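/- Assume Γ, F (of homogeneity degree k > 0), and f (with constants 0 < r₁ ≤ r₂) satisfy the structure conditions of the context. Let ρ₀ : Sⁿ → (0,∞) be smooth and admissible, set R₁ = min(r₁, min_{Sⁿ}ρ₀) and R₂ = max(r₂, max_{Sⁿ}ρ₀), and assume condition (4.1): 𝓕[ρ₀] ≥ 0 everywhere if k ≤ 1; and if k > 1, 0 ≤ −𝓕[ρ₀](x) ≤ (kR₁/((k+1)R₂))·min{f(Y) : R₁ ≤ |Y| ≤ R₂} for every x ∈ Sⁿ. Then there exists a constant C > 0, depending only on f, r₁, r₂ and ρ₀ (in particular independent of T), such that for every T > 0 and every admissible solution ρ : [0,T]×Sⁿ → (0,∞) of the flow ∂ₜρ = 𝓕[ρ(t,·)] with initial datum ρ₀, the principal curvatures satisfy max_{1≤i≤n}|κᵢ[ρ(t,·)](x)| ≤ C for all (t,x) ∈ [0,T]×Sⁿ. -/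

import Mathlib

open scoped RealInnerProductSpace
open Set

noncomputable section

/-- Euclidean `n`-space. -/
abbrev E (n : ℕ) := EuclideanSpace ℝ (Fin n)

/-- The Euclidean Hessian bilinear form at `x` of (the 0-homogeneous extension of) a
function `ρ` on the sphere, evaluated on the pair of vectors `(u, w)`. -/
def hess {n : ℕ} (ρ : E n → ℝ) (x u w : E n) : ℝ :=
  ⟪fderiv ℝ (gradient ρ) x u, w⟫

/-- The induced metric `g` of the starshaped hypersurface with radial function `ρ`,
as a bilinear form on the tangent space `x^⊥`. -/
def gForm {n : ℕ} (ρ : E n → ℝ) (x u w : E n) : ℝ :=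
  (ρ x) ^ 2 * ⟪u, w⟫ + ⟪gradient ρ x, u⟫ * ⟪gradient ρ x, w⟫

/-- The second fundamental form `h` of the starshaped hypersurface with radial function `ρ`,
as a bilinear form on the tangent space `x^⊥`. -/
def hForm {n : ℕ} (ρ : E n → ℝ) (x u w : E n) : ℝ :=
  ((ρ x) ^ 2 * ⟪u, w⟫ + 2 * ⟪gradient ρ x, u⟫ * ⟪gradient ρ x, w⟫
      - ρ x * hess ρ x u w) / Real.sqrt ((ρ x) ^ 2 + ‖gradient ρ x‖ ^ 2)

/-- `κ : Fin n → ℝ` is (an ordering of) the vector of principal curvatures at the point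
`ρ(x)·x` of the starshaped hypersurface with radial function `ρ` : the generalized
eigenvalues of the second fundamental form `h` with respect to the metric `g` on the
tangent space `x^⊥` (equivalently, the eigenvalues of the matrix `a = b·h·b`). -/
def HasPrincCurv {n : ℕ} (ρ : E (n + 1) → ℝ) (x : E (n + 1)) (κ : Fin n → ℝ) : Prop :=
  ∃ w : Fin n → E (n + 1), LinearIndependent ℝ w ∧ (∀ i, ⟪x, w i⟫ = 0) ∧
    ∀ i, ∀ u : E (n + 1), ⟪x, u⟫ = 0 →
      hForm ρ x u (w i) = κ i * gForm ρ x u (w i)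

/-- A radial function `ρ` is admissible if its principal curvature vector lies in `Γ`
at every point of the sphere. -/
def Admissible {n : ℕ} (Γ : Set (Fin n → ℝ)) (ρ : E (n + 1) → ℝ) : Prop :=
  ∀ x : E (n + 1), ‖x‖ = 1 → ∃ κ ∈ Γ, HasPrincCurv ρ x κ

/-- The value `𝓕[ρ](x)` of the flow operator, expressed through a principal
curvature vector `κ` of `ρ` at `x`. -/
def calF {n : ℕ} (F : (Fin n → ℝ) → ℝ) (f : E (n + 1) → ℝ)
    (ρ : E (n + 1) → ℝ) (x : E (n + 1)) (κ : Fin n → ℝ) : ℝ :=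
  (1 / F κ - f (ρ x • x)) * Real.sqrt ((ρ x) ^ 2 + ‖gradient ρ x‖ ^ 2) / ρ x

/-- `Γ` is an open convex symmetric cone with vertex at the origin containing the
positive cone. -/
def GoodCone {n : ℕ} (Γ : Set (Fin n → ℝ)) : Prop :=
  IsOpen Γ ∧ Convex ℝ Γ ∧ 0 ∉ Γ ∧
    (∀ t : ℝ, ∀ l ∈ Γ, 0 < t → t • l ∈ Γ) ∧
    (∀ σ : Equiv.Perm (Fin n), ∀ l ∈ Γ, l ∘ σ ∈ Γ) ∧
    (∀ l : Fin n → ℝ, (∀ i, 0 < l i) → l ∈ Γ)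

/-- Structure conditions (1.3)-(1.6) on the curvature function `F`:
positivity, smoothness, symmetry, monotonicity, homogeneity of degree `k`,
log-concavity and normalization. -/
def GoodF {n : ℕ} (Γ : Set (Fin n → ℝ)) (F : (Fin n → ℝ) → ℝ) (k : ℝ) : Prop :=
  (∀ l ∈ Γ, 0 < F l) ∧ ContDiffOn ℝ (⊤ : ℕ∞) F Γ ∧
    (∀ σ : Equiv.Perm (Fin n), ∀ l ∈ Γ, F (l ∘ σ) = F l) ∧
    (∀ l ∈ Γ, ∀ i, 0 < fderiv ℝ F l (Pi.single i 1)) ∧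
    (∀ t : ℝ, ∀ l ∈ Γ, 0 < t → F (t • l) = t ^ k * F l) ∧
    ConcaveOn ℝ Γ (fun l => Real.log (F l)) ∧
    F (fun _ => 1) = 1

/-- `F` extends continuously by `0` to the boundary of `Γ`. -/
def FVanishesOnBoundary {n : ℕ} (Γ : Set (Fin n → ℝ)) (F : (Fin n → ℝ) → ℝ) : Prop :=
  ∀ l ∈ frontier Γ, Filter.Tendsto F (nhdsWithin l Γ) (nhds 0)

/-- Conditions (1.7)-(1.8) on the prescribed function `f`. -/
def GoodPrescribed {n : ℕ} (f : E (n + 1) → ℝ) (k r₁ r₂ : ℝ) : Prop :=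
  ContDiffOn ℝ (⊤ : ℕ∞) f {X | X ≠ 0} ∧ (∀ X : E (n + 1), X ≠ 0 → 0 < f X) ∧
    (∀ x : E (n + 1), ‖x‖ = 1 → ∀ r : ℝ, 0 < r →
      0 < deriv (fun s : ℝ => s ^ (-k) * f (s • x)) r) ∧
    0 < r₁ ∧ r₁ ≤ r₂ ∧
    (∀ X : E (n + 1), ‖X‖ = r₁ → f X ≤ r₁ ^ k) ∧
    (∀ X : E (n + 1), ‖X‖ = r₂ → r₂ ^ k ≤ f X)

/-- A smooth positive function on the sphere, given by its 0-homogeneous extension. -/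
def GoodInit {n : ℕ} (ρ₀ : E (n + 1) → ℝ) : Prop :=
  ContDiffOn ℝ (⊤ : ℕ∞) ρ₀ {y | y ≠ 0} ∧
    (∀ c : ℝ, 0 < c → ∀ y : E (n + 1), ρ₀ (c • y) = ρ₀ y) ∧
    (∀ x : E (n + 1), ‖x‖ = 1 → 0 < ρ₀ x)

/-- `ρ` is an admissible solution on `[0,T]` of the flow `∂ₜρ = 𝓕[ρ(t,·)]` (the radial
formulation (2.10) of the curvature flow (1.2)) with initial datum `ρ₀`. -/
def IsFlowSol {n : ℕ} (Γ : Set (Fin n → ℝ)) (F : (Fin n → ℝ) → ℝ)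
    (f : E (n + 1) → ℝ) (T : ℝ) (ρ : ℝ → E (n + 1) → ℝ) (ρ₀ : E (n + 1) → ℝ) : Prop :=
  ContDiffOn ℝ (⊤ : ℕ∞) (fun p : ℝ × E (n + 1) => ρ p.1 p.2) (univ ×ˢ {y | y ≠ 0}) ∧
    (∀ t ∈ Icc (0 : ℝ) T, ∀ c : ℝ, 0 < c → ∀ y : E (n + 1), ρ t (c • y) = ρ t y) ∧
    (∀ t ∈ Icc (0 : ℝ) T, ∀ x : E (n + 1), ‖x‖ = 1 → 0 < ρ t x) ∧
    (∀ t ∈ Icc (0 : ℝ) T, Admissible Γ (ρ t)) ∧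
    (∀ t ∈ Icc (0 : ℝ) T, ∀ x : E (n + 1), ‖x‖ = 1 → ∀ κ : Fin n → ℝ,
      HasPrincCurv (ρ t) x κ → deriv (fun s => ρ s x) t = calF F f (ρ t) x κ) ∧
    (∀ x : E (n + 1), ‖x‖ = 1 → ρ 0 x = ρ₀ x)

/-- Minimum of a function over the unit sphere. -/
def sphMin {n : ℕ} (u : E (n + 1) → ℝ) : ℝ := sInf (u '' {x : E (n + 1) | ‖x‖ = 1})

/-- Maximum of a function over the unit sphere. -/
def sphMax {n : ℕ} (u : E (n + 1) → ℝ) : ℝ := sSup (u '' {x : E (n + 1) | ‖x‖ = 1})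

/-- The `C^m`-norm on the sphere of a function, computed through the Euclidean
derivatives of its 0-homogeneous extension. -/
def CmNorm {n : ℕ} (m : ℕ) (u : E (n + 1) → ℝ) : ℝ :=
  ∑ j ∈ Finset.range (m + 1),
    sSup ((fun x => ‖iteratedFDeriv ℝ j u x‖) '' {x : E (n + 1) | ‖x‖ = 1})




/-- logarithmic derivative weights -/
def Bw {n : ℕ} (F : (Fin n → ℝ) → ℝ) (κ : Fin n → ℝ) (i : Fin n) : ℝ :=
  fderiv ℝ F κ (Pi.single i 1) / F κ

lemma Bw_pos {n : ℕ} {Γ : Set (Fin n → ℝ)} {F : (Fin n → ℝ) → ℝ} {k : ℝ} (hF : GoodF Γ F k)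
    {κ : Fin n → ℝ} (hκ : κ ∈ Γ) (i : Fin n) : 0 < Bw F κ i :=
  div_pos (hF.2.2.2.1 κ hκ i) (hF.1 κ hκ)

lemma F_diff {n : ℕ} {Γ : Set (Fin n → ℝ)} (hΓ : GoodCone Γ) {F : (Fin n → ℝ) → ℝ} {k : ℝ}
    (hF : GoodF Γ F k) {κ : Fin n → ℝ} (hκ : κ ∈ Γ) : DifferentiableAt ℝ F κ :=
  (hF.2.1.contDiffAt (hΓ.1.mem_nhds hκ)).differentiableAt (by simp)

lemma fderiv_eq_sum {n : ℕ} (L : (Fin n → ℝ) →L[ℝ] ℝ) (v : Fin n → ℝ) :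
    L v = ∑ i, v i * L (Pi.single i 1) := by
  conv_lhs => rw [pi_eq_sum_univ' v]
  simp

lemma F_euler {n : ℕ} {Γ : Set (Fin n → ℝ)} (hΓ : GoodCone Γ) {F : (Fin n → ℝ) → ℝ} {k : ℝ}
    (hF : GoodF Γ F k) {κ : Fin n → ℝ} (hκ : κ ∈ Γ) : ∑ i, Bw F κ i * κ i = k := by
  have h1 : HasDerivAt (fun t : ℝ => F (t • κ)) (fderiv ℝ F κ κ) 1 := by
    have hd : HasFDerivAt F (fderiv ℝ F κ) ((1:ℝ) • κ) := by
      rw [one_smul]; exact (F_diff hΓ hF hκ).hasFDerivAt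
    have hs : HasDerivAt (fun t : ℝ => t • κ) κ 1 := by
      simpa using (hasDerivAt_id (1:ℝ)).smul_const κ
    exact hd.comp_hasDerivAt 1 hs
  have h2 : HasDerivAt (fun t : ℝ => t ^ k * F κ) (k * F κ) 1 := by
    have := (Real.hasDerivAt_rpow_const (x := 1) (p := k) (Or.inl one_ne_zero)).mul_const (F κ)
    simpa using this
  have h3 : HasDerivAt (fun t : ℝ => F (t • κ)) (k * F κ) 1 := by
    apply h2.congr_of_eventuallyEq
    filter_upwards [lt_mem_nhds (zero_lt_one (α := ℝ))] with t ht
    exact hF.2.2.2.2.1 t κ hκ ht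
  have h4 := h1.unique h3
  rw [fderiv_eq_sum] at h4
  have hp := hF.1 κ hκ
  unfold Bw
  have : ∑ i, fderiv ℝ F κ (Pi.single i 1) / F κ * κ i = (k * F κ) / F κ := by
    rw [← h4, Finset.sum_div]
    exact Finset.sum_congr rfl fun i _ => by ring
  rw [this]; field_simp

lemma F_tangent {n : ℕ} {Γ : Set (Fin n → ℝ)} (hΓ : GoodCone Γ) {F : (Fin n → ℝ) → ℝ} {k : ℝ}
    (hF : GoodF Γ F k) {κ l : Fin n → ℝ} (hκ : κ ∈ Γ) (hl : l ∈ Γ) :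
    Real.log (F l) ≤ Real.log (F κ) + ∑ i, Bw F κ i * (l i - κ i) := by
  have hp := hF.1 κ hκ
  have h1 : HasDerivAt (fun t : ℝ => Real.log (F (κ + t • (l - κ))))
      (fderiv ℝ F κ (l - κ) / F κ) 0 := by
    have hd : HasFDerivAt F (fderiv ℝ F κ) (κ + (0:ℝ) • (l - κ)) := by
      simpa using (F_diff hΓ hF hκ).hasFDerivAt
    have hs : HasDerivAt (fun t : ℝ => κ + t • (l - κ)) (l - κ) 0 := by
      simpa using ((hasDerivAt_id (0:ℝ)).smul_const (l - κ)).const_add κ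
    have := (hd.comp_hasDerivAt 0 hs).log (by simpa using hp.ne')
    simpa using this
  have h2 : fderiv ℝ F κ (l - κ) / F κ = ∑ i, Bw F κ i * (l i - κ i) := by
    rw [fderiv_eq_sum, Finset.sum_div]
    exact Finset.sum_congr rfl fun i _ => by simp [Bw]; ring
  rw [h2] at h1
  have h3 := h1.tendsto_slope_zero_right
  have h4 : Real.log (F l) - Real.log (F κ) ≤ ∑ i, Bw F κ i * (l i - κ i) := by
    refine ge_of_tendsto h3 ?_
    have : Ioo (0:ℝ) 1 ∈ nhdsWithin (0:ℝ) (Ioi 0) := Ioo_mem_nhdsGT zero_lt_one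
    filter_upwards [this] with t ht
    have h1t : (0:ℝ) ≤ 1 - t := by linarith [ht.2]
    have hc := hF.2.2.2.2.2.1.2 hκ hl h1t ht.1.le (by ring)
    have he : (1 - t) • κ + t • l = κ + (0 + t) • (l - κ) := by
      ext i; simp; ring
    simp only [smul_eq_mul] at hc
    rw [he] at hc
    simp only [smul_eq_mul, zero_smul, add_zero] at hc ⊢
    rw [inv_mul_eq_div, le_div_iff₀ ht.1]
    simp only [zero_add] at hc ⊢
    linarith
  linarith

lemma F_birkhoff {n : ℕ} {Γ : Set (Fin n → ℝ)} (hΓ : GoodCone Γ) {F : (Fin n → ℝ) → ℝ} {k : ℝ}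
    (hF : GoodF Γ F k) {κ : Fin n → ℝ} (hκ : κ ∈ Γ) (M : Matrix (Fin n) (Fin n) ℝ)
    (hM : M ∈ doublyStochastic ℝ (Fin n)) :
    M.mulVec κ ∈ Γ ∧ Real.log (F κ) ≤ Real.log (F (M.mulVec κ)) := by
  obtain ⟨w, hw0, hw1, hw⟩ := exists_eq_sum_perm_of_mem_doublyStochastic hM
  have he : M.mulVec κ = ∑ σ : Equiv.Perm (Fin n), w σ • (κ ∘ σ) := by
    rw [← hw, Matrix.sum_mulVec]
    refine Finset.sum_congr rfl fun σ _ => ?_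
    rw [Matrix.smul_mulVec, Matrix.permMatrix_mulVec]
  have hmem : ∀ σ ∈ (Finset.univ : Finset (Equiv.Perm (Fin n))), κ ∘ σ ∈ Γ :=
    fun σ _ => hΓ.2.2.2.2.1 σ κ hκ
  rw [he]
  refine ⟨hΓ.2.1.sum_mem (fun σ _ => hw0 σ) hw1 hmem, ?_⟩
  have := hF.2.2.2.2.2.1.le_map_sum (fun σ _ => hw0 σ) hw1 hmem
  refine le_trans (le_of_eq ?_) this
  have : ∀ σ : Equiv.Perm (Fin n), F (κ ∘ σ) = F κ := fun σ => hF.2.2.1 σ κ hκ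
  simp only [this, smul_eq_mul, ← Finset.sum_mul, hw1, one_mul]

lemma F_mono {n : ℕ} {Γ : Set (Fin n → ℝ)} (hΓ : GoodCone Γ) {F : (Fin n → ℝ) → ℝ} {k : ℝ}
    (hF : GoodF Γ F k) {κ l : Fin n → ℝ} (hκ : κ ∈ Γ) (hl : l ∈ Γ) (h : ∀ i, l i ≤ κ i) :
    F l ≤ F κ := by
  have h1 := F_tangent hΓ hF hκ hl
  have h2 : ∑ i, Bw F κ i * (l i - κ i) ≤ 0 :=
    Finset.sum_nonpos fun i _ => mul_nonpos_of_nonneg_of_nonpos (Bw_pos hF hκ i).le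
      (by linarith [h i])
  exact (Real.log_le_log_iff (hF.1 l hl) (hF.1 κ hκ)).1 (by linarith)

lemma F_const {n : ℕ} {Γ : Set (Fin n → ℝ)} (hΓ : GoodCone Γ) {F : (Fin n → ℝ) → ℝ} {k : ℝ}
    (hF : GoodF Γ F k) {c : ℝ} (hc : 0 < c) :
    (fun _ => c : Fin n → ℝ) ∈ Γ ∧ F (fun _ => c) = c ^ k := by
  refine ⟨hΓ.2.2.2.2.2 _ fun _ => hc, ?_⟩
  have h := hF.2.2.2.2.1 c (fun _ => 1) (hΓ.2.2.2.2.2 _ fun _ => one_pos) hc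
  have e : c • (fun _ => (1:ℝ) : Fin n → ℝ) = fun _ => c := by ext; simp
  rw [e, hF.2.2.2.2.2.2, mul_one] at h
  exact h

lemma cone_sum_pos {n : ℕ} (hn : 2 ≤ n) {Γ : Set (Fin n → ℝ)} (hΓ : GoodCone Γ)
    {κ : Fin n → ℝ} (hκ : κ ∈ Γ) : 0 < ∑ i, κ i := by
  have hn0 : (0:ℝ) < n := by exact_mod_cast (by omega : 0 < n)
  by_contra hneg
  push Not at hneg
  set M : Matrix (Fin n) (Fin n) ℝ := fun _ _ => 1 / n with hMd
  have hM : M ∈ doublyStochastic ℝ (Fin n) := by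
    rw [mem_doublyStochastic_iff_sum]
    refine ⟨fun i j => by positivity, fun i => ?_, fun i => ?_⟩ <;> simp [hMd, hn0.ne']
  obtain ⟨w, hw0, hw1, hw⟩ := exists_eq_sum_perm_of_mem_doublyStochastic hM
  have he : M.mulVec κ = ∑ σ : Equiv.Perm (Fin n), w σ • (κ ∘ σ) := by
    rw [← hw, Matrix.sum_mulVec]
    refine Finset.sum_congr rfl fun σ _ => ?_
    rw [Matrix.smul_mulVec, Matrix.permMatrix_mulVec]
  have hmem : M.mulVec κ ∈ Γ := by
    rw [he]
    exact hΓ.2.1.sum_mem (fun σ _ => hw0 σ) hw1 fun σ _ => hΓ.2.2.2.2.1 σ κ hκ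
  have hm : M.mulVec κ = fun _ => (∑ i, κ i) / n := by
    ext i; simp [hMd, Matrix.mulVec, dotProduct, div_eq_inv_mul, Finset.mul_sum]
  rw [hm] at hmem
  set a := (∑ i, κ i) / n with ha
  have ha0 : a ≤ 0 := div_nonpos_of_nonpos_of_nonneg hneg hn0.le
  have hb := (hΓ.2.2.2.2.2 (fun _ => 1 - a) fun _ => by linarith)
  have g1 : 0 ≤ (1 - a) / (1 - 2 * a) := by apply div_nonneg <;> linarith
  have g2 : 0 ≤ - a / (1 - 2 * a) := by apply div_nonneg <;> linarith
  have := hΓ.2.1 hmem hb g1 g2 (by rw [← add_div, div_eq_one_iff_eq] <;> linarith)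
  apply hΓ.2.2.1
  convert this using 1
  ext i; simp; ring


/-- `e` is an orthonormal frame of the hyperplane orthogonal to `p` -/
def Frame {n : ℕ} (p : E (n + 1)) (e : Fin n → E (n + 1)) : Prop :=
  Orthonormal ℝ e ∧ ∀ i, ⟪p, e i⟫ = 0

/-- frame that diagonalises the form `A` on the hyperplane orthogonal to `p` -/
def IsData {n : ℕ} (p : E (n + 1)) (A : E (n + 1) →L[ℝ] E (n + 1) →L[ℝ] ℝ) (κ : Fin n → ℝ)
    (e : Fin n → E (n + 1)) : Prop :=
  Frame p e ∧ ∀ i U, ⟪p, U⟫ = 0 → A U (e i) = κ i * ⟪U, e i⟫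

lemma Frame.basis {n : ℕ} {p : E (n + 1)} {e : Fin n → E (n + 1)} (h : Frame p e) (hp : p ≠ 0) :
    ∃ b : OrthonormalBasis (Fin (n + 1)) ℝ (E (n + 1)), b 0 = ‖p‖⁻¹ • p ∧ ∀ i, b (Fin.succ i) = e i := by
  have hp' : ‖p‖ ≠ 0 := norm_ne_zero_iff.2 hp
  have ho : Orthonormal ℝ (Fin.cons (‖p‖⁻¹ • p) e : Fin (n + 1) → E (n + 1)) := by
    rw [orthonormal_iff_ite]
    intro i j
    have h1 := orthonormal_iff_ite.1 h.1
    refine Fin.cases ?_ (fun i => ?_) i <;> refine Fin.cases ?_ (fun j => ?_) j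
    · rw [Fin.cons_zero, real_inner_self_eq_norm_sq, norm_smul, norm_inv, norm_norm, inv_mul_cancel₀ hp']; simp
    · simp [inner_smul_left, h.2 j, (Fin.succ_ne_zero j).symm]
    · rw [real_inner_comm]; simp [inner_smul_left, h.2 i, (Fin.succ_ne_zero i)]
    · simp [h1 i j]
  refine ⟨OrthonormalBasis.mk ho ?_, ?_, ?_⟩
  · have := (basisOfOrthonormalOfCardEqFinrank ho (by simp)).span_eq
    rw [coe_basisOfOrthonormalOfCardEqFinrank] at this
    exact this.ge
  · simp
  · intro i; simp

lemma Frame.expand {n : ℕ} {p : E (n + 1)} {e : Fin n → E (n + 1)} (h : Frame p e) (hp : p ≠ 0)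
    (v : E (n + 1)) : v = (⟪p, v⟫ / ‖p‖ ^ 2) • p + ∑ i, ⟪e i, v⟫ • e i := by
  obtain ⟨b, b0, bs⟩ := h.basis hp
  have := b.sum_repr' v
  rw [Fin.sum_univ_succ] at this
  simp only [b0, bs, inner_smul_left, smul_smul] at this
  conv_lhs => rw [← this]
  congr 2
  simp; field_simp

lemma Frame.norm_sq {n : ℕ} {p : E (n + 1)} {e : Fin n → E (n + 1)} (h : Frame p e) (hp : p ≠ 0)
    (v : E (n + 1)) : ‖v‖ ^ 2 = ⟪p, v⟫ ^ 2 / ‖p‖ ^ 2 + ∑ i, ⟪e i, v⟫ ^ 2 := by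
  obtain ⟨b, b0, bs⟩ := h.basis hp
  have := b.sum_sq_norm_inner_right v
  rw [Fin.sum_univ_succ] at this
  simp only [b0, bs, inner_smul_left, Real.norm_eq_abs, sq_abs] at this
  rw [← this]
  simp; field_simp

lemma IsData.diag {n : ℕ} {p : E (n + 1)} {A : E (n + 1) →L[ℝ] E (n + 1) →L[ℝ] ℝ} {κ : Fin n → ℝ}
    {e : Fin n → E (n + 1)} (h : IsData p A κ e) (hp : p ≠ 0) {V : E (n + 1)} (hV : ⟪p, V⟫ = 0) :
    A V V = ∑ j, ⟪e j, V⟫ ^ 2 * κ j := by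
  have hx := h.1.expand hp V
  rw [hV, zero_div, zero_smul, zero_add] at hx
  have : A V V = A V (∑ i, ⟪e i, V⟫ • e i) := by rw [← hx]
  rw [this, map_sum]
  refine Finset.sum_congr rfl fun i _ => ?_
  rw [map_smul, h.2 i V hV, real_inner_comm]; simp; ring

lemma SG {n : ℕ} {Γ : Set (Fin n → ℝ)} (hΓ : GoodCone Γ) {F : (Fin n → ℝ) → ℝ} {k : ℝ}
    (hF : GoodF Γ F k) {κ κ' : Fin n → ℝ} (hκ : κ ∈ Γ) (hκ' : κ' ∈ Γ) {p : E (n + 1)} (hp : p ≠ 0)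
    {A : E (n + 1) →L[ℝ] E (n + 1) →L[ℝ] ℝ} {e : Fin n → E (n + 1)} (h : IsData p A κ e)
    {v : Fin n → E (n + 1)} (hv : Frame p v) :
    Real.log (F κ) ≤ Real.log (F κ') + ∑ i, Bw F κ' i * (A (v i) (v i) - κ' i) := by
  set M : Matrix (Fin n) (Fin n) ℝ := fun i j => ⟪e j, v i⟫ ^ 2 with hMd
  have hM : M ∈ doublyStochastic ℝ (Fin n) := by
    rw [mem_doublyStochastic_iff_sum]
    refine ⟨fun i j => by positivity, fun i => ?_, fun j => ?_⟩
    · have := h.1.norm_sq hp (v i)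
      rw [hv.2 i, hv.1.1 i] at this
      simp at this
      simp [hMd, ← this]
    · have := hv.norm_sq hp (e j)
      rw [h.1.2 j, h.1.1.1 j] at this
      simp at this
      simp only [hMd]
      rw [this]
      exact Finset.sum_congr rfl fun i _ => by rw [real_inner_comm]
  obtain ⟨h1, h2⟩ := F_birkhoff hΓ hF hκ M hM
  have h3 := F_tangent hΓ hF hκ' h1
  have h4 : ∀ i, M.mulVec κ i = A (v i) (v i) := fun i => by
    rw [h.diag hp (hv.2 i)]; simp [hMd, Matrix.mulVec, dotProduct]
  simp only [h4] at h3
  linarith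

lemma exists_data {n : ℕ} {p : E (n + 1)} {A : E (n + 1) →L[ℝ] E (n + 1) →L[ℝ] ℝ} {κ : Fin n → ℝ}
    {w : Fin n → E (n + 1)} (hA : ∀ U V, A U V = A V U) (hw : LinearIndependent ℝ w)
    (hwp : ∀ i, ⟪p, w i⟫ = 0) (h : ∀ i U, ⟪p, U⟫ = 0 → A U (w i) = κ i * ⟪U, w i⟫) :
    ∃ e, IsData p A κ e := by
  have key : ∀ i, ⟪p, InnerProductSpace.gramSchmidt ℝ w i⟫ = 0 ∧ ∀ U, ⟪p, U⟫ = 0 →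
      A U (InnerProductSpace.gramSchmidt ℝ w i) = κ i * ⟪U, InnerProductSpace.gramSchmidt ℝ w i⟫ := by
    intro i
    induction i using WellFoundedLT.induction with
    | ind i ih =>
    have e1 : InnerProductSpace.gramSchmidt ℝ w i = w i - ∑ j ∈ Finset.Iio i,
        (⟪InnerProductSpace.gramSchmidt ℝ w j, w i⟫ / ‖InnerProductSpace.gramSchmidt ℝ w j‖ ^ 2) •
          InnerProductSpace.gramSchmidt ℝ w j := by
      have := InnerProductSpace.gramSchmidt_def'' ℝ w i
      rw [eq_sub_iff_add_eq]; exact this.symm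
    constructor
    · rw [e1, inner_sub_right, hwp, inner_sum, zero_sub, neg_eq_zero]
      refine Finset.sum_eq_zero fun j hj => ?_
      rw [inner_smul_right, (ih j (Finset.mem_Iio.1 hj)).1, mul_zero]
    · intro U hU
      rw [e1, map_sub, h i U hU, inner_sub_right, mul_sub, map_sum, inner_sum, Finset.mul_sum]
      congr 1
      refine Finset.sum_congr rfl fun j hj => ?_
      obtain ⟨i1, i2⟩ := ih j (Finset.mem_Iio.1 hj)
      rw [map_smul, i2 U hU, inner_smul_right]
      have a1 := i2 (w i) (hwp i)
      have a2 := h i _ i1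
      rw [hA] at a2
      have a3 : (κ j - κ i) * ⟪InnerProductSpace.gramSchmidt ℝ w j, w i⟫ = 0 := by
        rw [real_inner_comm (InnerProductSpace.gramSchmidt ℝ w j)] at a1
        linarith
      simp only [smul_eq_mul]
      have : ∀ a b c d e : ℝ, (a - b) * c = 0 → c / d * (a * e) = b * (c / d * e) := by
        intro a b c d e h
        have : c / d * (a * e) - b * (c / d * e) = (a - b) * c * e / d := by ring
        rw [h] at this; simp at this; linarith
      exact this _ _ _ _ _ a3
  refine ⟨InnerProductSpace.gramSchmidtNormed ℝ w, ⟨InnerProductSpace.gramSchmidtNormed_orthonormal hw, ?_⟩, ?_⟩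
  · intro i; simp [InnerProductSpace.gramSchmidtNormed, inner_smul_right, (key i).1]
  · intro i U hU
    simp only [InnerProductSpace.gramSchmidtNormed, map_smul, inner_smul_right, (key i).2 U hU]
    simp; ring

/-- reflecting a frame -/
lemma Frame.refl {n : ℕ} {p p' : E (n + 1)} {e : Fin n → E (n + 1)} (h : Frame p e)
    (hp : ‖p‖ = 1) (hp' : ‖p'‖ = 1) (hs : p + p' ≠ 0) :
    Frame p' (fun i => e i - (2 * ⟪p', e i⟫ / ‖p + p'‖ ^ 2) • (p + p')) := by
  have hs' : ‖p + p'‖ ^ 2 ≠ 0 := by positivity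
  have hN : ‖p + p'‖ ^ 2 = 2 + 2 * ⟪p, p'⟫ := by
    rw [norm_add_sq_real, hp, hp']; ring
  have a1 : ∀ i, ⟪e i, p + p'⟫ = ⟪p', e i⟫ := fun i => by
    rw [inner_add_right, real_inner_comm, h.2, real_inner_comm, zero_add]
  constructor
  · rw [orthonormal_iff_ite]
    intro i j
    rw [← orthonormal_iff_ite.1 h.1 i j]
    rw [inner_sub_left, inner_sub_right, inner_sub_right, inner_smul_left, inner_smul_right, inner_smul_left,
      inner_smul_right, real_inner_self_eq_norm_sq, a1, real_inner_comm (e j) (p + p'), a1, conj_trivial]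
    field_simp
    ring
  · intro i
    rw [inner_sub_right, inner_smul_right, inner_add_right, real_inner_self_eq_norm_sq, hp', real_inner_comm p p']
    have : ‖p + p'‖ ^ 2 = 2 * (⟪p, p'⟫ + 1 ^ 2) := by rw [hN]; ring
    have h2 : ⟪p, p'⟫ + 1 ^ 2 = ‖p + p'‖ ^ 2 / 2 := by linarith
    rw [h2]
    field_simp
    ring


lemma left_deriv_nonneg {g : ℝ → ℝ} {g' t a : ℝ} (hat : a < t) (hg : HasDerivAt g g' t)
    (h : ∀ s ∈ Ioo a t, g s ≤ g t) : 0 ≤ g' := by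
  have h1 := (hasDerivAt_iff_tendsto_slope_left_right.1 hg).1
  refine ge_of_tendsto h1 ?_
  filter_upwards [Ioo_mem_nhdsLT hat] with s hs
  rw [slope_def_field]
  exact div_nonneg_of_nonpos (by linarith [h s hs]) (by linarith [hs.2])

lemma MP {α : Type*} [TopologicalSpace α] {K : Set α} (hK : IsCompact K) {T m : ℝ} (hT : 0 < T)
    {w w' : ℝ → α → ℝ} (hc : ContinuousOn (fun q : ℝ × α => w q.1 q.2) (Icc 0 T ×ˢ K))
    (hd : ∀ t ∈ Ioo 0 T, ∀ x ∈ K, HasDerivAt (fun s => w s x) (w' t x) t)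
    (h0 : ∀ x ∈ K, w 0 x ≤ m)
    (hmax : ∀ t ∈ Ioo 0 T, ∀ x ∈ K, m < w t x → (∀ y ∈ K, w t y ≤ w t x) →
      ∃ x' ∈ K, w t x' = w t x ∧ w' t x' ≤ 0) :
    ∀ t ∈ Icc 0 T, ∀ x ∈ K, w t x ≤ m := by
  have main : ∀ t ∈ Ioo 0 T, ∀ x ∈ K, w t x ≤ m := by
    intro t1 ht1 x1 hx1
    by_contra! hlt
    obtain ⟨ε, hε, hε2⟩ : ∃ ε > 0, m < w t1 x1 - ε * t1 := by
      refine ⟨(w t1 x1 - m) / (2 * t1), div_pos (by linarith) (by linarith [ht1.1]), ?_⟩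
      have : (w t1 x1 - m) / (2 * t1) * t1 = (w t1 x1 - m) / 2 := by
        have := ht1.1.ne'
        field_simp
      linarith
    have hsub : Icc 0 t1 ×ˢ K ⊆ Icc 0 T ×ˢ K := prod_mono (Icc_subset_Icc_right ht1.2.le) subset_rfl
    obtain ⟨⟨ts, xs⟩, ⟨hts, hxs⟩, hm⟩ := (isCompact_Icc.prod hK).exists_isMaxOn
      (⟨(t1, x1), ⟨⟨ht1.1.le, le_rfl⟩, hx1⟩⟩ : (Icc 0 t1 ×ˢ K).Nonempty)
      (f := fun q : ℝ × α => w q.1 q.2 - ε * q.1)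
      ((hc.mono hsub).sub (by fun_prop))
    simp only at hts hxs
    have hm' : ∀ s ∈ Icc 0 t1, ∀ y ∈ K, w s y - ε * s ≤ w ts xs - ε * ts :=
      fun s hs y hy => hm (show (s, y) ∈ Icc 0 t1 ×ˢ K from ⟨hs, hy⟩)
    have h1 := hm' t1 ⟨ht1.1.le, le_rfl⟩ x1 hx1
    have hts0 : 0 < ts := by
      rcases hts.1.eq_or_lt with h | h
      · rw [← h] at h1; linarith [h0 xs hxs]
      · exact h
    have htsT : ts ∈ Ioo 0 T := ⟨hts0, hts.2.trans_lt ht1.2⟩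
    obtain ⟨x', hx', e, hle⟩ := hmax ts htsT xs hxs (by nlinarith)
      (fun y hy => by linarith [hm' ts hts y hy])
    have hder : HasDerivAt (fun s => w s x' - ε * s) (w' ts x' - ε * 1) ts :=
      (hd ts htsT x' hx').sub ((hasDerivAt_id ts).const_mul ε)
    have := left_deriv_nonneg hts0 hder (fun s hs => by
      have := hm' s ⟨hs.1.le, hs.2.le.trans hts.2⟩ x' hx'
      linarith)
    linarith
  intro t ht x hx
  rcases ht.1.eq_or_lt with h | h
  · rw [← h]; exact h0 x hx
  rcases ht.2.eq_or_lt with h' | h'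
  · subst h'
    have hcw : ContinuousWithinAt (fun s => w s x) (Icc 0 t) t :=
      (hc (t, x) ⟨ht, hx⟩).comp (t := Icc 0 t ×ˢ K) (f := fun s : ℝ => (s, x)) (by fun_prop) (fun s hs => ⟨hs, hx⟩)
    have hcw2 : ContinuousWithinAt (fun s => w s x) (Ioo 0 t) t := hcw.mono Ioo_subset_Icc_self
    have : (nhdsWithin t (Ioo 0 t)).NeBot := by
      rw [nhdsWithin_Ioo_eq_nhdsLT h]; infer_instance
    exact le_of_tendsto hcw2 (by filter_upwards [self_mem_nhdsWithin] with s hs using main s hs x hx)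
  · exact main t ⟨h, h'⟩ x hx

lemma MPexp {α : Type*} [TopologicalSpace α] {K : Set α} (hK : IsCompact K) {T m L : ℝ} (hT : 0 < T)
    (hL : 0 ≤ L) (hm : 0 ≤ m)
    {w w' : ℝ → α → ℝ} (hc : ContinuousOn (fun q : ℝ × α => w q.1 q.2) (Icc 0 T ×ˢ K))
    (hd : ∀ t ∈ Ioo 0 T, ∀ x ∈ K, HasDerivAt (fun s => w s x) (w' t x) t)
    (h0 : ∀ x ∈ K, w 0 x ≤ m)
    (hmax : ∀ t ∈ Ioo 0 T, ∀ x ∈ K, m < w t x → (∀ y ∈ K, w t y ≤ w t x) → w' t x ≤ L * w t x) :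
    ∀ t ∈ Icc 0 T, ∀ x ∈ K, w t x ≤ m * Real.exp (L * t) := by
  have := MP hK hT (m := m) (w := fun t x => Real.exp (-L * t) * w t x)
    (w' := fun t x => Real.exp (-L * t) * (-L * 1) * w t x + Real.exp (-L * t) * w' t x)
    (ContinuousOn.mul (by fun_prop) hc) (fun t ht x hx =>
      (((hasDerivAt_id t).const_mul (-L)).exp).mul (hd t ht x hx)) (by simpa using h0)
    (by
      intro t ht x hx h1 h2
      have he : 0 < Real.exp (-L * t) := Real.exp_pos _
      have he1 : Real.exp (-L * t) ≤ 1 := Real.exp_le_one_iff.2 (by nlinarith [ht.1])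
      have hw : 0 < w t x := by
        by_contra! h
        nlinarith
      refine ⟨x, hx, rfl, ?_⟩
      have := hmax t ht x hx (by nlinarith) (fun y hy => le_of_mul_le_mul_left (h2 y hy) he)
      nlinarith)
  intro t ht x hx
  have h := this t ht x hx
  have he : 0 < Real.exp (L * t) := Real.exp_pos _
  have e1 : Real.exp (L * t) * Real.exp (-L * t) = 1 := by rw [← Real.exp_add]; simp
  calc w t x = Real.exp (L * t) * (Real.exp (-L * t) * w t x) := by rw [← mul_assoc, e1, one_mul]
    _ ≤ Real.exp (L * t) * m := by gcongr
    _ = _ := mul_comm _ _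


/-- second order Taylor expansion at `0` -/
def T2 (g : ℝ → ℝ) (a b c : ℝ) : Prop :=
  (fun s => g s - (a + b * s + c * s ^ 2)) =o[nhds 0] (fun s : ℝ => s ^ 2)

lemma T2.iff {g : ℝ → ℝ} {a b c : ℝ} : T2 g a b c ↔ ∃ r : ℝ → ℝ, Filter.Tendsto r (nhds 0) (nhds 0) ∧
    g =ᶠ[nhds 0] fun s => a + b * s + c * s ^ 2 + r s * s ^ 2 := by
  unfold T2
  rw [Asymptotics.isLittleO_iff_exists_eq_mul]
  constructor
  · rintro ⟨r, h1, h2⟩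
    refine ⟨r, h1, ?_⟩
    filter_upwards [h2] with s hs
    simp at hs; linarith
  · rintro ⟨r, h1, h2⟩
    refine ⟨r, h1, ?_⟩
    filter_upwards [h2] with s hs
    simp; linarith

lemma T2.congr {g g' : ℝ → ℝ} {a b c : ℝ} (h : T2 g a b c) (he : ∀ᶠ s in nhds 0, g' s = g s) : T2 g' a b c := by
  refine Asymptotics.IsLittleO.congr' h ?_ (Filter.EventuallyEq.refl _ _)
  filter_upwards [he] with s hs; rw [hs]

lemma T2.coef {g : ℝ → ℝ} {a b c a' b' c' : ℝ} (h : T2 g a b c) (ha : a = a') (hb : b = b') (hc : c = c') :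
    T2 g a' b' c' := by subst ha hb hc; exact h

lemma T2.const (a : ℝ) : T2 (fun _ => a) a 0 0 := by
  simp [T2]

lemma T2.id : T2 (fun s => s) 0 1 0 := by
  simp [T2]

lemma T2.add {g g' : ℝ → ℝ} {a b c a' b' c' : ℝ} (h : T2 g a b c) (h' : T2 g' a' b' c') :
    T2 (fun s => g s + g' s) (a + a') (b + b') (c + c') := by
  refine (Asymptotics.IsLittleO.add h h').congr_left fun s => by ring

lemma T2.smul {g : ℝ → ℝ} {a b c : ℝ} (r : ℝ) (h : T2 g a b c) :
    T2 (fun s => r * g s) (r * a) (r * b) (r * c) := by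
  refine (Asymptotics.IsLittleO.const_mul_left h r).congr_left fun s => by ring

lemma T2.sub {g g' : ℝ → ℝ} {a b c a' b' c' : ℝ} (h : T2 g a b c) (h' : T2 g' a' b' c') :
    T2 (fun s => g s - g' s) (a - a') (b - b') (c - c') := by
  refine (Asymptotics.IsLittleO.sub h h').congr_left fun s => by ring

lemma T2.sum {ι : Type*} (S : Finset ι) {g : ι → ℝ → ℝ} {a b c : ι → ℝ} (h : ∀ i ∈ S, T2 (g i) (a i) (b i) (c i)) :
    T2 (fun s => ∑ i ∈ S, g i s) (∑ i ∈ S, a i) (∑ i ∈ S, b i) (∑ i ∈ S, c i) := by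
  classical
  induction S using Finset.induction_on with
  | empty => simpa using T2.const 0
  | insert i S hi ih =>
    simp only [Finset.sum_insert hi]
    exact (h i (by simp)).add (ih fun j hj => h j (by simp [hj]))

lemma T2.mul {g g' : ℝ → ℝ} {a b c a' b' c' : ℝ} (h : T2 g a b c) (h' : T2 g' a' b' c') :
    T2 (fun s => g s * g' s) (a * a') (a * b' + b * a') (a * c' + b * b' + c * a') := by
  obtain ⟨r, h1, h2⟩ := T2.iff.1 h
  obtain ⟨r', h1', h2'⟩ := T2.iff.1 h'
  refine T2.iff.2 ⟨fun s => (b * c' + c * b') * s + c * c' * s ^ 2 + r s * (a' + b' * s + c' * s ^ 2)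
    + r' s * (a + b * s + c * s ^ 2) + r s * r' s * s ^ 2, ?_, ?_⟩
  · have hs : Filter.Tendsto (fun s : ℝ => s) (nhds 0) (nhds 0) := Filter.tendsto_id
    have k := ((((hs.const_mul (b * c' + c * b')).add ((hs.pow 2).const_mul (c * c'))).add
      (h1.mul (((hs.const_mul b').const_add a').add ((hs.pow 2).const_mul c')))).add
      (h1'.mul (((hs.const_mul b).const_add a).add ((hs.pow 2).const_mul c)))).add ((h1.mul h1').mul (hs.pow 2))
    convert k using 2; simp
  · filter_upwards [h2, h2'] with s e1 e2
    rw [e1, e2]; ring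

lemma T2.tendsto {g : ℝ → ℝ} {a b c : ℝ} (h : T2 g a b c) : Filter.Tendsto g (nhds 0) (nhds a) := by
  obtain ⟨r, h1, h2⟩ := T2.iff.1 h
  rw [Filter.tendsto_congr' h2]
  have hs : Filter.Tendsto (fun s : ℝ => s) (nhds 0) (nhds 0) := Filter.tendsto_id
  have k := (((hs.const_mul b).const_add a).add ((hs.pow 2).const_mul c)).add (h1.mul (hs.pow 2))
  convert k using 2; simp

lemma T2.eval {g : ℝ → ℝ} {a b c : ℝ} (h : T2 g a b c) : g 0 = a := by
  obtain ⟨r, h1, h2⟩ := T2.iff.1 h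
  have := h2.eq_of_nhds
  simpa using this

lemma T2.lin_sign {g : ℝ → ℝ} {b c : ℝ} (h : T2 g 0 b c) (hs : ∀ᶠ s in nhds 0, 0 ≤ g s) : 0 ≤ b := by
  obtain ⟨r, h1, h2⟩ := T2.iff.1 h
  have hs' : Filter.Tendsto (fun s : ℝ => s) (nhds 0) (nhds 0) := Filter.tendsto_id
  have k : Filter.Tendsto (fun s : ℝ => b + c * s + r s * s) (nhds 0) (nhds b) := by
    convert ((hs'.const_mul c).const_add b).add (h1.mul hs') using 2; simp
  refine ge_of_tendsto (k.mono_left (nhdsWithin_le_nhds (s := Ioi 0))) ?_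
  filter_upwards [nhdsWithin_le_nhds h2, nhdsWithin_le_nhds hs, self_mem_nhdsWithin] with s e1 e2 e3
  rw [e1] at e2
  have : 0 ≤ s * (b + c * s + r s * s) := by linarith [e2]
  exact nonneg_of_mul_nonneg_right this e3

lemma T2.neg_arg {g : ℝ → ℝ} {a b c : ℝ} (h : T2 g a b c) : T2 (fun s => g (-s)) a (-b) c := by
  have : Filter.Tendsto (fun s : ℝ => -s) (nhds 0) (nhds 0) := by
    simpa using (continuous_neg (G := ℝ)).tendsto 0
  refine (Asymptotics.IsLittleO.comp_tendsto h this).congr (fun s => ?_) (fun s => ?_)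
  · simp
  · simp

lemma T2.sign {g : ℝ → ℝ} {b c : ℝ} (h : T2 g 0 b c) (hs : ∀ᶠ s in nhds 0, 0 ≤ g s) : b = 0 ∧ 0 ≤ c := by
  have hneg : Filter.Tendsto (fun s : ℝ => -s) (nhds 0) (nhds 0) := by
    simpa using (continuous_neg (G := ℝ)).tendsto 0
  have hb : b = 0 := le_antisymm (by linarith [h.neg_arg.lin_sign (hneg.eventually hs)]) (h.lin_sign hs)
  refine ⟨hb, ?_⟩
  subst hb
  obtain ⟨r, h1, h2⟩ := T2.iff.1 h
  have k : Filter.Tendsto (fun s : ℝ => c + r s) (nhds 0) (nhds c) := by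
    simpa using h1.const_add c
  refine ge_of_tendsto (k.mono_left (nhdsWithin_le_nhds (s := Ioi 0))) ?_
  filter_upwards [nhdsWithin_le_nhds h2, nhdsWithin_le_nhds hs, self_mem_nhdsWithin] with s e1 e2 e3
  rw [e1] at e2
  have : 0 ≤ s ^ 2 * (c + r s) := by linarith [e2]
  exact nonneg_of_mul_nonneg_right this (pow_pos e3 2)

lemma T2.unique {g : ℝ → ℝ} {a b c a' b' c' : ℝ} (h : T2 g a b c) (h' : T2 g a' b' c') :
    a = a' ∧ b = b' ∧ c = c' := by
  have ha : a = a' := by rw [← h.eval, h'.eval]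
  subst ha
  have k1 : T2 (fun _ => 0) 0 (b - b') (c - c') := by
    simpa using (h.sub h')
  have k2 : T2 (fun _ => 0) 0 (b' - b) (c' - c) := by
    simpa using (h'.sub h)
  have s1 := k1.sign (by simp)
  have s2 := k2.sign (by simp)
  exact ⟨rfl, by linarith, by linarith⟩

lemma T2.of_hasDerivAt {g g1 : ℝ → ℝ} {g2 : ℝ} (h : ∀ᶠ s in nhds 0, HasDerivAt g (g1 s) s)
    (h2 : HasDerivAt g1 g2 0) : T2 g (g 0) (g1 0) (g2 / 2) := by
  unfold T2
  rw [Asymptotics.isLittleO_iff]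
  intro ε hε
  have h3 := (hasDerivAt_iff_isLittleO.1 h2).def hε
  obtain ⟨δ, hδ, hb⟩ := Metric.eventually_nhds_iff_ball.1 (h.and h3)
  filter_upwards [Metric.ball_mem_nhds (0 : ℝ) hδ] with s hs
  have hsub : ∀ y ∈ Metric.closedBall (0 : ℝ) |s|, y ∈ Metric.ball (0 : ℝ) δ := fun y hy => by
    simp at hy hs ⊢; linarith
  have key := (convex_closedBall (0 : ℝ) |s|).norm_image_sub_le_of_norm_hasDerivWithin_le
    (f := fun s => g s - (g 0 + g1 0 * s + g2 / 2 * s ^ 2)) (f' := fun s => g1 s - (g1 0 + g2 * s))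
    (C := ε * |s|) (x := 0) (y := s)
    (fun y hy => by
      have := ((hb y (hsub y hy)).1.sub ((((hasDerivAt_id y).const_mul (g1 0)).const_add (g 0)).add
        (((hasDerivAt_id y).pow 2).const_mul (g2 / 2))))
      refine (this.congr_deriv ?_).hasDerivWithinAt
      simp; ring)
    (fun y hy => by
      have := (hb y (hsub y hy)).2
      simp at this hy ⊢
      have e : g1 y - (g1 0 + g2 * y) = g1 y - g1 0 - y * g2 := by ring
      rw [e]
      refine this.trans (by gcongr)) (by simp) (by simp)
  simp at key ⊢
  refine key.trans_eq ?_
  rw [mul_assoc, ← sq, sq_abs]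

lemma T2.of_contDiffAt {g : ℝ → ℝ} (h : ContDiffAt ℝ 2 g 0) : ∃ b c, T2 g (g 0) b c := by
  have h1 : ContDiffAt ℝ 1 (deriv g) 0 := by
    have := h.fderiv_right (m := 1) (by norm_num)
    have e : deriv g = fun s => fderiv ℝ g s 1 := by ext s; simp
    rw [e]
    exact this.clm_apply contDiffAt_const
  have h2 := (h1.differentiableAt (by norm_num)).hasDerivAt
  refine ⟨_, _, T2.of_hasDerivAt ?_ h2⟩
  have := h.eventually (by simp)
  filter_upwards [this] with s hs
  exact (hs.differentiableAt (by norm_num)).hasDerivAt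

/-! directional derivatives -/
section dd
variable {Y : Type*} [NormedAddCommGroup Y] [NormedSpace ℝ Y]

/-- directional derivative -/
def dd (v : Y) (G : Y → ℝ) : Y → ℝ := fun y => fderiv ℝ G y v

lemma sm_at {U : Set Y} (hU : IsOpen U) {G : Y → ℝ} (h : ContDiffOn ℝ (⊤ : ℕ∞) G U) {y : Y} (hy : y ∈ U) :
    ContDiffAt ℝ (⊤ : ℕ∞) G y := h.contDiffAt (hU.mem_nhds hy)

lemma sm_diff {U : Set Y} (hU : IsOpen U) {G : Y → ℝ} (h : ContDiffOn ℝ (⊤ : ℕ∞) G U) {y : Y} (hy : y ∈ U) :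
    DifferentiableAt ℝ G y := (sm_at hU h hy).differentiableAt (by simp)

lemma sm_fderiv {U : Set Y} (hU : IsOpen U) {G : Y → ℝ} (h : ContDiffOn ℝ (⊤ : ℕ∞) G U) :
    ContDiffOn ℝ (⊤ : ℕ∞) (fderiv ℝ G) U := h.fderiv_of_isOpen hU (by simp)

lemma sm_dd {U : Set Y} (hU : IsOpen U) {G : Y → ℝ} (h : ContDiffOn ℝ (⊤ : ℕ∞) G U) (v : Y) :
    ContDiffOn ℝ (⊤ : ℕ∞) (dd v G) U := (sm_fderiv hU h).clm_apply contDiffOn_const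

lemma dd_dd {U : Set Y} (hU : IsOpen U) {G : Y → ℝ} (h : ContDiffOn ℝ (⊤ : ℕ∞) G U) {y : Y} (hy : y ∈ U) (v w : Y) :
    dd v (dd w G) y = fderiv ℝ (fderiv ℝ G) y v w := by
  have : DifferentiableAt ℝ (fderiv ℝ G) y :=
    ((sm_fderiv hU h).contDiffAt (hU.mem_nhds hy)).differentiableAt (by simp)
  unfold dd
  rw [fderiv_clm_apply this (by fun_prop)]
  simp

lemma dd_comm {U : Set Y} (hU : IsOpen U) {G : Y → ℝ} (h : ContDiffOn ℝ (⊤ : ℕ∞) G U) {y : Y} (hy : y ∈ U) (v w : Y) :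
    dd v (dd w G) y = dd w (dd v G) y := by
  rw [dd_dd hU h hy, dd_dd hU h hy]
  exact ((sm_at hU h hy).isSymmSndFDerivAt (by simp; exact WithTop.coe_le_coe.2 le_top)) v w

lemma dd_congr {U : Set Y} (hU : IsOpen U) {G G' : Y → ℝ} (h : ∀ y ∈ U, G y = G' y) {y : Y} (hy : y ∈ U) (v : Y) :
    dd v G y = dd v G' y := by
  unfold dd
  rw [Filter.EventuallyEq.fderiv_eq (Filter.eventually_of_mem (hU.mem_nhds hy) h)]

lemma dd_comm3 {U : Set Y} (hU : IsOpen U) {G : Y → ℝ} (h : ContDiffOn ℝ (⊤ : ℕ∞) G U) {y : Y} (hy : y ∈ U) (z v w : Y) :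
    dd z (dd v (dd w G)) y = dd z (dd w (dd v G)) y :=
  dd_congr hU (fun _ hy => dd_comm hU h hy v w) hy z

lemma dd_add (v w : Y) (G : Y → ℝ) (y : Y) : dd (v + w) G y = dd v G y + dd w G y := by simp [dd]
lemma dd_smul (c : ℝ) (v : Y) (G : Y → ℝ) (y : Y) : dd (c • v) G y = c * dd v G y := by simp [dd]

lemma line_mem {U : Set Y} (hU : IsOpen U) {y : Y} (hy : y ∈ U) (v : Y) : ∀ᶠ s : ℝ in nhds 0, y + s • v ∈ U := by
  have : Continuous fun s : ℝ => y + s • v := by fun_prop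
  exact this.continuousAt.eventually (hU.mem_nhds (by simpa))

lemma line_deriv {U : Set Y} (hU : IsOpen U) {G : Y → ℝ} (h : ContDiffOn ℝ (⊤ : ℕ∞) G U) {y v : Y} {s : ℝ}
    (hy : y + s • v ∈ U) : HasDerivAt (fun s : ℝ => G (y + s • v)) (dd v G (y + s • v)) s := by
  have h1 := (sm_diff hU h hy).hasFDerivAt
  have h2 : HasDerivAt (fun s : ℝ => y + s • v) ((1 : ℝ) • v) s := ((hasDerivAt_id s).smul_const v).const_add y
  have := h1.comp_hasDerivAt s h2
  rw [one_smul] at this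
  exact this

lemma T2.line {U : Set Y} (hU : IsOpen U) {G : Y → ℝ} (h : ContDiffOn ℝ (⊤ : ℕ∞) G U) {y : Y} (hy : y ∈ U) (v : Y) :
    T2 (fun s : ℝ => G (y + s • v)) (G y) (dd v G y) (dd v (dd v G) y / 2) := by
  have := T2.of_hasDerivAt (g := fun s : ℝ => G (y + s • v)) (g1 := fun s : ℝ => dd v G (y + s • v))
    (g2 := dd v (dd v G) y) (by
      filter_upwards [line_mem hU hy v] with s hs using line_deriv hU h hs)
    (by simpa using line_deriv hU (sm_dd hU h v) (s := 0) (y := y) (v := v) (by simpa))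
  simpa using this

end dd


/-- spatial gradient -/
def pV {n : ℕ} (φ : ℝ × E (n + 1) → ℝ) (y : ℝ × E (n + 1)) : E (n + 1) :=
  (InnerProductSpace.toDual ℝ (E (n + 1))).symm
    ((fderiv ℝ φ y).comp (ContinuousLinearMap.inr ℝ ℝ (E (n + 1))))

lemma pV_inner {n : ℕ} (φ : ℝ × E (n + 1) → ℝ) (y : ℝ × E (n + 1)) (v : E (n + 1)) :
    ⟪pV φ y, v⟫ = dd (0, v) φ y := by
  simp [pV, dd]

/-- spatial Hessian -/
def HB {n : ℕ} (φ : ℝ × E (n + 1) → ℝ) (y : ℝ × E (n + 1)) : E (n + 1) →L[ℝ] E (n + 1) →L[ℝ] ℝ :=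
  (fderiv ℝ (fderiv ℝ φ) y).bilinearComp (ContinuousLinearMap.inr ℝ ℝ (E (n + 1)))
    (ContinuousLinearMap.inr ℝ ℝ (E (n + 1)))

lemma HB_apply {n : ℕ} {U : Set (ℝ × E (n + 1))} (hU : IsOpen U) {φ : ℝ × E (n + 1) → ℝ}
    (h : ContDiffOn ℝ (⊤ : ℕ∞) φ U) {y : ℝ × E (n + 1)} (hy : y ∈ U) (v w : E (n + 1)) :
    HB φ y v w = dd (0, v) (dd (0, w) φ) y := by
  rw [dd_dd hU h hy]; simp [HB]

/-- minus the normal speed divided by support function; `S = ∂ₜ log ρ · u` -/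
def SS {n : ℕ} (φ : ℝ × E (n + 1) → ℝ) (y : ℝ × E (n + 1)) : ℝ :=
  - dd (1, 0) φ y / (φ y * ‖pV φ y‖)

/-- time derivative of `log ρ` -/
def VV {n : ℕ} (φ : ℝ × E (n + 1) → ℝ) (y : ℝ × E (n + 1)) : ℝ := - dd (1, 0) φ y / φ y

/-- the inverse curvature along the flow -/
def QQ {n : ℕ} (f : E (n + 1) → ℝ) (φ : ℝ × E (n + 1) → ℝ) (y : ℝ × E (n + 1)) : ℝ :=
  f ((φ y)⁻¹ • y.2) + SS φ y

/-- solutions in terms of the gauge function -/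
structure Sol {n : ℕ} (Γ : Set (Fin n → ℝ)) (F : (Fin n → ℝ) → ℝ) (f : E (n + 1) → ℝ) (T : ℝ)
    (U : Set (ℝ × E (n + 1))) (φ : ℝ × E (n + 1) → ℝ) : Prop where
  op : IsOpen U
  sm : ContDiffOn ℝ (⊤ : ℕ∞) φ U
  mem : ∀ t ∈ Icc 0 T, ∀ X : E (n + 1), X ≠ 0 → (t, X) ∈ U
  ne : ∀ y ∈ U, y.2 ≠ 0
  pos : ∀ y ∈ U, 0 < φ y
  cone : ∀ c : ℝ, 0 < c → ∀ t X, (t, X) ∈ U → (t, c • X) ∈ U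
  hom : ∀ c : ℝ, 0 < c → ∀ t X, (t, X) ∈ U → φ (t, c • X) = c * φ (t, X)
  pde : ∀ t ∈ Icc 0 T, ∀ X : E (n + 1), X ≠ 0 → ∃ κ ∈ Γ, ∃ e,
    IsData (pV φ (t, X)) ((φ (t, X) / ‖pV φ (t, X)‖) • HB φ (t, X)) κ e ∧ (F κ)⁻¹ = QQ f φ (t, X)

/-- homogeneity of degree `j` in space -/
def Hom {n : ℕ} (U : Set (ℝ × E (n + 1))) (j : ℤ) (G : ℝ × E (n + 1) → ℝ) : Prop :=
  ∀ c : ℝ, 0 < c → ∀ t X, (t, X) ∈ U → G (t, c • X) = c ^ j * G (t, X)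

section
variable {n : ℕ} {U : Set (ℝ × E (n + 1))} {G : ℝ × E (n + 1) → ℝ} {j : ℤ}

lemma Hom.scale (hU : IsOpen U) (hc : ∀ c : ℝ, 0 < c → ∀ t X, (t, X) ∈ U → (t, c • X) ∈ U)
    (hG : ContDiffOn ℝ (⊤ : ℕ∞) G U) (h : Hom U j G) {c : ℝ} (c0 : 0 < c) {t : ℝ} {X : E (n + 1)}
    (hy : (t, X) ∈ U) (a : ℝ) (v : E (n + 1)) : dd (a, c • v) G (t, c • X) = c ^ j * dd (a, v) G (t, X) := by
  let L : ℝ × E (n + 1) →L[ℝ] ℝ × E (n + 1) :=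
    (ContinuousLinearMap.id ℝ ℝ).prodMap (c • ContinuousLinearMap.id ℝ (E (n + 1)))
  have hL : ∀ t X, L (t, X) = (t, c • X) := fun t X => by simp [L]
  have e1 : ∀ y ∈ U, (fun z => G (L z)) y = (fun z => c ^ j * G z) y := by
    rintro ⟨t, X⟩ hy
    simp only [hL]; exact h c c0 t X hy
  have e2 := dd_congr hU e1 hy (a, v)
  have d1 := sm_diff hU hG (hc c c0 t X hy)
  have d2 := sm_diff hU hG hy
  have e3 : dd (a, v) (fun z => G (L z)) (t, X) = dd (a, c • v) G (t, c • X) := by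
    unfold dd
    rw [← hL] at d1
    have := d1.hasFDerivAt.comp (t, X) L.hasFDerivAt
    rw [HasFDerivAt.fderiv (f := fun z => G (L z)) this]
    simp [hL]
  have e4 : dd (a, v) (fun z => c ^ j * G z) (t, X) = c ^ j * dd (a, v) G (t, X) := by
    unfold dd
    rw [fderiv_const_mul d2]; simp
  rw [← e3, e2, e4]

lemma Hom.dd_space (hU : IsOpen U) (hc : ∀ c : ℝ, 0 < c → ∀ t X, (t, X) ∈ U → (t, c • X) ∈ U)
    (hG : ContDiffOn ℝ (⊤ : ℕ∞) G U) (h : Hom U j G) (v : E (n + 1)) : Hom U (j - 1) (dd (0, v) G) := by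
  intro c c0 t X hy
  have := Hom.scale hU hc hG h c0 hy 0 v
  have e : ((0 : ℝ), c • v) = c • ((0 : ℝ), v) := by simp
  rw [e, dd_smul] at this
  rw [zpow_sub_one₀ c0.ne', mul_comm (c ^ j), mul_assoc, ← this]
  field_simp

lemma Hom.dd_time (hU : IsOpen U) (hc : ∀ c : ℝ, 0 < c → ∀ t X, (t, X) ∈ U → (t, c • X) ∈ U)
    (hG : ContDiffOn ℝ (⊤ : ℕ∞) G U) (h : Hom U j G) : Hom U j (dd (1, 0) G) := by
  intro c c0 t X hy
  have := Hom.scale hU hc hG h c0 hy 1 0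
  simpa using this

lemma Hom.euler (hU : IsOpen U) (hG : ContDiffOn ℝ (⊤ : ℕ∞) G U) (h : Hom U j G) {t : ℝ} {X : E (n + 1)}
    (hy : (t, X) ∈ U) : dd (0, X) G (t, X) = j * G (t, X) := by
  have h1 := line_deriv hU hG (y := (t, X)) (v := (0, X)) (s := 0) (by simpa)
  have h2 : HasDerivAt (fun s : ℝ => (1 + s) ^ j * G (t, X)) (j * (1 + 0) ^ (j - 1) * 1 * G (t, X)) 0 := by
    have h3 : HasDerivAt (fun s : ℝ => 1 + s) 1 0 := (hasDerivAt_id (0 : ℝ)).const_add 1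
    have := (hasDerivAt_zpow j ((1 : ℝ) + 0) (by simp)).comp (0 : ℝ) h3
    exact this.mul_const _
  have h4 : (fun s : ℝ => G ((t, X) + s • ((0 : ℝ), X))) =ᶠ[nhds 0] fun s : ℝ => (1 + s) ^ j * G (t, X) := by
    filter_upwards [Ioi_mem_nhds (show (-1 : ℝ) < 0 by norm_num)] with s hs
    rw [← h (1 + s) (by simp at hs; linarith) t X hy]
    congr 1
    simp [add_smul]
  have := (h1.congr_of_eventuallyEq h4.symm).unique h2
  simpa using this
end

namespace Sol
variable {n : ℕ} {Γ : Set (Fin n → ℝ)} {F : (Fin n → ℝ) → ℝ} {f : E (n + 1) → ℝ} {T : ℝ}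
    {U : Set (ℝ × E (n + 1))} {φ : ℝ × E (n + 1) → ℝ} (S : Sol Γ F f T U φ)
include S

lemma hom1 : Hom U 1 φ := fun c c0 t X hy => by rw [zpow_one]; exact S.hom c c0 t X hy

lemma inner_pX {t : ℝ} {X : E (n + 1)} (hy : (t, X) ∈ U) : ⟪pV φ (t, X), X⟫ = φ (t, X) := by
  rw [pV_inner, S.hom1.euler S.op S.sm hy]; simp

lemma p_ne {t : ℝ} {X : E (n + 1)} (hy : (t, X) ∈ U) : pV φ (t, X) ≠ 0 := by
  intro h
  have := S.inner_pX hy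
  rw [h, inner_zero_left] at this
  linarith [S.pos _ hy]

lemma p_pos {t : ℝ} {X : E (n + 1)} (hy : (t, X) ∈ U) : 0 < ‖pV φ (t, X)‖ := norm_pos_iff.2 (S.p_ne hy)

lemma p_hom {t : ℝ} {X : E (n + 1)} (hy : (t, X) ∈ U) {c : ℝ} (c0 : 0 < c) :
    pV φ (t, c • X) = pV φ (t, X) := by
  refine ext_inner_right ℝ fun v => ?_
  rw [pV_inner, pV_inner]
  simpa using (S.hom1.dd_space S.op S.cone S.sm v) c c0 t X hy

lemma HX {t : ℝ} {X : E (n + 1)} (hy : (t, X) ∈ U) (v : E (n + 1)) : HB φ (t, X) v X = 0 := by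
  rw [HB_apply S.op S.sm hy, dd_comm S.op S.sm hy,
    (S.hom1.dd_space S.op S.cone S.sm v).euler S.op (sm_dd S.op S.sm _) hy]
  simp

lemma H_symm {y : ℝ × E (n + 1)} (hy : y ∈ U) (v w : E (n + 1)) : HB φ y v w = HB φ y w v := by
  rw [HB_apply S.op S.sm hy, HB_apply S.op S.sm hy, dd_comm S.op S.sm hy]

lemma H_hom {t : ℝ} {X : E (n + 1)} (hy : (t, X) ∈ U) {c : ℝ} (c0 : 0 < c) (v w : E (n + 1)) :
    HB φ (t, c • X) v w = c⁻¹ * HB φ (t, X) v w := by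
  rw [HB_apply S.op S.sm hy, HB_apply S.op S.sm (S.cone c c0 t X hy)]
  have := ((S.hom1.dd_space S.op S.cone S.sm w).dd_space S.op S.cone (sm_dd S.op S.sm _) v) c c0 t X hy
  simpa using this

lemma dt_hom {t : ℝ} {X : E (n + 1)} (hy : (t, X) ∈ U) {c : ℝ} (c0 : 0 < c) :
    dd (1, 0) φ (t, c • X) = c * dd (1, 0) φ (t, X) := by
  simpa using (S.hom1.dd_time S.op S.cone S.sm) c c0 t X hy

lemma VV_hom {t : ℝ} {X : E (n + 1)} (hy : (t, X) ∈ U) {c : ℝ} (c0 : 0 < c) :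
    VV φ (t, c • X) = VV φ (t, X) := by
  unfold VV
  rw [S.dt_hom hy c0, S.hom c c0 t X hy]
  have := S.pos _ hy
  field_simp

lemma VV_eq {y : ℝ × E (n + 1)} (hy : y ∈ U) : VV φ y = ‖pV φ y‖ * SS φ y := by
  have h1 := S.pos _ hy
  have h2 := S.p_pos (t := y.1) (X := y.2) hy
  simp only [Prod.mk.eta] at h2
  unfold VV SS; field_simp

lemma T2s {t : ℝ} {X : E (n + 1)} (hy : (t, X) ∈ U) (v : E (n + 1)) :
    T2 (fun s : ℝ => φ (t, X + s • v)) (φ (t, X)) ⟪pV φ (t, X), v⟫ (HB φ (t, X) v v / 2) := by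
  have := T2.line S.op S.sm hy (0, v)
  rw [pV_inner, HB_apply S.op S.sm hy]
  simpa using this

lemma logderiv {t : ℝ} {X : E (n + 1)} (hy : (t, X) ∈ U) :
    HasDerivAt (fun s => - Real.log (φ (s, X))) (VV φ (t, X)) t := by
  have h := line_deriv S.op S.sm (y := ((0 : ℝ), X)) (v := (1, 0)) (s := t) (by simpa using hy)
  simp at h
  have := (h.log (S.pos _ hy).ne').neg
  rw [← neg_div] at this
  exact this

lemma cont_log (K : Set (E (n + 1))) (hK : ∀ x ∈ K, x ≠ 0) :
    ContinuousOn (fun q : ℝ × E (n + 1) => Real.log (φ (q.1, q.2))) (Icc 0 T ×ˢ K) := by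
  refine ContinuousOn.log ?_ ?_
  · exact S.sm.continuousOn.mono fun q hq => S.mem _ hq.1 _ (hK _ hq.2)
  · exact fun q hq => (S.pos _ (S.mem _ hq.1 _ (hK _ hq.2))).ne'

lemma cont_VV (K : Set (E (n + 1))) (hK : ∀ x ∈ K, x ≠ 0) :
    ContinuousOn (fun q : ℝ × E (n + 1) => VV φ (q.1, q.2)) (Icc 0 T ×ˢ K) := by
  have hs : Icc 0 T ×ˢ K ⊆ U := fun q hq => S.mem _ hq.1 _ (hK _ hq.2)
  refine ContinuousOn.div (ContinuousOn.neg ?_) ?_ ?_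
  · exact (sm_dd S.op S.sm _).continuousOn.mono hs
  · exact S.sm.continuousOn.mono hs
  · exact fun q hq => (S.pos _ (hs hq)).ne'

end Sol


section
variable {n : ℕ} {f : E (n + 1) → ℝ} {k r₁ r₂ : ℝ}

lemma f_scale (hf : GoodPrescribed f k r₁ r₂) {c : ℝ} (hc : 1 ≤ c) {Z : E (n + 1)} (hZ : Z ≠ 0) :
    c ^ k * f Z ≤ f (c • Z) := by
  have hZ' : 0 < ‖Z‖ := norm_pos_iff.2 hZ
  set x := ‖Z‖⁻¹ • Z with hx
  have hx1 : ‖x‖ = 1 := by rw [hx, norm_smul, norm_inv, norm_norm, inv_mul_cancel₀ hZ'.ne']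
  have hmono : StrictMonoOn (fun s : ℝ => s ^ (-k) * f (s • x)) (Ioi 0) := by
    refine strictMonoOn_of_deriv_pos (convex_Ioi 0) ?_ ?_
    · intro s hs
      exact (differentiableAt_of_deriv_ne_zero (hf.2.2.1 x hx1 s hs).ne').continuousAt.continuousWithinAt
    · intro s hs
      rw [interior_Ioi] at hs
      exact hf.2.2.1 x hx1 s hs
  have h1 : ‖Z‖ ≤ c * ‖Z‖ := by nlinarith
  have h2 := hmono.monotoneOn (show ‖Z‖ ∈ Ioi 0 from hZ') (show c * ‖Z‖ ∈ Ioi 0 from hZ'.trans_le h1) h1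
  have e1 : ‖Z‖ • x = Z := by rw [hx, smul_smul, mul_inv_cancel₀ hZ'.ne', one_smul]
  simp only [mul_smul, e1] at h2
  rw [Real.mul_rpow (by linarith) hZ'.le, Real.rpow_neg (by linarith : (0:ℝ) ≤ c), mul_comm _ (‖Z‖ ^ (-k)), mul_assoc] at h2
  have h3 := le_of_mul_le_mul_left h2 (Real.rpow_pos_of_pos hZ' _)
  have hck : 0 < c ^ k := Real.rpow_pos_of_pos (by linarith) _
  rw [inv_mul_eq_div, le_div_iff₀ hck] at h3
  linarith

lemma f_upper (hf : GoodPrescribed f k r₁ r₂) {Z : E (n + 1)} (hZ : r₂ ≤ ‖Z‖) : ‖Z‖ ^ k ≤ f Z := by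
  have hr2 : 0 < r₂ := hf.2.2.2.1.trans_le hf.2.2.2.2.1
  have hZ0 : 0 < ‖Z‖ := hr2.trans_le hZ
  have hn : ‖(r₂ / ‖Z‖) • Z‖ = r₂ := by
    rw [norm_smul, Real.norm_of_nonneg (by positivity)]; field_simp
  have h := f_scale hf (c := ‖Z‖ / r₂) ((one_le_div hr2).2 hZ) (Z := (r₂ / ‖Z‖) • Z)
    (by rw [← norm_ne_zero_iff, hn]; exact hr2.ne')
  have e : (‖Z‖ / r₂) • (r₂ / ‖Z‖) • Z = Z := by
    rw [smul_smul]; field_simp; simp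
  rw [e] at h
  refine le_trans ?_ h
  have := hf.2.2.2.2.2.2 _ hn
  calc ‖Z‖ ^ k = (‖Z‖ / r₂) ^ k * r₂ ^ k := by
        rw [← Real.mul_rpow (by positivity) hr2.le]; congr 1; field_simp
    _ ≤ _ := by gcongr

lemma f_lower (hf : GoodPrescribed f k r₁ r₂) {Z : E (n + 1)} (hZ0 : Z ≠ 0) (hZ : ‖Z‖ ≤ r₁) : f Z ≤ ‖Z‖ ^ k := by
  have hr1 : 0 < r₁ := hf.2.2.2.1
  have hZ0' : 0 < ‖Z‖ := norm_pos_iff.2 hZ0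
  have hn : ‖(r₁ / ‖Z‖) • Z‖ = r₁ := by
    rw [norm_smul, Real.norm_of_nonneg (by positivity)]; field_simp
  have h := f_scale hf (c := r₁ / ‖Z‖) ((one_le_div hZ0').2 hZ) hZ0
  have := hf.2.2.2.2.2.1 _ hn
  have e : r₁ ^ k = (r₁ / ‖Z‖) ^ k * ‖Z‖ ^ k := by
    rw [← Real.mul_rpow (by positivity) hZ0'.le]; congr 1; field_simp
  rw [e] at this
  have h3 : 0 < (r₁ / ‖Z‖) ^ k := by positivity
  exact le_of_mul_le_mul_left (h.trans this) h3
end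

lemma IsData.scale {n : ℕ} {p : E (n + 1)} {A : E (n + 1) →L[ℝ] E (n + 1) →L[ℝ] ℝ} {κ : Fin n → ℝ}
    {e : Fin n → E (n + 1)} (h : IsData p A κ e) (c : ℝ) : IsData p (c • A) (c • κ) e :=
  ⟨h.1, fun i U hU => by simp [h.2 i U hU]; ring⟩

lemma IsData.self {n : ℕ} {p : E (n + 1)} {A : E (n + 1) →L[ℝ] E (n + 1) →L[ℝ] ℝ} {κ : Fin n → ℝ}
    {e : Fin n → E (n + 1)} (h : IsData p A κ e) (i : Fin n) : A (e i) (e i) = κ i := by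
  rw [h.2 i _ (h.1.2 i), real_inner_self_eq_norm_sq, h.1.1.1 i]; simp

namespace Sol
variable {n : ℕ} {Γ : Set (Fin n → ℝ)} {F : (Fin n → ℝ) → ℝ} {f : E (n + 1) → ℝ} {T k : ℝ}
    {U : Set (ℝ × E (n + 1))} {φ : ℝ × E (n + 1) → ℝ} (S : Sol Γ F f T U φ)
    (hΓ : GoodCone Γ) (hF : GoodF Γ F k)
include S hΓ hF

lemma Q_pos {t : ℝ} (ht : t ∈ Icc 0 T) {X : E (n + 1)} (hX : X ≠ 0) : 0 < QQ f φ (t, X) := by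
  obtain ⟨κ, hκ, e, -, h⟩ := S.pde t ht X hX
  rw [← h]; exact inv_pos.2 (hF.1 κ hκ)

lemma touch {t1 t2 : ℝ} (h1 : t1 ∈ Icc 0 T) (h2 : t2 ∈ Icc 0 T) (R : E (n + 1) ≃ₗᵢ[ℝ] E (n + 1)) {l : ℝ} (hl : 0 < l)
    (hle : ∀ X ≠ 0, l * φ (t2, X) ≤ φ (t1, R X)) {X : E (n + 1)} (hX : X ≠ 0)
    (heq : φ (t1, R X) = l * φ (t2, X)) :
    ‖pV φ (t1, R X)‖ = l * ‖pV φ (t2, X)‖ ∧ l ^ k * QQ f φ (t1, R X) ≤ QQ f φ (t2, X) := by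
  have hRX : R X ≠ 0 := by simpa using hX
  have m1 := S.mem t1 h1 _ hRX
  have m2 := S.mem t2 h2 _ hX
  have key : ∀ V, ⟪pV φ (t1, R X), R V⟫ = l * ⟪pV φ (t2, X), V⟫ ∧
      l * HB φ (t2, X) V V ≤ HB φ (t1, R X) (R V) (R V) := by
    intro V
    have a := (S.T2s m1 (R V)).sub ((S.T2s m2 V).smul l)
    rw [heq, sub_self] at a
    have hn : ∀ᶠ s : ℝ in nhds 0, X + s • V ≠ 0 := by
      have : Continuous fun s : ℝ => X + s • V := by fun_prop
      exact this.continuousAt.eventually_ne (by simpa)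
    have b := a.sign (by
      filter_upwards [hn] with s hs
      have := hle _ hs
      rw [map_add, map_smul] at this
      linarith)
    constructor <;> linarith [b.1, b.2]
  have hp : pV φ (t1, R X) = l • R (pV φ (t2, X)) := by
    refine ext_inner_right ℝ fun w => ?_
    have := (key (R.symm w)).1
    rw [R.apply_symm_apply] at this
    rw [this, inner_smul_left, ← R.inner_map_map, R.apply_symm_apply]; simp
  have hpn : ‖pV φ (t1, R X)‖ = l * ‖pV φ (t2, X)‖ := by
    rw [hp, norm_smul, R.norm_map, Real.norm_of_nonneg hl.le]
  refine ⟨hpn, ?_⟩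
  obtain ⟨κ1, hκ1, e1, d1, q1⟩ := S.pde t1 h1 _ hRX
  obtain ⟨κ2, hκ2, e2, d2, q2⟩ := S.pde t2 h2 _ hX
  have p2 := S.p_pos m2
  have f2 := S.pos _ m2
  have hlk : 0 < l ^ k := Real.rpow_pos_of_pos hl _
  have hv : Frame (pV φ (t2, X)) (fun i => R.symm (e1 i)) := by
    refine ⟨d1.1.1.comp_linearIsometryEquiv R.symm, fun i => ?_⟩
    have := (key (R.symm (e1 i))).1
    rw [R.apply_symm_apply, d1.1.2] at this
    have := mul_eq_zero.1 this.symm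
    exact this.resolve_left hl.ne'
  have hs := SG hΓ hF (hΓ.2.2.2.1 l κ2 hκ2 hl) hκ1 (S.p_ne m2) (d2.scale l) hv
  have hneg : ∑ i, Bw F κ1 i * ((l • (φ (t2, X) / ‖pV φ (t2, X)‖) • HB φ (t2, X)) (R.symm (e1 i)) (R.symm (e1 i)) - κ1 i) ≤ 0 := by
    refine Finset.sum_nonpos fun i _ => mul_nonpos_of_nonneg_of_nonpos (Bw_pos hF hκ1 i).le ?_
    rw [← d1.self i]
    have := (key (R.symm (e1 i))).2
    rw [R.apply_symm_apply] at this
    simp only [ContinuousLinearMap.smul_apply, smul_eq_mul, heq, hpn]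
    have e : l * φ (t2, X) / (l * ‖pV φ (t2, X)‖) = φ (t2, X) / ‖pV φ (t2, X)‖ := by field_simp
    rw [e]
    have : φ (t2, X) / ‖pV φ (t2, X)‖ * (l * HB φ (t2, X) (R.symm (e1 i)) (R.symm (e1 i))) ≤ φ (t2, X) / ‖pV φ (t2, X)‖ * HB φ (t1, R X) (e1 i) (e1 i) := by
      gcongr
    linarith
  have hlog : Real.log (F (l • κ2)) ≤ Real.log (F κ1) := by linarith
  have F1 := hF.1 _ hκ1
  have F2 := hF.1 _ hκ2
  rw [hF.2.2.2.2.1 l κ2 hκ2 hl] at hlog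
  have hfin := (Real.log_le_log_iff (by positivity) F1).1 hlog
  rw [← q1, ← q2, ← div_eq_mul_inv, div_le_iff₀ F1, ← div_eq_inv_mul, le_div_iff₀ F2]
  exact hfin

lemma sph_aux {t : ℝ} {X : E (n + 1)} (hy : (t, X) ∈ U) (V : E (n + 1)) (c : ℝ) :
    T2 (fun s : ℝ => φ (t, X + s • V) * φ (t, X + s • V) - c ^ 2 * ‖X + s • V‖ ^ 2)
      (φ (t, X) * φ (t, X) - c ^ 2 * ‖X‖ ^ 2) (2 * (φ (t, X) * ⟪pV φ (t, X), V⟫ - c ^ 2 * ⟪X, V⟫))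
      (φ (t, X) * HB φ (t, X) V V + ⟪pV φ (t, X), V⟫ ^ 2 - c ^ 2 * ‖V‖ ^ 2) := by
  have h1 := S.T2s hy V
  have h2 : T2 (fun s : ℝ => ‖X + s • V‖ ^ 2) (‖X‖ ^ 2) (2 * ⟪X, V⟫) (‖V‖ ^ 2) := by
    have := ((T2.id.smul (2 * ⟪X, V⟫)).add ((T2.id.mul T2.id).smul (‖V‖ ^ 2))).add (T2.const (‖X‖ ^ 2))
    refine (this.congr (Filter.Eventually.of_forall fun s => ?_)).coef (by ring) (by ring) (by ring)
    rw [norm_add_sq_real, inner_smul_right, norm_smul, mul_pow, Real.norm_eq_abs, sq_abs]; ring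
  exact ((h1.mul h1).sub (h2.smul (c ^ 2))).coef (by ring) (by ring) (by ring)

lemma sph_p {t : ℝ} {X : E (n + 1)} (hy : (t, X) ∈ U) {c : ℝ} (hc : 0 < c) (heq : φ (t, X) = c * ‖X‖)
    (h : ∀ V, φ (t, X) * ⟪pV φ (t, X), V⟫ = c ^ 2 * ⟪X, V⟫) : ‖pV φ (t, X)‖ = c := by
  have h0 := S.pos _ hy
  have hX : 0 < ‖X‖ := norm_pos_iff.2 (S.ne _ hy)
  have : φ (t, X) • pV φ (t, X) = c ^ 2 • X := ext_inner_right ℝ fun V => by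
    rw [inner_smul_left, inner_smul_left]; simpa using h V
  have := congrArg norm this
  rw [norm_smul, norm_smul, Real.norm_of_nonneg h0.le, Real.norm_of_nonneg (by positivity), heq] at this
  have h3 : (c * ‖X‖) * ‖pV φ (t, X)‖ = (c * ‖X‖) * c := by rw [this]; ring
  exact mul_left_cancel₀ (by positivity) h3

lemma sph_max {t : ℝ} (ht : t ∈ Icc 0 T) {c : ℝ} (hc : 0 < c)
    (hle : ∀ X ≠ 0, c * ‖X‖ ≤ φ (t, X)) {X : E (n + 1)} (hX : X ≠ 0)
    (heq : φ (t, X) = c * ‖X‖) : QQ f φ (t, X) ≤ (c ^ k)⁻¹ := by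
  have m := S.mem t ht _ hX
  have key : ∀ V, φ (t, X) * ⟪pV φ (t, X), V⟫ = c ^ 2 * ⟪X, V⟫ ∧
      c ^ 2 * ‖V‖ ^ 2 ≤ φ (t, X) * HB φ (t, X) V V + ⟪pV φ (t, X), V⟫ ^ 2 := by
    intro V
    have a := sph_aux S hΓ hF m V c
    have e : φ (t, X) * φ (t, X) - c ^ 2 * ‖X‖ ^ 2 = 0 := by rw [heq]; ring
    rw [e] at a
    have hn : ∀ᶠ s : ℝ in nhds 0, X + s • V ≠ 0 := by
      have : Continuous fun s : ℝ => X + s • V := by fun_prop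
      exact this.continuousAt.eventually_ne (by simpa)
    have b := a.sign (by
      filter_upwards [hn] with s hs
      have := hle _ hs
      have h0 : 0 ≤ c * ‖X + s • V‖ := by positivity
      nlinarith)
    constructor <;> linarith [b.1, b.2]
  have hp := S.sph_p hΓ hF m hc heq fun V => (key V).1
  obtain ⟨κ, hκ, e, d, q⟩ := S.pde t ht _ hX
  obtain ⟨g1, g2⟩ := F_const hΓ hF hc
  have := F_mono hΓ hF hκ g1 (fun i => by
    rw [← d.self i, hp]
    have := (key (e i)).2
    rw [d.1.2 i, d.1.1.1 i] at this
    simp only [ContinuousLinearMap.smul_apply, smul_eq_mul]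
    rw [div_mul_eq_mul_div, le_div_iff₀ hc]
    linarith)
  rw [g2] at this
  rw [← q]
  exact inv_anti₀ (Real.rpow_pos_of_pos hc _) this

lemma sph_min {t : ℝ} (ht : t ∈ Icc 0 T) {c : ℝ} (hc : 0 < c)
    (hle : ∀ X ≠ 0, φ (t, X) ≤ c * ‖X‖) {X : E (n + 1)} (hX : X ≠ 0)
    (heq : φ (t, X) = c * ‖X‖) : (c ^ k)⁻¹ ≤ QQ f φ (t, X) := by
  have m := S.mem t ht _ hX
  have key : ∀ V, φ (t, X) * ⟪pV φ (t, X), V⟫ = c ^ 2 * ⟪X, V⟫ ∧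
      φ (t, X) * HB φ (t, X) V V + ⟪pV φ (t, X), V⟫ ^ 2 ≤ c ^ 2 * ‖V‖ ^ 2 := by
    intro V
    have a := (sph_aux S hΓ hF m V c).smul (-1)
    have e : -1 * (φ (t, X) * φ (t, X) - c ^ 2 * ‖X‖ ^ 2) = 0 := by rw [heq]; ring
    rw [e] at a
    have hn : ∀ᶠ s : ℝ in nhds 0, X + s • V ≠ 0 := by
      have : Continuous fun s : ℝ => X + s • V := by fun_prop
      exact this.continuousAt.eventually_ne (by simpa)
    have b := a.sign (by
      filter_upwards [hn] with s hs
      have := hle _ hs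
      have h0 := S.pos _ (S.mem t ht _ hs)
      nlinarith)
    constructor <;> linarith [b.1, b.2]
  have hp := S.sph_p hΓ hF m hc heq fun V => (key V).1
  obtain ⟨κ, hκ, e, d, q⟩ := S.pde t ht _ hX
  obtain ⟨g1, g2⟩ := F_const hΓ hF hc
  have := F_mono hΓ hF g1 hκ (fun i => by
    rw [← d.self i, hp]
    have := (key (e i)).2
    rw [d.1.2 i, d.1.1.1 i] at this
    simp only [ContinuousLinearMap.smul_apply, smul_eq_mul]
    rw [div_mul_eq_mul_div, div_le_iff₀ hc]
    linarith)
  rw [g2] at this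
  rw [← q]
  exact inv_anti₀ (hF.1 _ hκ) this

end Sol


lemma le_at_end {g : ℝ → ℝ} {T m : ℝ} (hT : 0 < T) (hc : ContinuousWithinAt g (Icc 0 T) T)
    (h : ∀ t ∈ Ico 0 T, g t ≤ m) : g T ≤ m := by
  have hcw2 : ContinuousWithinAt g (Ioo 0 T) T := hc.mono Ioo_subset_Icc_self
  have : (nhdsWithin T (Ioo 0 T)).NeBot := by
    rw [nhdsWithin_Ioo_eq_nhdsLT hT]; infer_instance
  exact le_of_tendsto hcw2 (by filter_upwards [self_mem_nhdsWithin] with s hs using h s ⟨hs.1.le, hs.2⟩)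

lemma E1abs {α : Type*} [PseudoMetricSpace α] {K : Set α} (hK : IsCompact K) {T : ℝ} (hT : 0 < T)
    {r V : ℝ → α → ℝ} (hr : ContinuousOn (fun q : ℝ × α => r q.1 q.2) (Icc 0 T ×ˢ K))
    (hV : ContinuousOn (fun q : ℝ × α => V q.1 q.2) (Icc 0 T ×ˢ K))
    (hd : ∀ t ∈ Icc 0 T, ∀ x ∈ K, HasDerivAt (fun s => r s x) (V t x) t) {m L : ℝ} (hm : 0 ≤ m) (hL : 0 ≤ L)
    (h0 : ∀ x ∈ K, V 0 x ≤ m)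
    (hmax : ∀ t s, 0 < s → 0 ≤ t → t + s ≤ T → ∀ x ∈ K, 0 < r (t + s) x - r t x →
      (∀ y ∈ K, r (t + s) y - r t y ≤ r (t + s) x - r t x) →
      V (t + s) x - V t x ≤ L * (r (t + s) x - r t x)) :
    ∀ t ∈ Icc 0 T, ∀ x ∈ K, V t x ≤ m * Real.exp (L * T) := by
  have main : ∀ t ∈ Ico 0 T, ∀ x ∈ K, V t x ≤ m * Real.exp (L * T) := by
    intro t ht x hx
    have claim : ∀ ε > 0, V t x ≤ (m + ε) * Real.exp (L * T) := by
      intro ε hε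
      have huc := (isCompact_Icc.prod hK).uniformContinuousOn_of_continuous hV
      rw [Metric.uniformContinuousOn_iff] at huc
      obtain ⟨δ, hδ, hδ2⟩ := huc ε hε
      have hVs : ∀ θ, 0 ≤ θ → θ ≤ T → θ < δ → ∀ y ∈ K, V θ y ≤ m + ε := by
        intro θ h1 h2 h3 y hy
        have := hδ2 (θ, y) ⟨⟨h1, h2⟩, hy⟩ (0, y) ⟨⟨le_rfl, hT.le⟩, hy⟩ (by
          simp [Prod.dist_eq, abs_of_nonneg h1, h3, hδ])
        rw [Real.dist_eq] at this
        have := (abs_lt.1 this).2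
        have h0' := h0 y hy
        simp only at this
        linarith
      have hdiff : ∀ s, 0 < s → s < δ → t + s < T → r (t + s) x - r t x ≤ (m + ε) * Real.exp (L * T) * s := by
        intro s hs hsδ hst
        have hinit : ∀ y ∈ K, r (0 + s) y - r 0 y ≤ (m + ε) * s := by
          intro y hy
          have hsT : s ≤ T := by linarith [ht.1]
          have := (convex_Icc 0 s).image_sub_le_mul_sub_of_deriv_le (f := fun θ => r θ y) (C := m + ε)
            (fun θ hθ => (hd θ ⟨hθ.1, hθ.2.trans hsT⟩ y hy).continuousAt.continuousWithinAt)
            (fun θ hθ => by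
              rw [interior_Icc] at hθ
              exact (hd θ ⟨hθ.1.le, hθ.2.le.trans hsT⟩ y hy).differentiableAt.differentiableWithinAt)
            (fun θ hθ => by
              rw [interior_Icc] at hθ
              rw [(hd θ ⟨hθ.1.le, hθ.2.le.trans hsT⟩ y hy).deriv]
              exact hVs θ hθ.1.le (hθ.2.le.trans hsT) (hθ.2.trans hsδ) y hy)
            0 ⟨le_rfl, hs.le⟩ s ⟨hs.le, le_rfl⟩ hs.le
          simpa using this
        have := MPexp hK (T := T - s) (m := (m + ε) * s) (L := L) (by linarith [ht.1]) hL (by positivity)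
          (w := fun t x => r (t + s) x - r t x) (w' := fun t x => V (t + s) x - V t x)
          (by
            refine ContinuousOn.sub ?_ ?_
            · refine hr.comp (f := fun q : ℝ × α => (q.1 + s, q.2)) (by fun_prop) ?_
              rintro ⟨q1, q2⟩ ⟨⟨a, b⟩, c⟩
              exact ⟨⟨by simp at *; linarith, by simp at *; linarith⟩, c⟩
            · refine hr.mono (prod_mono (Icc_subset_Icc_right (by linarith)) subset_rfl))
          (fun t ht x hx => by
            refine HasDerivAt.sub ?_ (hd t ⟨ht.1.le, by linarith [ht.2]⟩ x hx)
            have := hd (t + s) ⟨by linarith [ht.1], by linarith [ht.2]⟩ x hx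
            exact this.comp_add_const t s)
          hinit
          (fun t ht x hx h1 h2 => hmax t s hs ht.1.le (by linarith [ht.2]) x hx
            (lt_of_le_of_lt (by positivity) h1) h2)
          t ⟨ht.1, by linarith⟩ x hx
        refine this.trans ?_
        have e : Real.exp (L * t) ≤ Real.exp (L * T) := Real.exp_le_exp.2 (by nlinarith [ht.2])
        calc (m + ε) * s * Real.exp (L * t) ≤ (m + ε) * s * Real.exp (L * T) := by gcongr
          _ = _ := by ring
      have hder := (hasDerivAt_iff_tendsto_slope_left_right.1 (hd t ⟨ht.1, ht.2.le⟩ x hx)).2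
      refine le_of_tendsto hder ?_
      have : t < min (t + δ) T := lt_min (by linarith) ht.2
      filter_upwards [Ioo_mem_nhdsGT this] with y hy
      have h1 := hy.1
      have h2 := lt_min_iff.1 hy.2
      have := hdiff (y - t) (by linarith) (by linarith) (by linarith)
      rw [slope_def_field, div_le_iff₀ (by linarith)]
      simpa using this
    have hlim : Filter.Tendsto (fun ε : ℝ => (m + ε) * Real.exp (L * T)) (nhdsWithin 0 (Ioi 0)) (nhds ((m + 0) * Real.exp (L * T))) := by
      apply Filter.Tendsto.mono_left _ nhdsWithin_le_nhds
      exact (Continuous.tendsto (by fun_prop) 0)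
    rw [add_zero] at hlim
    exact ge_of_tendsto hlim (by filter_upwards [self_mem_nhdsWithin] with ε hε using claim ε hε)
  intro t ht x hx
  rcases ht.2.eq_or_lt with h' | h'
  · subst h'
    refine le_at_end (g := fun s => V s x) hT ?_ fun s hs => main s hs x hx
    exact (hV (t, x) ⟨ht, hx⟩).comp (t := Icc 0 t ×ˢ K) (f := fun s : ℝ => (s, x)) (by fun_prop) (fun s hs => ⟨hs, hx⟩)
  · exact main t ⟨ht.1, h'⟩ x hx

/-- unit sphere -/
abbrev Sph (n : ℕ) : Set (E (n + 1)) := Metric.sphere 0 1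

lemma sph_ne {n : ℕ} : ∀ x ∈ Sph n, x ≠ 0 := fun x hx h => by
  subst h; simp at hx

namespace Sol
variable {n : ℕ} {Γ : Set (Fin n → ℝ)} {F : (Fin n → ℝ) → ℝ} {f : E (n + 1) → ℝ} {T k r₁ r₂ : ℝ}
    {U : Set (ℝ × E (n + 1))} {φ : ℝ × E (n + 1) → ℝ}

lemma unitize (S : Sol Γ F f T U φ) {t : ℝ} (ht : t ∈ Icc 0 T) {X : E (n + 1)} (hX : X ≠ 0) :
    ‖X‖⁻¹ • X ∈ Sph n ∧ φ (t, X) = ‖X‖ * φ (t, ‖X‖⁻¹ • X) := by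
  have h : 0 < ‖X‖ := norm_pos_iff.2 hX
  constructor
  · simp [norm_smul, h.ne']
  · rw [S.hom _ (inv_pos.2 h) t X (S.mem t ht X hX)]
    field_simp

lemma E0max (S : Sol Γ F f T U φ) (hΓ : GoodCone Γ) (hF : GoodF Γ F k) (hf : GoodPrescribed f k r₁ r₂)
    (hT : 0 < T) {R : ℝ} (hR : r₂ ≤ R) (h0 : ∀ x ∈ Sph n, R⁻¹ ≤ φ (0, x)) :
    ∀ t ∈ Icc 0 T, ∀ x ∈ Sph n, R⁻¹ ≤ φ (t, x) := by
  have hr2 : 0 < r₂ := hf.2.2.2.1.trans_le hf.2.2.2.2.1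
  have hR0 : 0 < R := hr2.trans_le hR
  have := MP (isCompact_sphere (0 : E (n + 1)) 1) hT (m := Real.log R) (w := fun t x => - Real.log (φ (t, x)))
    (w' := fun t x => VV φ (t, x)) (S.cont_log _ sph_ne).neg
    (fun t ht x hx => S.logderiv (S.mem t ⟨ht.1.le, ht.2.le⟩ x (sph_ne x hx)))
    (fun x hx => by
      have := Real.log_le_log (by positivity) (h0 x hx)
      rw [Real.log_inv] at this
      linarith)
    (fun t ht x hx h1 h2 => by
      have ht' : t ∈ Icc 0 T := ⟨ht.1.le, ht.2.le⟩
      have m := S.mem t ht' x (sph_ne x hx)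
      have hc := S.pos _ m
      refine ⟨x, hx, rfl, ?_⟩
      have hx1 : ‖x‖ = 1 := by simpa using hx
      have hq := S.sph_max hΓ hF ht' hc (fun X hX => by
        obtain ⟨u1, u2⟩ := S.unitize ht' hX
        have := h2 _ u1
        have := (Real.log_le_log_iff hc (S.pos _ (S.mem t ht' _ (sph_ne _ u1)))).1 (by linarith)
        rw [u2, mul_comm]; gcongr) (sph_ne x hx) (by rw [hx1, mul_one])
      rw [S.VV_eq m]
      refine mul_nonpos_of_nonneg_of_nonpos (norm_nonneg _) ?_
      have hcR : R ≤ (φ (t, x))⁻¹ := by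
        rw [← Real.log_le_log_iff hR0 (inv_pos.2 hc), Real.log_inv]; exact h1.le
      have hn : ‖(φ (t, x))⁻¹ • x‖ = (φ (t, x))⁻¹ := by
        rw [norm_smul, hx1, mul_one, Real.norm_of_nonneg (inv_pos.2 hc).le]
      have hfu := f_upper hf (Z := (φ (t, x))⁻¹ • x) (by rw [hn]; linarith)
      rw [hn, Real.inv_rpow hc.le] at hfu
      unfold QQ at hq
      simp only at hq
      linarith)
  intro t ht x hx
  have h := this t ht x hx
  have m := S.mem t ht x (sph_ne x hx)
  rw [← Real.log_le_log_iff (inv_pos.2 hR0) (S.pos _ m), Real.log_inv]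
  linarith

lemma E0min (S : Sol Γ F f T U φ) (hΓ : GoodCone Γ) (hF : GoodF Γ F k) (hf : GoodPrescribed f k r₁ r₂)
    (hT : 0 < T) {R : ℝ} (hR0 : 0 < R) (hR : R ≤ r₁) (h0 : ∀ x ∈ Sph n, φ (0, x) ≤ R⁻¹) :
    ∀ t ∈ Icc 0 T, ∀ x ∈ Sph n, φ (t, x) ≤ R⁻¹ := by
  have := MP (isCompact_sphere (0 : E (n + 1)) 1) hT (m := - Real.log R) (w := fun t x => - - Real.log (φ (t, x)))
    (w' := fun t x => - VV φ (t, x)) (S.cont_log _ sph_ne).neg.neg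
    (fun t ht x hx => (S.logderiv (S.mem t ⟨ht.1.le, ht.2.le⟩ x (sph_ne x hx))).neg)
    (fun x hx => by
      rw [neg_neg, ← Real.log_inv]
      exact Real.log_le_log (S.pos _ (S.mem 0 ⟨le_rfl, hT.le⟩ x (sph_ne x hx))) (h0 x hx))
    (fun t ht x hx h1 h2 => by
      have ht' : t ∈ Icc 0 T := ⟨ht.1.le, ht.2.le⟩
      have m := S.mem t ht' x (sph_ne x hx)
      have hc := S.pos _ m
      refine ⟨x, hx, rfl, ?_⟩
      have hx1 : ‖x‖ = 1 := by simpa using hx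
      have hq := S.sph_min hΓ hF ht' hc (fun X hX => by
        obtain ⟨u1, u2⟩ := S.unitize ht' hX
        have := h2 _ u1
        have := (Real.log_le_log_iff (S.pos _ (S.mem t ht' _ (sph_ne _ u1))) hc).1 (by linarith)
        rw [u2, mul_comm]; gcongr) (sph_ne x hx) (by rw [hx1, mul_one])
      rw [S.VV_eq m, neg_nonpos]
      refine mul_nonneg (norm_nonneg _) ?_
      have hcR : (φ (t, x))⁻¹ ≤ R := by
        rw [← Real.log_le_log_iff (inv_pos.2 hc) hR0, Real.log_inv]; linarith
      have hn : ‖(φ (t, x))⁻¹ • x‖ = (φ (t, x))⁻¹ := by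
        rw [norm_smul, hx1, mul_one, Real.norm_of_nonneg (inv_pos.2 hc).le]
      have hfu := f_lower hf (Z := (φ (t, x))⁻¹ • x) (smul_ne_zero (inv_pos.2 hc).ne' (sph_ne x hx)) (by rw [hn]; linarith)
      rw [hn, Real.inv_rpow hc.le] at hfu
      unfold QQ at hq
      simp only at hq
      linarith)
  intro t ht x hx
  have h := this t ht x hx
  have m := S.mem t ht x (sph_ne x hx)
  rw [← Real.log_le_log_iff (S.pos _ m) (inv_pos.2 hR0), Real.log_inv]
  linarith

/-- comparison of speeds at two times -/
lemma speed_cmp (S : Sol Γ F f T U φ) (hΓ : GoodCone Γ) (hF : GoodF Γ F k) (hf : GoodPrescribed f k r₁ r₂)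
    {t1 t2 : ℝ} (h1 : t1 ∈ Icc 0 T) (h2 : t2 ∈ Icc 0 T) {x : E (n + 1)} (hx : x ∈ Sph n) {D : ℝ}
    (hD : D = - Real.log (φ (t1, x)) - - Real.log (φ (t2, x))) (hD0 : 0 ≤ D)
    (hmax : ∀ y ∈ Sph n, - Real.log (φ (t1, y)) - - Real.log (φ (t2, y)) ≤ D) :
    VV φ (t1, x) ≤ Real.exp ((k - 1) * D) * VV φ (t2, x) := by
  have hx0 := sph_ne x hx
  have m1 := S.mem t1 h1 x hx0
  have m2 := S.mem t2 h2 x hx0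
  have p1 := S.pos _ m1
  have p2 := S.pos _ m2
  have hl : 0 < Real.exp (-D) := Real.exp_pos _
  have hle : ∀ X ≠ 0, Real.exp (-D) * φ (t2, X) ≤ φ (t1, LinearIsometryEquiv.refl ℝ (E (n + 1)) X) := by
    intro X hX
    obtain ⟨u1, u2⟩ := S.unitize h1 hX
    obtain ⟨_, u3⟩ := S.unitize h2 hX
    have a1 := S.pos _ (S.mem t1 h1 _ (sph_ne _ u1))
    have a2 := S.pos _ (S.mem t2 h2 _ (sph_ne _ u1))
    have := hmax _ u1
    simp only [LinearIsometryEquiv.coe_refl, _root_.id]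
    rw [u2, u3, mul_left_comm]
    gcongr
    rw [← Real.log_le_log_iff (by positivity) a1, Real.log_mul hl.ne' a2.ne', Real.log_exp]
    linarith
  have heq : φ (t1, LinearIsometryEquiv.refl ℝ (E (n + 1)) x) = Real.exp (-D) * φ (t2, x) := by
    simp only [LinearIsometryEquiv.coe_refl, _root_.id]
    rw [← Real.exp_log p1, ← Real.exp_log p2, ← Real.exp_add]
    congr 1; linarith
  obtain ⟨b1, b2⟩ := S.touch hΓ hF h1 h2 (LinearIsometryEquiv.refl ℝ _) hl hle hx0 heq
  simp only [LinearIsometryEquiv.coe_refl, _root_.id] at b1 b2 heq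
  rw [S.VV_eq m1, S.VV_eq m2, b1]
  have hfs := f_scale hf (c := Real.exp D) (Real.one_le_exp hD0) (Z := (φ (t2, x))⁻¹ • x)
    (smul_ne_zero (inv_pos.2 p2).ne' hx0)
  have ez : Real.exp D • (φ (t2, x))⁻¹ • x = (φ (t1, x))⁻¹ • x := by
    rw [smul_smul, heq, mul_inv, ← Real.exp_neg, neg_neg]
  rw [ez] at hfs
  have ek : Real.exp D ^ k = Real.exp (k * D) := by rw [← Real.exp_mul, mul_comm]
  have ek' : Real.exp (-D) ^ k = Real.exp (-(k * D)) := by rw [← Real.exp_mul]; congr 1; ring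
  rw [ek] at hfs
  rw [ek'] at b2
  have e2 : Real.exp (k * D) * Real.exp (-(k * D)) = 1 := by rw [← Real.exp_add]; simp
  have b3 : QQ f φ (t1, x) ≤ Real.exp (k * D) * QQ f φ (t2, x) := by
    have := mul_le_mul_of_nonneg_left b2 (Real.exp_pos (k * D)).le
    rw [← mul_assoc, e2, one_mul] at this
    exact this
  unfold QQ at b3
  simp only at b3
  have b4 : SS φ (t1, x) ≤ Real.exp (k * D) * SS φ (t2, x) := by linarith
  have e3 : Real.exp ((k - 1) * D) = Real.exp (-D) * Real.exp (k * D) := by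
    rw [← Real.exp_add]; congr 1; ring
  rw [e3]
  have := mul_le_mul_of_nonneg_left b4 (show 0 ≤ Real.exp (-D) * ‖pV φ (t2, x)‖ by positivity)
  linarith

lemma V_bdd (S : Sol Γ F f T U φ) : ∃ B, 0 ≤ B ∧ ∀ t ∈ Icc 0 T, ∀ x ∈ Sph n, |VV φ (t, x)| ≤ B := by
  obtain ⟨C, hC⟩ := (isCompact_Icc.prod (isCompact_sphere (0 : E (n + 1)) 1)).exists_bound_of_continuousOn
    (S.cont_VV (Sph n) sph_ne)
  refine ⟨max C 0, le_max_right _ _, fun t ht x hx => ?_⟩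
  exact (hC (t, x) ⟨ht, hx⟩).trans (le_max_left _ _)

lemma E1a (S : Sol Γ F f T U φ) (hΓ : GoodCone Γ) (hF : GoodF Γ F k) (hf : GoodPrescribed f k r₁ r₂)
    (hT : 0 < T) (hk : k ≤ 1) (h0 : ∀ x ∈ Sph n, 0 ≤ VV φ (0, x)) :
    (∀ t ∈ Icc 0 T, ∀ x ∈ Sph n, 0 ≤ VV φ (t, x)) := by
  obtain ⟨B, hB0, hB⟩ := S.V_bdd
  have := E1abs (isCompact_sphere (0 : E (n + 1)) 1) hT (r := fun t x => - - Real.log (φ (t, x)))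
    (V := fun t x => - VV φ (t, x)) (S.cont_log _ sph_ne).neg.neg (S.cont_VV _ sph_ne).neg
    (fun t ht x hx => (S.logderiv (S.mem t ht x (sph_ne x hx))).neg) le_rfl
    (show 0 ≤ (1 - k) * B by nlinarith) (fun x hx => by linarith [h0 x hx])
    (fun t s hs ht hts x hx h1 h2 => by
      have i1 : t ∈ Icc 0 T := ⟨ht, by linarith⟩
      have i2 : t + s ∈ Icc 0 T := ⟨by linarith, hts⟩
      set D := - - Real.log (φ (t + s, x)) - - - Real.log (φ (t, x)) with hD
      have := S.speed_cmp hΓ hF hf i1 i2 hx (D := D) (by rw [hD]; ring) h1.le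
        (fun y hy => by linarith [h2 y hy])
      have b := (abs_le.1 (hB _ i2 x hx))
      have e1 : Real.exp ((k - 1) * D) ≤ 1 := Real.exp_le_one_iff.2 (by nlinarith)
      have e2 : (k - 1) * D + 1 ≤ Real.exp ((k - 1) * D) := Real.add_one_le_exp _
      have e3 : (1 - Real.exp ((k - 1) * D)) * (- VV φ (t + s, x)) ≤ (1 - Real.exp ((k - 1) * D)) * B :=
        mul_le_mul_of_nonneg_left (by linarith) (by linarith)
      have e4 : (1 - Real.exp ((k - 1) * D)) * B ≤ ((1 - k) * D) * B :=
        mul_le_mul_of_nonneg_right (by linarith) hB0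
      linarith)
  intro t ht x hx
  have := this t ht x hx
  simp at this; exact this

lemma E1c (S : Sol Γ F f T U φ) (hΓ : GoodCone Γ) (hF : GoodF Γ F k) (hf : GoodPrescribed f k r₁ r₂)
    (hT : 0 < T) (hk : 1 ≤ k) (h0 : ∀ x ∈ Sph n, VV φ (0, x) ≤ 0) :
    (∀ t ∈ Icc 0 T, ∀ x ∈ Sph n, VV φ (t, x) ≤ 0) := by
  obtain ⟨B, hB0, hB⟩ := S.V_bdd
  have := E1abs (isCompact_sphere (0 : E (n + 1)) 1) hT (r := fun t x => - Real.log (φ (t, x)))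
    (V := fun t x => VV φ (t, x)) (S.cont_log _ sph_ne).neg (S.cont_VV _ sph_ne)
    (fun t ht x hx => (S.logderiv (S.mem t ht x (sph_ne x hx)))) le_rfl
    (show 0 ≤ (k - 1) * B by nlinarith) (fun x hx => by linarith [h0 x hx])
    (fun t s hs ht hts x hx h1 h2 => by
      have i1 : t ∈ Icc 0 T := ⟨ht, by linarith⟩
      have i2 : t + s ∈ Icc 0 T := ⟨by linarith, hts⟩
      set D := - Real.log (φ (t + s, x)) - - Real.log (φ (t, x)) with hD
      have := S.speed_cmp hΓ hF hf i2 i1 hx (D := D) hD h1.le h2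
      have b := (abs_le.1 (hB _ i2 x hx))
      have e0 : Real.exp (-((k - 1) * D)) * Real.exp ((k - 1) * D) = 1 := by rw [← Real.exp_add]; simp
      have e1 : Real.exp (-((k - 1) * D)) ≤ 1 := Real.exp_le_one_iff.2 (by nlinarith)
      have e2 : -((k - 1) * D) + 1 ≤ Real.exp (-((k - 1) * D)) := Real.add_one_le_exp _
      have e5 := mul_le_mul_of_nonneg_left this (Real.exp_pos (-((k - 1) * D))).le
      rw [← mul_assoc, e0, one_mul] at e5
      have e3 : (1 - Real.exp (-((k - 1) * D))) * (VV φ (t + s, x)) ≤ (1 - Real.exp (-((k - 1) * D))) * B :=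
        mul_le_mul_of_nonneg_left (by linarith) (by linarith)
      have e4 : (1 - Real.exp (-((k - 1) * D))) * B ≤ ((k - 1) * D) * B :=
        mul_le_mul_of_nonneg_right (by linarith) hB0
      linarith)
  intro t ht x hx
  have := this t ht x hx
  simpa using this

lemma E1b (S : Sol Γ F f T U φ) (hΓ : GoodCone Γ) (hF : GoodF Γ F k) (hf : GoodPrescribed f k r₁ r₂)
    (hT : 0 < T) (hk : k ≤ 1) (h0 : ∀ x ∈ Sph n, 0 ≤ VV φ (0, x)) {m : ℝ} (hm0 : 0 ≤ m)
    (hm : ∀ x ∈ Sph n, VV φ (0, x) ≤ m) :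
    (∀ t ∈ Icc 0 T, ∀ x ∈ Sph n, VV φ (t, x) ≤ m) := by
  have hp := S.E1a hΓ hF hf hT hk h0
  have := E1abs (isCompact_sphere (0 : E (n + 1)) 1) hT (r := fun t x => - Real.log (φ (t, x)))
    (V := fun t x => VV φ (t, x)) (S.cont_log _ sph_ne).neg (S.cont_VV _ sph_ne)
    (fun t ht x hx => (S.logderiv (S.mem t ht x (sph_ne x hx)))) hm0 le_rfl hm
    (fun t s hs ht hts x hx h1 h2 => by
      have i1 : t ∈ Icc 0 T := ⟨ht, by linarith⟩
      have i2 : t + s ∈ Icc 0 T := ⟨by linarith, hts⟩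
      set D := - Real.log (φ (t + s, x)) - - Real.log (φ (t, x)) with hD
      have := S.speed_cmp hΓ hF hf i2 i1 hx (D := D) hD h1.le h2
      have e1 : Real.exp ((k - 1) * D) ≤ 1 := Real.exp_le_one_iff.2 (by nlinarith)
      nlinarith [hp t i1 x hx])
  intro t ht x hx
  have := this t ht x hx
  simpa using this

lemma E1d (S : Sol Γ F f T U φ) (hΓ : GoodCone Γ) (hF : GoodF Γ F k) (hf : GoodPrescribed f k r₁ r₂)
    (hT : 0 < T) (hk : 1 ≤ k) (h0 : ∀ x ∈ Sph n, VV φ (0, x) ≤ 0) {m : ℝ} (hm0 : 0 ≤ m)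
    (hm : ∀ x ∈ Sph n, - VV φ (0, x) ≤ m) :
    (∀ t ∈ Icc 0 T, ∀ x ∈ Sph n, - VV φ (t, x) ≤ m) := by
  have hp := S.E1c hΓ hF hf hT hk h0
  have := E1abs (isCompact_sphere (0 : E (n + 1)) 1) hT (r := fun t x => - - Real.log (φ (t, x)))
    (V := fun t x => - VV φ (t, x)) (S.cont_log _ sph_ne).neg.neg (S.cont_VV _ sph_ne).neg
    (fun t ht x hx => (S.logderiv (S.mem t ht x (sph_ne x hx))).neg) hm0 le_rfl hm
    (fun t s hs ht hts x hx h1 h2 => by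
      have i1 : t ∈ Icc 0 T := ⟨ht, by linarith⟩
      have i2 : t + s ∈ Icc 0 T := ⟨by linarith, hts⟩
      set D := - - Real.log (φ (t + s, x)) - - - Real.log (φ (t, x)) with hD
      have := S.speed_cmp hΓ hF hf i1 i2 hx (D := D) (by rw [hD]; ring) h1.le
        (fun y hy => by linarith [h2 y hy])
      have e1 : 1 ≤ Real.exp ((k - 1) * D) := Real.one_le_exp (by nlinarith)
      nlinarith [hp _ i2 x hx])
  intro t ht x hx
  have := this t ht x hx
  simpa using this
end Sol


/-- annulus -/
def An (n : ℕ) (R₁ R₂ : ℝ) : Set (E (n + 1)) := {Z | R₁ ≤ ‖Z‖ ∧ ‖Z‖ ≤ R₂}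

lemma An_compact {n : ℕ} (R₁ R₂ : ℝ) : IsCompact (An n R₁ R₂) := by
  refine (isCompact_closedBall (0 : E (n + 1)) R₂).of_isClosed_subset ?_ fun Z hZ => by simpa using hZ.2
  exact (isClosed_le continuous_const continuous_norm).inter (isClosed_le continuous_norm continuous_const)

lemma An_ne {n : ℕ} {R₁ R₂ : ℝ} (h : 0 < R₁) {Z : E (n + 1)} (hZ : Z ∈ An n R₁ R₂) : Z ≠ 0 :=
  norm_pos_iff.1 (h.trans_le hZ.1)

lemma lip_compact {X : Type*} [NormedAddCommGroup X] [NormedSpace ℝ X] {g : X → ℝ} {U K : Set X} (hU : IsOpen U)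
    (hg : ContDiffOn ℝ (⊤ : ℕ∞) g U) (hK : IsCompact K) (hKU : K ⊆ U) :
    ∃ L, 0 ≤ L ∧ ∀ x ∈ K, ∀ y ∈ K, |g x - g y| ≤ L * ‖x - y‖ := by
  have : LocallyLipschitzOn K g := by
    intro x hx
    obtain ⟨C, t, ht, h⟩ := ((hg.contDiffAt (hU.mem_nhds (hKU hx))).of_le (m := 1) (by exact_mod_cast le_top)).exists_lipschitzOnWith
    exact ⟨C, t, nhdsWithin_le_nhds ht, h⟩
  obtain ⟨C, hC⟩ := this.exists_lipschitzOnWith_of_compact hK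
  refine ⟨C, C.2, fun x hx y hy => ?_⟩
  have := hC.dist_le_mul x hx y hy
  rwa [Real.dist_eq, dist_eq_norm] at this

section
variable {n : ℕ} {f : E (n + 1) → ℝ} {k r₁ r₂ R₁ R₂ : ℝ}

lemma ne_open {n : ℕ} : IsOpen {X : E (n + 1) | X ≠ 0} := isOpen_ne

lemma f_lip (hf : GoodPrescribed f k r₁ r₂) (h : 0 < R₁) : ∃ L, 0 ≤ L ∧ ∀ Z ∈ An n R₁ R₂, ∀ Z' ∈ An n R₁ R₂,
    f Z ≤ Real.exp (L * ‖Z - Z'‖) * f Z' := by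
  obtain ⟨L, hL, h2⟩ := lip_compact ne_open (hf.1.log fun X hX => (hf.2.1 X hX).ne') (An_compact (n := n) R₁ R₂)
    (fun Z hZ => An_ne h hZ)
  refine ⟨L, hL, fun Z hZ Z' hZ' => ?_⟩
  have := (abs_le.1 (h2 Z hZ Z' hZ')).2
  have p1 := hf.2.1 Z (An_ne h hZ)
  have p2 := hf.2.1 Z' (An_ne h hZ')
  rw [← Real.log_le_log_iff p1 (by positivity), Real.log_mul (Real.exp_pos _).ne' p2.ne', Real.log_exp]
  linarith

lemma f_ray (hf : GoodPrescribed f k r₁ r₂) {Z : E (n + 1)} {s : ℝ} (hZ : s • Z ≠ 0) :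
    HasDerivAt (fun s : ℝ => f (s • Z)) (fderiv ℝ f (s • Z) Z) s := by
  have h1 := (sm_diff ne_open hf.1 hZ).hasFDerivAt
  have h2 : HasDerivAt (fun s : ℝ => s • Z) ((1 : ℝ) • Z) s := (hasDerivAt_id s).smul_const Z
  have := h1.comp_hasDerivAt s h2
  rw [one_smul] at this
  exact this

lemma f_rad (hf : GoodPrescribed f k r₁ r₂) {Z : E (n + 1)} (hZ : Z ≠ 0) : k * f Z < fderiv ℝ f Z Z := by
  have hZ' : 0 < ‖Z‖ := norm_pos_iff.2 hZ
  set x := ‖Z‖⁻¹ • Z with hx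
  have hx1 : ‖x‖ = 1 := by rw [hx, norm_smul, norm_inv, norm_norm, inv_mul_cancel₀ hZ'.ne']
  have e1 : ‖Z‖ • x = Z := by rw [hx, smul_smul, mul_inv_cancel₀ hZ'.ne', one_smul]
  have h1 := hf.2.2.1 x hx1 ‖Z‖ hZ'
  have h2 := (Real.hasDerivAt_rpow_const (x := ‖Z‖) (p := -k) (Or.inl hZ'.ne')).mul (f_ray hf (Z := x) (s := ‖Z‖) (by rwa [e1]))
  have h3 : deriv (fun s : ℝ => s ^ (-k) * f (s • x)) ‖Z‖ = _ := h2.deriv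
  rw [h3, e1, hx, map_smul, Real.rpow_sub_one hZ'.ne'] at h1
  have h4 : -k * (‖Z‖ ^ (-k) / ‖Z‖) * f Z + ‖Z‖ ^ (-k) * ‖Z‖⁻¹ • (fderiv ℝ f Z) Z
    = (‖Z‖ ^ (-k) / ‖Z‖) * (fderiv ℝ f Z Z - k * f Z) := by
    rw [smul_eq_mul]; field_simp; ring
  rw [h4] at h1
  have := pos_of_mul_pos_right h1 (by positivity)
  linarith

lemma f_strict (hf : GoodPrescribed f k r₁ r₂) (h : 0 < R₁) : ∃ d, 0 < d ∧ ∀ Z ∈ An n R₁ R₂, ∀ c, 1 ≤ c →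
    c * ‖Z‖ ≤ R₂ → c ^ (k + d) * f Z ≤ f (c • Z) := by
  obtain ⟨d, hd, hd2⟩ : ∃ d, 0 < d ∧ ∀ Z ∈ An n R₁ R₂, (k + d) * f Z ≤ fderiv ℝ f Z Z := by
    rcases (An n R₁ R₂).eq_empty_or_nonempty with he | hne
    · exact ⟨1, one_pos, by simp [he]⟩
    have hcont : ContinuousOn (fun Z => fderiv ℝ f Z Z / f Z - k) (An n R₁ R₂) := by
      have hsub : An n R₁ R₂ ⊆ {X : E (n + 1) | X ≠ 0} := fun Z hZ => An_ne h hZ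
      refine ContinuousOn.sub (ContinuousOn.div ?_ (hf.1.continuousOn.mono hsub) fun Z hZ => (hf.2.1 Z (hsub hZ)).ne') continuousOn_const
      exact ((sm_fderiv ne_open hf.1).continuousOn.mono hsub).clm_apply continuousOn_id
    obtain ⟨Z0, hZ0, hmin⟩ := (An_compact R₁ R₂).exists_isMinOn hne hcont
    refine ⟨fderiv ℝ f Z0 Z0 / f Z0 - k, ?_, fun Z hZ => ?_⟩
    · have := f_rad hf (An_ne h hZ0)
      have p := hf.2.1 Z0 (An_ne h hZ0)
      rw [sub_pos, lt_div_iff₀ p]; exact this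
    · have p := hf.2.1 Z (An_ne h hZ)
      have : fderiv ℝ f Z0 Z0 / f Z0 - k ≤ fderiv ℝ f Z Z / f Z - k := hmin hZ
      rw [← le_div_iff₀ p]; linarith
  refine ⟨d, hd, fun Z hZ c hc hcR => ?_⟩
  have hZ0 := An_ne h hZ
  have hs : ∀ s ∈ Icc 1 c, s • Z ∈ An n R₁ R₂ := fun s hs => by
    have hs0 : 0 ≤ s := by linarith [hs.1]
    have e : ‖s • Z‖ = s * ‖Z‖ := by rw [norm_smul, Real.norm_of_nonneg hs0]
    constructor
    · rw [e]; nlinarith [hZ.1, hs.1]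
    · rw [e]; nlinarith [hs.2, norm_nonneg Z]
  have hder : ∀ s ∈ Icc 1 c, HasDerivAt (fun s : ℝ => Real.log (f (s • Z)) - (k + d) * Real.log s)
      (fderiv ℝ f (s • Z) Z / f (s • Z) - (k + d) * s⁻¹) s := fun s hs' => by
    have hn := An_ne h (hs s hs')
    exact ((f_ray hf hn).log (hf.2.1 _ hn).ne').sub ((Real.hasDerivAt_log (by linarith [hs'.1])).const_mul _)
  have hmono : MonotoneOn (fun s : ℝ => Real.log (f (s • Z)) - (k + d) * Real.log s) (Icc 1 c) := by
    refine monotoneOn_of_deriv_nonneg (convex_Icc 1 c) (fun s hs => (hder s hs).continuousAt.continuousWithinAt)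
      (fun s hs => (hder s (interior_subset hs)).differentiableAt.differentiableWithinAt) (fun s hs' => ?_)
    have hs'' := interior_subset hs'
    rw [(hder s hs'').deriv]
    have hn := An_ne h (hs s hs'')
    have := hd2 _ (hs s hs'')
    rw [map_smul, smul_eq_mul] at this
    have s0 : 0 < s := by linarith [hs''.1]
    rw [sub_nonneg, le_div_iff₀ (hf.2.1 _ hn), mul_assoc, mul_comm s⁻¹, ← mul_assoc, ← div_eq_mul_inv, div_le_iff₀ s0]
    linarith
  have := hmono (left_mem_Icc.2 hc) (right_mem_Icc.2 hc) hc
  simp only [one_smul, Real.log_one, mul_zero, sub_zero] at this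
  have c0 : 0 < c := by linarith
  have p1 := hf.2.1 _ hZ0
  have p2 := hf.2.1 _ (An_ne h (hs c (right_mem_Icc.2 hc)))
  rw [← Real.log_le_log_iff (by positivity) p2, Real.log_mul (by positivity) p1.ne', Real.log_rpow c0]
  linarith
end

lemma exp_aux {k D s : ℝ} (hD0 : 0 ≤ D) (hs : (k - 1) * s ≤ 0) :
    Real.exp (-D) * Real.exp (k * D) * s ≤ s := by
  rw [← Real.exp_add]
  have e : -D + k * D = (k - 1) * D := by ring
  rw [e]
  rcases lt_trichotomy k 1 with hk | hk | hk
  · have : Real.exp ((k - 1) * D) ≤ 1 := Real.exp_le_one_iff.2 (by nlinarith)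
    have : 0 ≤ s := by nlinarith
    nlinarith
  · rw [hk]; simp
  · have : 1 ≤ Real.exp ((k - 1) * D) := Real.one_le_exp (by nlinarith)
    have : s ≤ 0 := by nlinarith
    nlinarith

namespace Sol
variable {n : ℕ} {Γ : Set (Fin n → ℝ)} {F : (Fin n → ℝ) → ℝ} {f : E (n + 1) → ℝ} {T k r₁ r₂ R₁ R₂ : ℝ}
    {U : Set (ℝ × E (n + 1))} {φ : ℝ × E (n + 1) → ℝ}

set_option maxHeartbeats 1000000 in
lemma E2rot (S : Sol Γ F f T U φ) (hΓ : GoodCone Γ) (hF : GoodF Γ F k) (hf : GoodPrescribed f k r₁ r₂)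
    (hT : 0 < T) (hR1 : 0 < R₁) (hlo : ∀ t ∈ Icc 0 T, ∀ x ∈ Sph n, R₂⁻¹ ≤ φ (t, x))
    (hR2 : 0 < R₂) (hhi : ∀ t ∈ Icc 0 T, ∀ x ∈ Sph n, φ (t, x) ≤ R₁⁻¹)
    (hS : ∀ t ∈ Icc 0 T, ∀ x ∈ Sph n, (k - 1) * SS φ (t, x) ≤ 0)
    {d L Λ : ℝ} (hd : 0 < d) (hd2 : ∀ Z ∈ An n R₁ R₂, ∀ c, 1 ≤ c → c * ‖Z‖ ≤ R₂ → c ^ (k + d) * f Z ≤ f (c • Z))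
    (hL : 0 ≤ L) (hL2 : ∀ Z ∈ An n R₁ R₂, ∀ Z' ∈ An n R₁ R₂, f Z ≤ Real.exp (L * ‖Z - Z'‖) * f Z')
    (hΛ0 : 0 ≤ Λ) (hΛ : L * R₂ ≤ Λ * d)
    (hini : ∀ x ∈ Sph n, ∀ y ∈ Sph n, - Real.log (φ (0, y)) - - Real.log (φ (0, x)) ≤ Λ * ‖y - x‖)
    (R : E (n + 1) ≃ₗᵢ[ℝ] E (n + 1)) {δ : ℝ} (hδ0 : 0 ≤ δ) (hδ : ∀ x, ‖R x - x‖ ≤ δ * ‖x‖) :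
    ∀ t ∈ Icc 0 T, ∀ x ∈ Sph n, - Real.log (φ (t, R x)) - - Real.log (φ (t, x)) ≤ Λ * δ := by
  have hRs : ∀ x ∈ Sph n, R x ∈ Sph n := fun x hx => by simpa using hx
  refine MP (isCompact_sphere (0 : E (n + 1)) 1) hT
    (w := fun t x => - Real.log (φ (t, R x)) - - Real.log (φ (t, x)))
    (w' := fun t x => VV φ (t, R x) - VV φ (t, x)) ?_ ?_ ?_ ?_
  · refine ContinuousOn.sub (ContinuousOn.neg ?_) (S.cont_log _ sph_ne).neg
    refine (S.cont_log (Sph n) sph_ne).comp (f := fun q : ℝ × E (n + 1) => (q.1, R q.2)) ?_ ?_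
    · exact (continuous_fst.prodMk (R.continuous.comp continuous_snd)).continuousOn
    · exact fun q hq => ⟨hq.1, hRs _ hq.2⟩
  · intro t ht x hx
    have ht' : t ∈ Icc 0 T := ⟨ht.1.le, ht.2.le⟩
    exact (S.logderiv (S.mem t ht' _ (sph_ne _ (hRs x hx)))).sub (S.logderiv (S.mem t ht' _ (sph_ne _ hx)))
  · intro x hx
    refine (hini x hx _ (hRs x hx)).trans ?_
    have := hδ x
    have hx1 : ‖x‖ = 1 := by simpa using hx
    rw [hx1, mul_one] at this
    gcongr
  · intro t ht x hx h1 h2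
    have ht' : t ∈ Icc 0 T := ⟨ht.1.le, ht.2.le⟩
    refine ⟨x, hx, rfl, ?_⟩
    have hx0 := sph_ne x hx
    have hx1 : ‖x‖ = 1 := by simpa using hx
    have m1 := S.mem t ht' _ (sph_ne _ (hRs x hx))
    have m2 := S.mem t ht' x hx0
    have p1 := S.pos _ m1
    have p2 := S.pos _ m2
    set D := - Real.log (φ (t, R x)) - - Real.log (φ (t, x)) with hD
    have hD0 : 0 ≤ D := le_trans (by positivity) h1.le
    have hl : 0 < Real.exp (-D) := Real.exp_pos _
    have hle : ∀ X ≠ 0, Real.exp (-D) * φ (t, X) ≤ φ (t, R X) := by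
      intro X hX
      obtain ⟨v1, v2⟩ := S.unitize ht' (X := R X) (by simpa using hX)
      obtain ⟨u1, u3⟩ := S.unitize ht' hX
      rw [R.norm_map, ← map_smul] at v2
      have a1 := S.pos _ (S.mem t ht' _ (sph_ne _ (hRs _ u1)))
      have a2 := S.pos _ (S.mem t ht' _ (sph_ne _ u1))
      have := h2 _ u1
      rw [v2, u3, mul_left_comm]
      gcongr
      rw [← Real.log_le_log_iff (by positivity) a1, Real.log_mul hl.ne' a2.ne', Real.log_exp]
      linarith
    have heq : φ (t, R x) = Real.exp (-D) * φ (t, x) := by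
      rw [← Real.exp_log p1, ← Real.exp_log p2, ← Real.exp_add]
      congr 1; linarith
    obtain ⟨b1, b2⟩ := S.touch hΓ hF ht' ht' R hl hle hx0 heq
    rw [S.VV_eq m1, S.VV_eq m2, b1]
    set Z := (φ (t, x))⁻¹ • x with hZ
    have hZn : ‖Z‖ = (φ (t, x))⁻¹ := by rw [hZ, norm_smul, hx1, mul_one, Real.norm_of_nonneg (inv_pos.2 p2).le]
    have hZA : Z ∈ An n R₁ R₂ := by
      refine ⟨?_, ?_⟩ <;> rw [hZn]
      · rw [← inv_inv R₁]; exact inv_anti₀ p2 (hhi t ht' x hx)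
      · rw [← inv_inv R₂]; exact inv_anti₀ (inv_pos.2 hR2) (hlo t ht' x hx)
    have hRZ : R Z ∈ An n R₁ R₂ := ⟨by rw [R.norm_map]; exact hZA.1, by rw [R.norm_map]; exact hZA.2⟩
    have ez : (φ (t, R x))⁻¹ • R x = Real.exp D • R Z := by
      rw [hZ, map_smul, smul_smul, heq, mul_inv, ← Real.exp_neg, neg_neg]
    have f1 := hd2 (R Z) hRZ (Real.exp D) (Real.one_le_exp hD0) (by
      rw [R.norm_map, hZn]
      have : Real.exp D * (φ (t, x))⁻¹ = (φ (t, R x))⁻¹ := by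
        rw [heq, mul_inv, ← Real.exp_neg, neg_neg]
      rw [this, ← inv_inv R₂]; exact inv_anti₀ (inv_pos.2 hR2) (hlo t ht' _ (hRs x hx)))
    have f2 := hL2 Z hZA (R Z) hRZ
    have hfZ := hf.2.1 Z (An_ne hR1 hZA)
    have hfRZ := hf.2.1 _ (An_ne hR1 hRZ)
    have f3 : Real.exp (L * ‖Z - R Z‖) ≤ Real.exp (d * D) := by
      refine Real.exp_le_exp.2 ?_
      rw [norm_sub_rev]
      have := hδ Z
      have h3 : δ * ‖Z‖ ≤ δ * R₂ := by gcongr; exact hZA.2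
      have h4 : L * ‖R Z - Z‖ ≤ L * (δ * R₂) := by gcongr; linarith
      have h5 : d * (Λ * δ) ≤ d * D := by gcongr
      have h6 : L * R₂ * δ ≤ Λ * d * δ := by gcongr
      linarith
    have f4 : f Z ≤ Real.exp (d * D) * f (R Z) := f2.trans (by gcongr)
    have ek : Real.exp D ^ (k + d) = Real.exp (k * D) * Real.exp (d * D) := by
      rw [← Real.exp_mul, ← Real.exp_add]; congr 1; ring
    have ek' : Real.exp (-D) ^ k = Real.exp (-(k * D)) := by rw [← Real.exp_mul]; congr 1; ring
    rw [ek] at f1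
    rw [ek'] at b2
    have f5 : Real.exp (k * D) * f Z ≤ f (Real.exp D • R Z) := by
      have := mul_le_mul_of_nonneg_left f4 (Real.exp_pos (k * D)).le
      linarith
    have e2 : Real.exp (k * D) * Real.exp (-(k * D)) = 1 := by rw [← Real.exp_add]; simp
    have b3 : QQ f φ (t, R x) ≤ Real.exp (k * D) * QQ f φ (t, x) := by
      have := mul_le_mul_of_nonneg_left b2 (Real.exp_pos (k * D)).le
      rw [← mul_assoc, e2, one_mul] at this
      exact this
    unfold QQ at b3
    simp only [ez] at b3
    rw [← hZ] at b3
    have b4 : SS φ (t, R x) ≤ Real.exp (k * D) * SS φ (t, x) := by linarith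
    have b5 := exp_aux hD0 (hS t ht' x hx)
    have b6 : Real.exp (-D) * SS φ (t, R x) ≤ SS φ (t, x) := by
      have := mul_le_mul_of_nonneg_left b4 hl.le
      linarith
    have := mul_le_mul_of_nonneg_left b6 (norm_nonneg (pV φ (t, x)))
    linarith


lemma rot_exists {x e : E (n + 1)} (hx : ‖x‖ = 1) (he : ‖e‖ = 1) (hxe : ⟪x, e⟫ = 0) {s : ℝ} (hs : |s| ≤ 1) :
    ∃ R : E (n + 1) ≃ₗᵢ[ℝ] E (n + 1), (∀ z, ‖R z - z‖ ≤ 8 * |s| * ‖z‖) ∧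
      (1 - s ^ 2) • x + (2 * s) • e = (1 + s ^ 2) • R x := by
  have hex : ⟪e, x⟫ = 0 := by rw [real_inner_comm]; exact hxe
  have hxx : ⟪x, x⟫ = 1 := by rw [real_inner_self_eq_norm_sq, hx]; norm_num
  have hee : ⟪e, e⟫ = 1 := by rw [real_inner_self_eq_norm_sq, he]; norm_num
  have hc : ‖x + s • e‖ ^ 2 = 1 + s ^ 2 := by
    rw [← real_inner_self_eq_norm_sq]
    simp only [inner_add_left, inner_add_right, inner_smul_left, inner_smul_right, hxe, hex, hxx, hee]
    simp; ring
  have hpos : 0 < 1 + s ^ 2 := by positivity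
  have rx : ∀ z, Submodule.reflection (ℝ ∙ x) z = (2 * ⟪x, z⟫) • x - z := fun z => by
    rw [Submodule.reflection_singleton_apply, hx]; simp [← smul_assoc]
  have rc : ∀ z, Submodule.reflection (ℝ ∙ (x + s • e)) z = (2 * (⟪x + s • e, z⟫ / (1 + s ^ 2))) • (x + s • e) - z := fun z => by
    rw [Submodule.reflection_singleton_apply]; simp [hc, ← smul_assoc, mul_assoc]
  refine ⟨(Submodule.reflection (ℝ ∙ x)).trans (Submodule.reflection (ℝ ∙ (x + s • e))), fun z => ?_, ?_⟩
  · set y := Submodule.reflection (ℝ ∙ x) z with hy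
    have hyz : ‖y‖ = ‖z‖ := LinearIsometryEquiv.norm_map _ _
    have hz : z = (2 * ⟪x, y⟫) • x - y := by
      rw [← rx y, hy, Submodule.reflection_reflection]
    rw [LinearIsometryEquiv.trans_apply, ← hy, rc]
    have e1 : (2 * (⟪x + s • e, y⟫ / (1 + s ^ 2))) • (x + s • e) - y - z =
        (1 + s ^ 2)⁻¹ • ((2 * s * ⟪x, y⟫) • e + (2 * s * ⟪e, y⟫) • x + (2 * s ^ 2 * ⟪e, y⟫) • e - (2 * s ^ 2 * ⟪x, y⟫) • x) := by
      rw [hz, inner_add_left, inner_smul_left]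
      simp only [conj_trivial]
      match_scalars
      · field_simp; ring
      · field_simp
      · field_simp; ring
    rw [e1, norm_smul, Real.norm_of_nonneg (by positivity)]
    have a1 : |⟪x, y⟫| ≤ ‖z‖ := by have := abs_real_inner_le_norm x y; rwa [hx, one_mul, hyz] at this
    have a2 : |⟪e, y⟫| ≤ ‖z‖ := by have := abs_real_inner_le_norm e y; rwa [he, one_mul, hyz] at this
    have hs2 : s ^ 2 ≤ |s| := by rw [← sq_abs]; nlinarith [abs_nonneg s]
    have hz0 := norm_nonneg z
    have a3 : ‖(2 * s * ⟪x, y⟫) • e‖ ≤ 2 * |s| * ‖z‖ := by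
      rw [norm_smul, he, mul_one, Real.norm_eq_abs, abs_mul, abs_mul, abs_two]; gcongr
    have a4 : ‖(2 * s * ⟪e, y⟫) • x‖ ≤ 2 * |s| * ‖z‖ := by
      rw [norm_smul, hx, mul_one, Real.norm_eq_abs, abs_mul, abs_mul, abs_two]; gcongr
    have a5 : ‖(2 * s ^ 2 * ⟪e, y⟫) • e‖ ≤ 2 * |s| * ‖z‖ := by
      rw [norm_smul, he, mul_one, Real.norm_eq_abs, abs_mul, abs_mul, abs_two, abs_sq]; gcongr
    have a6 : ‖(2 * s ^ 2 * ⟪x, y⟫) • x‖ ≤ 2 * |s| * ‖z‖ := by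
      rw [norm_smul, hx, mul_one, Real.norm_eq_abs, abs_mul, abs_mul, abs_two, abs_sq]; gcongr
    have a7 := norm_sub_le ((2 * s * ⟪x, y⟫) • e + (2 * s * ⟪e, y⟫) • x + (2 * s ^ 2 * ⟪e, y⟫) • e) ((2 * s ^ 2 * ⟪x, y⟫) • x)
    have a8 := norm_add₃_le (a := (2 * s * ⟪x, y⟫) • e) (b := (2 * s * ⟪e, y⟫) • x) (c := (2 * s ^ 2 * ⟪e, y⟫) • e)
    have a9 : (1 + s ^ 2)⁻¹ ≤ 1 := inv_le_one_of_one_le₀ (by nlinarith)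
    calc _ ≤ 1 * (8 * |s| * ‖z‖) := mul_le_mul a9 (by linarith) (norm_nonneg _) zero_le_one
      _ = _ := one_mul _
  · rw [LinearIsometryEquiv.trans_apply, rx, hxx, rc]
    simp only [mul_one, inner_sub_right, inner_smul_right, inner_add_left, inner_smul_left, hxx, hex, conj_trivial]
    match_scalars
    · field_simp; ring
    · field_simp; ring

lemma E2 (S : Sol Γ F f T U φ) {t : ℝ} (ht : t ∈ Icc 0 T) {Λ : ℝ} (hΛ0 : 0 ≤ Λ)
    (h : ∀ (R : E (n + 1) ≃ₗᵢ[ℝ] E (n + 1)) (δ : ℝ), 0 ≤ δ → (∀ x, ‖R x - x‖ ≤ δ * ‖x‖) →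
      ∀ x ∈ Sph n, - Real.log (φ (t, R x)) - - Real.log (φ (t, x)) ≤ Λ * δ)
    {x : E (n + 1)} (hx : x ∈ Sph n) : ‖pV φ (t, x)‖ ≤ (1 + 4 * Λ) * φ (t, x) := by
  have hx0 := sph_ne x hx
  have hx1 : ‖x‖ = 1 := by simpa using hx
  have m := S.mem t ht x hx0
  have p0 := S.pos _ m
  have key : ∀ e : E (n + 1), ‖e‖ = 1 → ⟪x, e⟫ = 0 → ⟪pV φ (t, x), e⟫ ≤ 4 * Λ * φ (t, x) := by
    intro e he hxe
    have hd : HasDerivAt (fun s : ℝ => φ (t, (1 - s ^ 2) • x + (2 * s) • e)) (2 * ⟪pV φ (t, x), e⟫) 0 := by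
      have h1 : HasDerivAt (fun s : ℝ => ((t, (1 - s ^ 2) • x + (2 * s) • e) : ℝ × E (n + 1))) ((0 : ℝ), (2 : ℝ) • e) 0 := by
        refine (hasDerivAt_const _ _).prodMk ?_
        have a1 : HasDerivAt (fun s : ℝ => 1 - s ^ 2) 0 0 := by simpa using ((hasDerivAt_id (0 : ℝ)).pow 2).const_sub 1
        have a2 : HasDerivAt (fun s : ℝ => 2 * s) 2 0 := by simpa using (hasDerivAt_id (0 : ℝ)).const_mul 2
        have a3 := (a1.smul_const x).add (a2.smul_const e)
        rw [zero_smul, zero_add] at a3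
        exact a3
      have h2 : HasFDerivAt φ (fderiv ℝ φ (t, x)) ((fun s : ℝ => ((t, (1 - s ^ 2) • x + (2 * s) • e) : ℝ × E (n + 1))) 0) := by
        simpa using (sm_diff S.op S.sm m).hasFDerivAt
      have h3 := h2.comp_hasDerivAt (0 : ℝ) h1
      have h4 : fderiv ℝ φ (t, x) ((0 : ℝ), (2 : ℝ) • e) = 2 * ⟪pV φ (t, x), e⟫ := by
        rw [pV_inner]; unfold dd
        have : ((0 : ℝ), (2 : ℝ) • e) = (2 : ℝ) • ((0 : ℝ), e) := by simp
        rw [this, map_smul, smul_eq_mul]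
      rw [h4] at h3
      exact h3
    have hg : HasDerivAt (fun s : ℝ => Real.exp (8 * Λ * s) * φ (t, x) - φ (t, (1 - s ^ 2) • x + (2 * s) • e))
        (8 * Λ * φ (t, x) - 2 * ⟪pV φ (t, x), e⟫) 0 := by
      refine HasDerivAt.sub ?_ hd
      have := (((hasDerivAt_id (0 : ℝ)).const_mul (8 * Λ)).exp).mul_const (φ (t, x))
      simpa using this
    have := left_deriv_nonneg (a := -1) (by norm_num) hg fun s hs => by
      obtain ⟨R, hR, hR2⟩ := rot_exists hx1 he hxe (s := s) (by rw [abs_le]; constructor <;> linarith [hs.1, hs.2])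
      have h1 := h R (8 * |s|) (by positivity) hR x hx
      have hRx : R x ∈ Sph n := by simpa using hx
      have mR := S.mem t ht _ (sph_ne _ hRx)
      have pR := S.pos _ mR
      rw [hR2, S.hom _ (by positivity) _ _ mR]
      have h2 : Real.exp (8 * Λ * s) * φ (t, x) ≤ φ (t, R x) := by
        rw [← Real.log_le_log_iff (by positivity) pR, Real.log_mul (Real.exp_pos _).ne' p0.ne', Real.log_exp]
        rw [abs_of_neg hs.2] at h1
        linarith
      have h3 : φ (t, R x) ≤ (1 + s ^ 2) * φ (t, R x) := by nlinarith [sq_nonneg s]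
      simp
      linarith
    linarith
  set p := pV φ (t, x) with hp
  have hpx : ⟪p, x⟫ = φ (t, x) := S.inner_pX m
  have hxx : ⟪x, x⟫ = 1 := by rw [real_inner_self_eq_norm_sq, hx1]; norm_num
  have hq : ‖p - φ (t, x) • x‖ ≤ 4 * Λ * φ (t, x) := by
    set q := p - φ (t, x) • x with hq
    rcases eq_or_ne q 0 with h0 | h0
    · rw [h0, norm_zero]; positivity
    have hq0 : 0 < ‖q‖ := norm_pos_iff.2 h0
    have hxq : ⟪x, q⟫ = 0 := by
      rw [hq, inner_sub_right, inner_smul_right, hxx, real_inner_comm, hpx]; ring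
    have := key (‖q‖⁻¹ • q) (by rw [norm_smul, norm_inv, norm_norm, inv_mul_cancel₀ hq0.ne'])
      (by rw [inner_smul_right, hxq, mul_zero])
    have e2 : ⟪p, q⟫ = ‖q‖ ^ 2 := by
      have : p = q + φ (t, x) • x := by rw [hq]; abel
      rw [this, inner_add_left, inner_smul_left, hxq, real_inner_self_eq_norm_sq]; simp
    rw [inner_smul_right, e2] at this
    have e3 : ‖q‖⁻¹ * ‖q‖ ^ 2 = ‖q‖ := by field_simp
    rwa [e3] at this
  have e : p = (p - φ (t, x) • x) + φ (t, x) • x := by abel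
  rw [e]
  refine (norm_add_le _ _).trans ?_
  rw [norm_smul, hx1, Real.norm_of_nonneg p0.le]
  linarith

end Sol


lemma T2.mul_bdd {c g : ℝ → ℝ} (h : T2 c 0 0 0) {B : ℝ} (hB : ∀ᶠ s in nhds 0, |g s| ≤ B) :
    T2 (fun s => c s * g s) 0 0 0 := by
  unfold T2 at *
  simp only [zero_mul, add_zero, sub_zero] at *
  have h2 : g =O[nhds 0] (fun _ => (1 : ℝ)) := by
    refine Asymptotics.IsBigO.of_bound B ?_
    filter_upwards [hB] with s hs; simpa using hs
  simpa using h.mul_isBigO h2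

lemma T2.comp {G P : ℝ → ℝ} {a b c g0 g1 g2 : ℝ} (hG : T2 (fun r => G (a + r)) g0 g1 g2) (h : T2 P a b c) :
    T2 (fun s => G (P s)) g0 (g1 * b) (g1 * c + g2 * b ^ 2) := by
  have hr : T2 (fun s => P s - a) 0 b c := (h.sub (T2.const a)).coef (by ring) (by ring) (by ring)
  have h1 : (fun s => G (a + (P s - a)) - (g0 + g1 * (P s - a) + g2 * (P s - a) ^ 2)) =o[nhds 0]
      (fun s => (P s - a) ^ 2) := Asymptotics.IsLittleO.comp_tendsto hG hr.tendsto
  have hO : (fun s => P s - a) =O[nhds 0] (fun s : ℝ => s) := by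
    obtain ⟨r, k1, k2⟩ := T2.iff.1 hr
    have hs' : Filter.Tendsto (fun s : ℝ => s) (nhds 0) (nhds 0) := Filter.tendsto_id
    have k : Filter.Tendsto (fun s : ℝ => b + c * s + r s * s) (nhds 0) (nhds (b + c * 0 + 0 * 0)) :=
      (tendsto_const_nhds.add (hs'.const_mul c)).add (k1.mul hs')
    have k3 := (k.isBigO_one ℝ).mul (Asymptotics.isBigO_refl (fun s : ℝ => s) (nhds 0))
    simp only [one_mul] at k3
    refine k3.congr' ?_ (Filter.EventuallyEq.refl _ _)
    filter_upwards [k2] with s hs; rw [hs]; ring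
  have h2 := h1.trans_isBigO (hO.pow 2)
  have h3 : T2 (fun s => G (P s) - (g0 + g1 * (P s - a) + g2 * (P s - a) ^ 2)) 0 0 0 := by
    unfold T2; refine h2.congr_left fun s => ?_
    have : a + (P s - a) = P s := by ring
    rw [this]; ring
  have h4 := (((T2.const g0).add (hr.smul g1)).add ((hr.mul hr).smul g2)).add h3
  refine (h4.congr (Filter.Eventually.of_forall fun s => ?_)).coef (by ring) (by ring) (by ring)
  ring

lemma T2.isqrt {P : ℝ → ℝ} {a b c u : ℝ} (h : T2 P a b c) (hu : 0 < u) (hua : u ^ 2 * a = 1) :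
    ∃ b' c', T2 (fun s => (Real.sqrt (P s))⁻¹) u b' c' ∧ 2 * u * b' * a + u ^ 2 * b = 0 ∧
      (2 * u * c' + b' ^ 2) * a + 2 * u * b' * b + u ^ 2 * c = 0 := by
  have ha : 0 < a := by
    by_contra! hh; nlinarith [mul_nonneg (sq_nonneg u) (neg_nonneg.2 hh)]
  obtain ⟨g1, g2, hg⟩ := T2.of_contDiffAt (g := fun r => (Real.sqrt (a + r))⁻¹) (by
    refine ContDiffAt.inv (ContDiffAt.sqrt (contDiffAt_const.add contDiffAt_id) (by simpa using ha.ne')) ?_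
    simpa using (Real.sqrt_pos.2 ha).ne')
  have hu' : (Real.sqrt (a + 0))⁻¹ = u := by
    rw [add_zero]
    have : a = (u⁻¹) ^ 2 := by field_simp; linarith
    rw [this, Real.sqrt_sq (by positivity), inv_inv]
  have h1 := T2.comp (G := fun x => (Real.sqrt x)⁻¹) hg h
  rw [hu'] at h1
  refine ⟨_, _, h1, ?_⟩
  have h2 := (h1.mul h1).mul h
  have h3 : T2 (fun _ => (1 : ℝ)) 1 0 0 := T2.const 1
  have h4 := h2.unique (h3.congr (g' := fun s => (Real.sqrt (P s))⁻¹ * (Real.sqrt (P s))⁻¹ * P s) (by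
    filter_upwards [h.tendsto.eventually (lt_mem_nhds ha)] with s hs
    have := Real.sq_sqrt hs.le
    have hs' := Real.sqrt_pos.2 hs
    field_simp; linarith))
  constructor
  · linarith [h4.2.1]
  · linarith [h4.2.2]

lemma T2.inv1 {P : ℝ → ℝ} {c : ℝ} (h : T2 P 1 0 c) : T2 (fun s => (P s)⁻¹) 1 0 (-c) := by
  obtain ⟨g1, g2, hg⟩ := T2.of_contDiffAt (g := fun r : ℝ => (1 + r)⁻¹) (by
    refine ContDiffAt.inv (contDiffAt_const.add contDiffAt_id) (by simp))
  have h1 := T2.comp (G := fun x => x⁻¹) hg h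
  have h2 := h1.mul h
  have h3 : T2 (fun _ => (1 : ℝ)) 1 0 0 := T2.const 1
  have h4 := h2.unique (h3.congr (g' := fun s => (P s)⁻¹ * P s) (by
    filter_upwards [h.tendsto.eventually (lt_mem_nhds one_pos)] with s hs
    field_simp))
  refine h1.coef (by simp) (by simp) ?_
  have := h4.2.2
  simp at this ⊢
  linarith

/-- spatial directional derivative -/
abbrev sd {n : ℕ} (v : E (n + 1)) (G : ℝ × E (n + 1) → ℝ) : ℝ × E (n + 1) → ℝ := dd ((0 : ℝ), v) G

/-- data at a spatial maximum of the curvature -/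
structure Crit {n : ℕ} (Γ : Set (Fin n → ℝ)) (F : (Fin n → ℝ) → ℝ) (f : E (n + 1) → ℝ) (T : ℝ)
    (U : Set (ℝ × E (n + 1))) (φ : ℝ × E (n + 1) → ℝ) (t : ℝ) (X : E (n + 1)) (κ : Fin n → ℝ)
    (e : Fin n → E (n + 1)) (M : ℝ) (o : Fin n) : Prop where
  S : Sol Γ F f T U φ
  ht : t ∈ Icc 0 T
  hX : X ≠ 0
  h1 : φ (t, X) = 1
  hκ : κ ∈ Γ
  data : IsData (pV φ (t, X)) ((φ (t, X) / ‖pV φ (t, X)‖) • HB φ (t, X)) κ e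
  hq : (F κ)⁻¹ = QQ f φ (t, X)
  hM : 0 < M
  hmax : ∀ Y : E (n + 1), Y ≠ 0 → ∀ η, φ (t, Y) ^ 3 * HB φ (t, Y) η η ≤ M * ‖φ (t, Y) • η - ⟪pV φ (t, Y), η⟫ • Y‖ ^ 2
  ho : HB φ (t, X) (e o) (e o) = M

namespace Crit
variable {n : ℕ} {Γ : Set (Fin n → ℝ)} {F : (Fin n → ℝ) → ℝ} {f : E (n + 1) → ℝ} {T k r₁ r₂ : ℝ}
    {U : Set (ℝ × E (n + 1))} {φ : ℝ × E (n + 1) → ℝ} {t : ℝ} {X : E (n + 1)} {κ : Fin n → ℝ}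
    {e : Fin n → E (n + 1)} {M : ℝ} {o : Fin n}

lemma m (C : Crit Γ F f T U φ t X κ e M o) : (t, X) ∈ U := C.S.mem t C.ht X C.hX

lemma pe (C : Crit Γ F f T U φ t X κ e M o) (a : Fin n) : sd (e a) φ (t, X) = 0 := by
  exact (pV_inner φ (t, X) (e a)).symm.trans (C.data.1.2 a)

lemma TT (C : Crit Γ F f T U φ t X κ e M o) {G : ℝ × E (n + 1) → ℝ} (hG : ContDiffOn ℝ (⊤ : ℕ∞) G U) (v : E (n + 1)) :
    T2 (fun s : ℝ => G (t, X + s • v)) (G (t, X)) (sd v G (t, X)) (sd v (sd v G) (t, X) / 2) := by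
  simpa using T2.line C.S.op hG C.m (0, v)

lemma evU (C : Crit Γ F f T U φ t X κ e M o) (v : E (n + 1)) : ∀ᶠ s : ℝ in nhds 0, (t, X + s • v) ∈ U := by
  filter_upwards [line_mem C.S.op C.m (0, v)] with s hs; simpa using hs

lemma sm1 (C : Crit Γ F f T U φ t X κ e M o) (v : E (n + 1)) : ContDiffOn ℝ (⊤ : ℕ∞) (sd v φ) U := sm_dd C.S.op C.S.sm _
lemma sm2 (C : Crit Γ F f T U φ t X κ e M o) (v w : E (n + 1)) : ContDiffOn ℝ (⊤ : ℕ∞) (sd w (sd v φ)) U := sm_dd C.S.op (C.sm1 v) _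

lemma ee (C : Crit Γ F f T U φ t X κ e M o) (a b : Fin n) : ⟪e a, e b⟫ = if a = b then 1 else 0 :=
  orthonormal_iff_ite.1 C.data.1.1 a b

lemma Hab (C : Crit Γ F f T U φ t X κ e M o) (a b : Fin n) : sd (e a) (sd (e b) φ) (t, X) =
    if a = b then κ a * ‖pV φ (t, X)‖ else 0 := by
  have hp := C.S.p_pos C.m
  have := C.data.2 b (e a) (C.data.1.2 a)
  rw [C.h1, C.ee] at this
  simp only [smul_apply, smul_eq_mul] at this
  rw [HB_apply C.S.op C.S.sm C.m] at this
  have h2 : dd (0, e a) (dd (0, e b) φ) (t, X) = ‖pV φ (t, X)‖ * (κ b * if a = b then 1 else 0) := by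
    rw [← this]; field_simp
  show dd (0, e a) (dd (0, e b) φ) (t, X) = _
  rw [h2]
  split_ifs with h
  · subst h; ring
  · ring

lemma HM (C : Crit Γ F f T U φ t X κ e M o) : κ o * ‖pV φ (t, X)‖ = M := by
  have := C.Hab o o
  rw [if_pos rfl] at this
  rw [← this, ← C.ho, HB_apply C.S.op C.S.sm C.m]

lemma ineq (C : Crit Γ F f T U φ t X κ e M o) (v : E (n + 1)) : ∀ᶠ s : ℝ in nhds 0,
    0 ≤ M * (φ (t, X + s • v) * φ (t, X + s • v) - 2 * (φ (t, X + s • v) * sd (e o) φ (t, X + s • v) * ⟪e o, X + s • v⟫)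
      + sd (e o) φ (t, X + s • v) * sd (e o) φ (t, X + s • v) * ‖X + s • v‖ ^ 2)
      - φ (t, X + s • v) * φ (t, X + s • v) * φ (t, X + s • v) * sd (e o) (sd (e o) φ) (t, X + s • v) := by
  filter_upwards [C.evU v] with s hs
  have := C.hmax _ (C.S.ne _ hs) (e o)
  rw [HB_apply C.S.op C.S.sm hs, pV_inner, norm_sub_sq_real, norm_smul, norm_smul, C.data.1.1.1 o,
    inner_smul_left, inner_smul_right, mul_pow, mul_pow, Real.norm_eq_abs, Real.norm_eq_abs, sq_abs, sq_abs] at this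
  simp only [conj_trivial] at this
  show 0 ≤ M * (φ (t, X + s • v) * φ (t, X + s • v) - 2 * (φ (t, X + s • v) * dd (0, e o) φ (t, X + s • v) * ⟪e o, X + s • v⟫)
      + dd (0, e o) φ (t, X + s • v) * dd (0, e o) φ (t, X + s • v) * ‖X + s • v‖ ^ 2)
      - φ (t, X + s • v) * φ (t, X + s • v) * φ (t, X + s • v) * dd (0, e o) (dd (0, e o) φ) (t, X + s • v)
  nlinarith [this]

lemma TZ (C : Crit Γ F f T U φ t X κ e M o) (a : Fin n) :
    sd (e a) (sd (e o) (sd (e o) φ)) (t, X) = (if a = o then -2 * M ^ 2 * ⟪e o, X⟫ else 0) ∧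
    (a ≠ o → sd (e a) (sd (e a) (sd (e o) (sd (e o) φ))) (t, X) ≤
      - 2 * M * ⟪e o, X⟫ * sd (e a) (sd (e a) (sd (e o) φ)) (t, X) - κ a * ‖pV φ (t, X)‖ * M) := by
  have t1 := C.TT C.S.sm (e a)
  rw [C.h1, C.pe, C.Hab, if_pos rfl] at t1
  have t2 := C.TT (C.sm1 (e o)) (e a)
  rw [C.pe, C.Hab] at t2
  have t3 := C.TT (C.sm2 (e o) (e o)) (e a)
  rw [C.Hab, if_pos rfl, C.HM] at t3
  have t4 : T2 (fun s : ℝ => ⟪e o, X + s • e a⟫) ⟪e o, X⟫ ⟪e o, e a⟫ 0 := by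
    refine (((T2.const ⟪e o, X⟫).add (T2.id.smul ⟪e o, e a⟫)).congr (Filter.Eventually.of_forall fun s => ?_)).coef
      (by ring) (by ring) (by ring)
    rw [inner_add_right, inner_smul_right]; ring
  have t5 : T2 (fun s : ℝ => ‖X + s • e a‖ ^ 2) (‖X‖ ^ 2) (2 * ⟪X, e a⟫) 1 := by
    refine (((T2.const (‖X‖ ^ 2)).add (T2.id.smul (2 * ⟪X, e a⟫))).add (T2.id.mul T2.id)).congr (Filter.Eventually.of_forall fun s => ?_) |>.coef
      (by ring) (by ring) (by ring)
    rw [norm_add_sq_real, norm_smul, inner_smul_right, C.data.1.1.1 a, Real.norm_eq_abs, mul_one, sq_abs]; ring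
  have t6 := (((((t1.mul t1).sub (((t1.mul t2).mul t4).smul 2)).add ((t2.mul t2).mul t5)).smul M)).sub (((t1.mul t1).mul t1).mul t3)
  obtain ⟨s1, s2⟩ := (t6.coef (a' := 0) (by ring) rfl rfl).sign (C.ineq (e a))
  rw [C.ee] at s1 s2
  by_cases h : a = o
  · subst h
    simp only [if_pos rfl, C.HM] at s1 ⊢
    refine ⟨?_, fun h => absurd rfl h⟩
    simp only [if_true] at s1 ⊢
    linarith
  · have h' : o ≠ a := fun hh => h hh.symm
    simp only [if_neg h, if_neg h'] at s1 s2 ⊢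
    refine ⟨by linarith, fun _ => ?_⟩
    linarith
end Crit


lemma norm_ev {V : Type*} [SeminormedAddCommGroup V] {g : ℝ → V} (h : ContinuousAt g 0) :
    ∀ᶠ s in nhds 0, ‖g s‖ ≤ ‖g 0‖ + 1 :=
  (h.norm.eventually (gt_mem_nhds (lt_add_one _))).mono fun _ h => le_of_lt h

namespace Crit
variable {n : ℕ} {Γ : Set (Fin n → ℝ)} {F : (Fin n → ℝ) → ℝ} {f : E (n + 1) → ℝ} {T k r₁ r₂ : ℝ}
    {U : Set (ℝ × E (n + 1))} {φ : ℝ × E (n + 1) → ℝ} {t : ℝ} {X : E (n + 1)} {κ : Fin n → ℝ}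
    {e : Fin n → E (n + 1)} {M : ℝ} {o : Fin n}

lemma sd_p (C : Crit Γ F f T U φ t X κ e M o) (G : ℝ × E (n + 1) → ℝ) (y : ℝ × E (n + 1)) :
    sd (pV φ (t, X)) G y = ‖pV φ (t, X)‖ ^ 2 * (sd X G y - ∑ a, ⟪e a, X⟫ * sd (e a) G y) := by
  have hp := C.S.p_pos C.m
  have h := C.data.1.expand (C.S.p_ne C.m) X
  rw [C.S.inner_pX C.m, C.h1] at h
  have h2 : sd X G y = 1 / ‖pV φ (t, X)‖ ^ 2 * sd (pV φ (t, X)) G y + ∑ a, ⟪e a, X⟫ * sd (e a) G y := by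
    let L : E (n + 1) →L[ℝ] ℝ := (fderiv ℝ G y).comp (ContinuousLinearMap.inr ℝ ℝ (E (n + 1)))
    have hL : ∀ v, sd v G y = L v := fun v => by simp [L, sd, dd]
    simp only [hL]
    conv_lhs => rw [h]
    simp [map_add, map_sum, map_smul]
  rw [h2]; field_simp; ring

lemma euler1 (C : Crit Γ F f T U φ t X κ e M o) (v : E (n + 1)) : sd X (sd v φ) (t, X) = 0 := by
  have := Hom.euler C.S.op (C.sm1 v) (C.S.hom1.dd_space C.S.op C.S.cone C.S.sm v) C.m
  show dd (0, X) (dd (0, v) φ) (t, X) = 0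
  rw [this]; simp

lemma euler2 (C : Crit Γ F f T U φ t X κ e M o) (v w : E (n + 1)) : sd X (sd w (sd v φ)) (t, X) = - sd w (sd v φ) (t, X) := by
  have := Hom.euler C.S.op (C.sm2 v w) ((C.S.hom1.dd_space C.S.op C.S.cone C.S.sm v).dd_space C.S.op C.S.cone (C.sm1 v) w) C.m
  show dd (0, X) (dd (0, w) (dd (0, v) φ)) (t, X) = - dd (0, w) (dd (0, v) φ) (t, X)
  rw [this]; simp

lemma Tp0 (C : Crit Γ F f T U φ t X κ e M o) : T2 (fun s : ℝ => ⟪pV φ (t, X), pV φ (t, X + s • e o)⟫)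
    (‖pV φ (t, X)‖ ^ 2) (- ‖pV φ (t, X)‖ ^ 2 * (⟪e o, X⟫ * M)) (‖pV φ (t, X)‖ ^ 2 * (2 * M ^ 2 * ⟪e o, X⟫ ^ 2 - M) / 2) := by
  have h := C.TT (C.sm1 (pV φ (t, X))) (e o)
  refine (h.congr (Filter.Eventually.of_forall fun s => ?_)).coef ?_ ?_ ?_
  · rw [real_inner_comm, pV_inner]
  · show dd (0, _) φ (t, X) = _
    rw [← pV_inner, real_inner_self_eq_norm_sq]
  · show dd (0, _) (dd (0, _) φ) (t, X) = _
    rw [dd_comm C.S.op C.S.sm C.m]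
    refine (C.sd_p (sd (e o) φ) (t, X)).trans ?_
    rw [C.euler1]
    simp only [C.Hab]
    have hs : ∀ a, ⟪e a, X⟫ * (if a = o then κ a * ‖pV φ (t, X)‖ else 0) = if a = o then ⟪e o, X⟫ * M else 0 := fun a => by
      split_ifs with h
      · subst h; rw [C.HM]
      · ring
    simp only [hs, Finset.sum_ite_eq', Finset.mem_univ, if_true]
    ring
  · congr 1
    show dd (0, _) (dd (0, _) (dd (0, _) φ)) (t, X) = _
    rw [dd_comm3 C.S.op C.S.sm C.m, dd_comm C.S.op (C.sm1 (e o)) C.m]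
    refine (C.sd_p (sd (e o) (sd (e o) φ)) (t, X)).trans ?_
    rw [C.euler2, C.Hab, if_pos rfl, C.HM]
    have hs : ∀ a, ⟪e a, X⟫ * sd (e a) (sd (e o) (sd (e o) φ)) (t, X) = if a = o then ⟪e o, X⟫ * (-2 * M ^ 2 * ⟪e o, X⟫) else 0 := fun a => by
      rw [(C.TZ a).1]
      split_ifs with h
      · subst h; ring
      · ring
    simp only [hs, Finset.sum_ite_eq', Finset.mem_univ, if_true]
    ring

lemma Tpe (C : Crit Γ F f T U φ t X κ e M o) (a : Fin n) : ∃ c, T2 (fun s : ℝ => ⟪e a, pV φ (t, X + s • e o)⟫)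
    0 (if a = o then M else 0) (if a = o then c else 0) := by
  have h := C.TT (C.sm1 (e a)) (e o)
  rw [C.pe, C.Hab] at h
  refine ⟨sd (e o) (sd (e o) (sd (e a) φ)) (t, X) / 2, (h.congr (Filter.Eventually.of_forall fun s => ?_)).coef rfl ?_ ?_⟩
  · rw [real_inner_comm, pV_inner]
  · rw [C.HM]
    by_cases h : a = o
    · simp [h]
    · rw [if_neg h, if_neg (fun hh => h hh.symm)]
  · by_cases h : a = o
    · simp [h]
    · rw [if_neg h]
      have := (C.TZ a).1
      rw [if_neg h] at this
      have h2 : sd (e o) (sd (e o) (sd (e a) φ)) (t, X) = 0 := by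
        rw [← this]
        show dd (0, _) (dd (0, _) (dd (0, _) φ)) (t, X) = dd (0, _) (dd (0, _) (dd (0, _) φ)) (t, X)
        rw [dd_comm3 C.S.op C.S.sm C.m, dd_comm C.S.op (C.sm1 (e o)) C.m]
      rw [h2]; simp

lemma TP (C : Crit Γ F f T U φ t X κ e M o) : T2 (fun s : ℝ => ‖pV φ (t, X + s • e o)‖ ^ 2)
    (‖pV φ (t, X)‖ ^ 2) (-2 * ⟪e o, X⟫ * M * ‖pV φ (t, X)‖ ^ 2)
    (M ^ 2 + ‖pV φ (t, X)‖ ^ 2 * (3 * ⟪e o, X⟫ ^ 2 * M ^ 2 - M)) := by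
  have hp := C.S.p_pos C.m
  choose c hc using C.Tpe
  have h1 := T2.sum Finset.univ (fun a _ => (hc a).mul (hc a))
  have h2 := ((C.Tp0.mul C.Tp0).smul (1 / ‖pV φ (t, X)‖ ^ 2)).add h1
  refine (h2.congr (Filter.Eventually.of_forall fun s => ?_)).coef ?_ ?_ ?_
  · rw [C.data.1.norm_sq (C.S.p_ne C.m) (pV φ (t, X + s • e o))]
    simp only [sq]; ring
  · simp; field_simp
  · simp; field_simp; ring
  · simp only [zero_mul, mul_zero, add_zero, mul_ite, ite_mul]
    simp; field_simp; ring

lemma Tu (C : Crit Γ F f T U φ t X κ e M o) {u : ℝ} (hu : u = ‖pV φ (t, X)‖⁻¹) :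
    T2 (fun s : ℝ => ‖pV φ (t, X + s • e o)‖⁻¹) u (u * ⟪e o, X⟫ * M) (u * (M - u ^ 2 * M ^ 2) / 2) := by
  have hp := C.S.p_pos C.m
  have hu0 : 0 < u := by rw [hu]; positivity
  have hP : ‖pV φ (t, X)‖ = u⁻¹ := by rw [hu, inv_inv]
  have h0 := C.TP
  rw [hP] at h0
  obtain ⟨b, c, h1, h2, h3⟩ := h0.isqrt hu0 (by field_simp)
  have hb : b = u * ⟪e o, X⟫ * M := by
    field_simp at h2; linarith
  refine (h1.congr (Filter.Eventually.of_forall fun s => ?_)).coef rfl hb ?_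
  · rw [Real.sqrt_sq (norm_nonneg _)]
  · rw [hb] at h3
    field_simp at h3 ⊢
    linarith

lemma TS (C : Crit Γ F f T U φ t X κ e M o) {u : ℝ} (hu : u = ‖pV φ (t, X)‖⁻¹) : ∃ b,
    T2 (fun s : ℝ => SS φ (t, X + s • e o)) (SS φ (t, X)) b
    (- u * (dd (1, 0) φ (t, X) * M + sd (e o) (sd (e o) (dd (1, 0) φ)) (t, X) + 2 * M * ⟪e o, X⟫ * sd (e o) (dd (1, 0) φ) (t, X)) / 2
      - SS φ (t, X) * (M + u ^ 2 * M ^ 2) / 2) := by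
  have t1 := C.TT (sm_dd C.S.op C.S.sm (1, 0)) (e o)
  have t2 := C.TT C.S.sm (e o)
  rw [C.h1, C.pe, C.Hab, if_pos rfl, C.HM] at t2
  have t3 := ((t1.mul (C.Tu hu)).mul t2.inv1).smul (-1)
  have hS : SS φ (t, X) = - dd (1, 0) φ (t, X) * u := by
    unfold SS; rw [C.h1, one_mul, hu]; rfl
  refine ⟨_, (t3.congr (Filter.Eventually.of_forall fun s => ?_)).coef ?_ rfl ?_⟩
  · unfold SS; rw [div_eq_mul_inv, mul_inv]; ring
  · rw [hS]; ring
  · rw [hS]; ring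

set_option synthInstance.maxHeartbeats 200000 in
set_option maxSynthPendingDepth 3 in
lemma HBbd (C : Crit Γ F f T U φ t X κ e M o) : ∃ B, 0 ≤ B ∧ ∀ᶠ s : ℝ in nhds 0, ∀ v w,
    |HB φ (t, X + s • e o) v w| ≤ B * ‖v‖ * ‖w‖ := by
  have h1 : ContDiffOn ℝ (⊤ : ℕ∞) (fderiv ℝ (fderiv ℝ φ)) U := (sm_fderiv C.S.op C.S.sm).fderiv_of_isOpen C.S.op (by simp)
  have h3 : ContinuousAt (fun s : ℝ => ((t, X + s • e o) : ℝ × E (n + 1))) 0 := by fun_prop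
  have h4 : ContinuousAt (fun s : ℝ => fderiv ℝ (fderiv ℝ φ) (t, X + s • e o)) 0 :=
    ContinuousAt.comp (g := fderiv ℝ (fderiv ℝ φ)) (by simpa using h1.continuousOn.continuousAt (C.S.op.mem_nhds C.m)) h3
  have h3 := norm_ev h4
  refine ⟨‖fderiv ℝ (fderiv ℝ φ) (t, X + (0 : ℝ) • e o)‖ + 1, add_nonneg (norm_nonneg _) zero_le_one, h3.mono fun s hs v w => ?_⟩
  have e1 : HB φ (t, X + s • e o) v w = fderiv ℝ (fderiv ℝ φ) (t, X + s • e o) (0, v) (0, w) := by simp [HB]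
  rw [e1, ← Real.norm_eq_abs]
  refine (ContinuousLinearMap.le_opNorm₂ _ _ _).trans ?_
  have nv : ∀ v : E (n + 1), ‖((0 : ℝ), v)‖ = ‖v‖ := fun v => by simp [Prod.norm_def]
  rw [nv, nv]
  gcongr
end Crit


lemma Frame.smul {n : ℕ} {p : E (n + 1)} {e : Fin n → E (n + 1)} (h : Frame p e) (c : ℝ) : Frame (c • p) e :=
  ⟨h.1, fun i => by rw [inner_smul_left, h.2 i, mul_zero]⟩

namespace Crit
variable {n : ℕ} {Γ : Set (Fin n → ℝ)} {F : (Fin n → ℝ) → ℝ} {f : E (n + 1) → ℝ} {T k r₁ r₂ : ℝ}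
    {U : Set (ℝ × E (n + 1))} {φ : ℝ × E (n + 1) → ℝ} {t : ℝ} {X : E (n + 1)} {κ : Fin n → ℝ}
    {e : Fin n → E (n + 1)} {M : ℝ} {o : Fin n}

/-- moving frame -/
def mf (φ : ℝ × E (n + 1) → ℝ) (t : ℝ) (X : E (n + 1)) (e : Fin n → E (n + 1)) (o : Fin n) (s : ℝ) (i : Fin n) : E (n + 1) :=
  e i - (2 * ⟪‖pV φ (t, X + s • e o)‖⁻¹ • pV φ (t, X + s • e o), e i⟫ /
    ‖‖pV φ (t, X)‖⁻¹ • pV φ (t, X) + ‖pV φ (t, X + s • e o)‖⁻¹ • pV φ (t, X + s • e o)‖ ^ 2) •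
      (‖pV φ (t, X)‖⁻¹ • pV φ (t, X) + ‖pV φ (t, X + s • e o)‖⁻¹ • pV φ (t, X + s • e o))

lemma mf_ev (C : Crit Γ F f T U φ t X κ e M o) : ∀ᶠ s : ℝ in nhds 0,
    1 ≤ ‖‖pV φ (t, X)‖⁻¹ • pV φ (t, X) + ‖pV φ (t, X + s • e o)‖⁻¹ • pV φ (t, X + s • e o)‖ ^ 2 ∧
    ‖‖pV φ (t, X)‖⁻¹ • pV φ (t, X) + ‖pV φ (t, X + s • e o)‖⁻¹ • pV φ (t, X + s • e o)‖ ≤ 2 ∧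
    Frame (pV φ (t, X + s • e o)) (mf φ t X e o s) := by
  have hp := C.S.p_pos C.m
  filter_upwards [C.evU (e o), C.Tp0.tendsto.eventually (lt_mem_nhds (by positivity : 0 < ‖pV φ (t, X)‖ ^ 2))] with s hs h0
  have hp' := C.S.p_pos hs
  have n1 : ‖‖pV φ (t, X)‖⁻¹ • pV φ (t, X)‖ = 1 := by rw [norm_smul, norm_inv, norm_norm, inv_mul_cancel₀ hp.ne']
  have n2 : ‖‖pV φ (t, X + s • e o)‖⁻¹ • pV φ (t, X + s • e o)‖ = 1 := by
    rw [norm_smul, norm_inv, norm_norm, inv_mul_cancel₀ hp'.ne']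
  have h1 : 1 ≤ ‖‖pV φ (t, X)‖⁻¹ • pV φ (t, X) + ‖pV φ (t, X + s • e o)‖⁻¹ • pV φ (t, X + s • e o)‖ ^ 2 := by
    rw [norm_add_sq_real, n1, n2, inner_smul_left, inner_smul_right]
    have : 0 ≤ ‖pV φ (t, X)‖⁻¹ * (‖pV φ (t, X + s • e o)‖⁻¹ * ⟪pV φ (t, X), pV φ (t, X + s • e o)⟫) := by positivity
    simp only [conj_trivial]; linarith
  refine ⟨h1, ?_, ?_⟩
  · refine (norm_add_le _ _).trans ?_
    rw [n1, n2]; norm_num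
  · have h2 := Frame.refl (C.data.1.smul ‖pV φ (t, X)‖⁻¹) n1 n2 (fun h => by rw [h] at h1; norm_num at h1)
    have h3 := h2.smul ‖pV φ (t, X + s • e o)‖
    rw [smul_smul, mul_inv_cancel₀ hp'.ne', one_smul] at h3
    exact h3

lemma Tmf (C : Crit Γ F f T U φ t X κ e M o) {a : Fin n} (ha : a ≠ o) :
    T2 (fun s : ℝ => HB φ (t, X + s • e o) (mf φ t X e o s a) (mf φ t X e o s a)) (κ a * ‖pV φ (t, X)‖)
      (sd (e o) (sd (e a) (sd (e a) φ)) (t, X)) (sd (e o) (sd (e o) (sd (e a) (sd (e a) φ))) (t, X) / 2) := by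
  obtain ⟨c, hc⟩ := C.Tpe a
  simp only [if_neg ha] at hc
  obtain ⟨B, hB0, hB⟩ := C.HBbd
  have h1 := C.TT (C.sm2 (e a) (e a)) (e o)
  rw [C.Hab, if_pos rfl] at h1
  have hc2 := hc.mul (C.Tu rfl)
  set ν : ℝ → E (n + 1) := fun s => ‖pV φ (t, X)‖⁻¹ • pV φ (t, X) + ‖pV φ (t, X + s • e o)‖⁻¹ • pV φ (t, X + s • e o) with hν
  have hb : ∀ᶠ s : ℝ in nhds 0, ‖HB φ (t, X + s • e o) (e a) (ν s)‖ ≤ 2 * B ∧ ‖HB φ (t, X + s • e o) (ν s) (ν s)‖ ≤ 4 * B := by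
    filter_upwards [hB, C.mf_ev] with s hs hm
    have k2 : ‖ν s‖ ≤ 2 := hm.2.1
    constructor
    · refine (hs _ _).trans ?_
      rw [C.data.1.1.1 a]; nlinarith
    · refine (hs _ _).trans ?_
      have : ‖ν s‖ * ‖ν s‖ ≤ 4 := by nlinarith [norm_nonneg (ν s)]
      nlinarith
  have g1 : T2 (fun s : ℝ => (⟪e a, pV φ (t, X + s • e o)⟫ * ‖pV φ (t, X + s • e o)‖⁻¹) * (2 / ‖ν s‖ ^ 2)) 0 0 0 := by
    refine (hc2.coef (by ring) (by ring) (by ring)).mul_bdd (B := 2) ?_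
    filter_upwards [C.mf_ev] with s hs
    have : 1 ≤ ‖ν s‖ ^ 2 := hs.1
    rw [abs_of_nonneg (by positivity)]
    rw [div_le_iff₀ (by linarith)]; linarith
  have g2 := g1.mul_bdd (g := fun s => HB φ (t, X + s • e o) (e a) (ν s)) (hb.mono fun s hs => hs.1)
  have g3 := (g1.mul g1).coef (a' := 0) (b' := 0) (c' := 0) (by ring) (by ring) (by ring) |>.mul_bdd
    (g := fun s => HB φ (t, X + s • e o) (ν s) (ν s)) (hb.mono fun s hs => hs.2)
  refine (((h1.sub (g2.smul 2)).add g3).congr ?_).coef (by ring) (by ring) (by ring)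
  filter_upwards [C.evU (e o)] with s hs
  have em : mf φ t X e o s a = e a - ((⟪e a, pV φ (t, X + s • e o)⟫ * ‖pV φ (t, X + s • e o)‖⁻¹) * (2 / ‖ν s‖ ^ 2)) • ν s := by
    unfold mf
    rw [inner_smul_left, real_inner_comm]
    simp only [conj_trivial]
    congr 2
    ring
  rw [em]
  simp only [map_sub, map_smul, sub_apply, smul_apply, smul_eq_mul]
  rw [C.S.H_symm hs (ν s) (e a), HB_apply C.S.op C.S.sm hs (e a) (e a)]
  ring

lemma main (C : Crit Γ F f T U φ t X κ e M o) (hk : 0 < k) (hΓ : GoodCone Γ) (hF : GoodF Γ F k) (hf : GoodPrescribed f k r₁ r₂)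
    {u : ℝ} (hu : u = ‖pV φ (t, X)‖⁻¹) :
    u * (dd (1, 0) φ (t, X) * M + sd (e o) (sd (e o) (dd (1, 0) φ)) (t, X) + 2 * M * ⟪e o, X⟫ * sd (e o) (dd (1, 0) φ) (t, X)) ≤
      (k * QQ f φ (t, X) - SS φ (t, X)) * M + dd (e o) (dd (e o) f) X
        - (k * QQ f φ (t, X) + SS φ (t, X)) * (u ^ 2 * M ^ 2) := by
  have hp := C.S.p_pos C.m
  have hu0 : 0 < u := by rw [hu]; positivity
  have hPu : ‖pV φ (t, X)‖ = u⁻¹ := by rw [hu, inv_inv]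
  have hq0 := C.S.Q_pos hΓ hF C.ht C.hX
  set q0 := QQ f φ (t, X) with hq0d
  obtain ⟨b, tS⟩ := C.TS hu
  have tu := C.Tu hu
  have tf := T2.line (Y := E (n + 1)) ne_open hf.1 C.hX (e o)
  have tφ := C.TT C.S.sm (e o)
  rw [C.h1, C.pe, C.Hab, if_pos rfl, C.HM] at tφ
  have hκo : κ o = u * M := by rw [← C.HM, hPu]; field_simp
  -- the scalar test function
  have tJ : ∀ a, T2 (fun s : ℝ => if a = o then M * ‖pV φ (t, X + s • e o)‖⁻¹ else
      φ (t, X + s • e o) * ‖pV φ (t, X + s • e o)‖⁻¹ * HB φ (t, X + s • e o) (mf φ t X e o s a) (mf φ t X e o s a))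
      (κ a) (if a = o then M * (u * ⟪e o, X⟫ * M) else u * sd (e o) (sd (e a) (sd (e a) φ)) (t, X) + u * ⟪e o, X⟫ * M * (κ a / u))
      (if a = o then M * (u * (M - u ^ 2 * M ^ 2) / 2) else
        u * (sd (e o) (sd (e o) (sd (e a) (sd (e a) φ))) (t, X) / 2) + u * ⟪e o, X⟫ * M * sd (e o) (sd (e a) (sd (e a) φ)) (t, X)
          + (u * (M - u ^ 2 * M ^ 2) / 2 + M / 2 * u) * (κ a / u)) := by
    intro a
    by_cases h : a = o
    · simp only [if_pos h]
      exact (tu.smul M).coef (by rw [h, hκo]; ring) rfl rfl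
    · simp only [if_neg h]
      have := (tφ.mul tu).mul (C.Tmf h)
      rw [hPu] at this
      refine this.coef ?_ ?_ ?_
      · field_simp
      · ring
      · ring
  have hJ := T2.sum Finset.univ (fun a _ => ((tJ a).sub (T2.const (κ a))).smul (Bw F κ a))
  have hJ2 := hJ.add (((tf.add tS).sub (T2.const q0)).smul q0⁻¹)
  have hq1 : f X + SS φ (t, X) = q0 := by rw [hq0d]; unfold QQ; rw [C.h1, inv_one, one_smul]
  have hev : ∀ᶠ s : ℝ in nhds 0, 1 ≤ φ (t, X + s • e o) := by
    obtain ⟨r, r1, r2⟩ := T2.iff.1 tφ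
    filter_upwards [r2, r1.eventually (lt_mem_nhds (show -(M / 2) < 0 by linarith [C.hM]))] with s h1 h2
    rw [h1]; nlinarith [sq_nonneg s]
  obtain ⟨-, hc⟩ := (hJ2.coef (a' := 0) (by rw [hq1]; simp) rfl rfl).sign (by
    filter_upwards [C.evU (e o), C.mf_ev, hev] with s hs hm h1
    have hXs := C.S.ne _ hs
    obtain ⟨κ', hκ', e', d', q'⟩ := C.S.pde t C.ht _ hXs
    have hsg := SG hΓ hF hκ' C.hκ (C.S.p_ne hs) d' hm.2.2
    have hqs := C.S.Q_pos hΓ hF C.ht hXs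
    have l1 : Real.log (F κ') = - Real.log (QQ f φ (t, X + s • e o)) := by rw [← q', Real.log_inv, neg_neg]
    have l2 : Real.log (F κ) = - Real.log q0 := by rw [hq0d, ← C.hq, Real.log_inv, neg_neg]
    rw [l1, l2] at hsg
    have l3 : Real.log (QQ f φ (t, X + s • e o)) - Real.log q0 ≤ q0⁻¹ * (QQ f φ (t, X + s • e o) - q0) := by
      rw [← Real.log_div hqs.ne' hq0.ne']
      refine (Real.log_le_sub_one_of_pos (by positivity)).trans (le_of_eq ?_)
      field_simp
    have l4 : QQ f φ (t, X + s • e o) ≤ f (X + s • e o) + SS φ (t, X + s • e o) := by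
      unfold QQ
      have hφ := C.S.pos _ hs
      have hZ : (φ (t, X + s • e o))⁻¹ • (X + s • e o) ≠ 0 := smul_ne_zero (inv_pos.2 hφ).ne' hXs
      have := f_scale hf h1 hZ
      rw [smul_smul, mul_inv_cancel₀ hφ.ne', one_smul] at this
      have h2 : 1 ≤ φ (t, X + s • e o) ^ k := Real.one_le_rpow h1 hk.le
      have h3 := hf.2.1 _ hZ
      simp only
      nlinarith
    have l5 : q0⁻¹ * (QQ f φ (t, X + s • e o) - q0) ≤ q0⁻¹ * (f (X + s • e o) + SS φ (t, X + s • e o) - q0) := by gcongr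
    have l6 : ∀ a ∈ Finset.univ, Bw F κ a * (((φ (t, X + s • e o) / ‖pV φ (t, X + s • e o)‖) • HB φ (t, X + s • e o)) (mf φ t X e o s a) (mf φ t X e o s a) - κ a)
      ≤ Bw F κ a * ((if a = o then M * ‖pV φ (t, X + s • e o)‖⁻¹ else
      φ (t, X + s • e o) * ‖pV φ (t, X + s • e o)‖⁻¹ * HB φ (t, X + s • e o) (mf φ t X e o s a) (mf φ t X e o s a)) - κ a) := by
      intro a _
      refine mul_le_mul_of_nonneg_left ?_ (Bw_pos hF C.hκ a).le
      simp only [smul_apply, smul_eq_mul]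
      split_ifs with h
      · have h4 := C.hmax _ hXs (mf φ t X e o s a)
        rw [hm.2.2.2 a, zero_smul, sub_zero, norm_smul, hm.2.2.1.1 a, mul_one, Real.norm_eq_abs, sq_abs] at h4
        have hφ := C.S.pos _ hs
        have hps := C.S.p_pos hs
        have h5 : φ (t, X + s • e o) * HB φ (t, X + s • e o) (mf φ t X e o s a) (mf φ t X e o s a) ≤ M := by
          have : 0 < φ (t, X + s • e o) ^ 2 := by positivity
          nlinarith
        rw [div_eq_mul_inv, mul_right_comm]
        gcongr
      · rw [div_eq_mul_inv]
    have l7 := Finset.sum_le_sum l6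
    linarith)
  -- conclusion
  have hsum : ∑ a, Bw F κ a * ((if a = o then M * (u * (M - u ^ 2 * M ^ 2) / 2) else
        u * (sd (e o) (sd (e o) (sd (e a) (sd (e a) φ))) (t, X) / 2) + u * ⟪e o, X⟫ * M * sd (e o) (sd (e a) (sd (e a) φ)) (t, X)
          + (u * (M - u ^ 2 * M ^ 2) / 2 + M / 2 * u) * (κ a / u)) - 0) ≤ k * ((M - u ^ 2 * M ^ 2) / 2) := by
    rw [← F_euler hΓ hF C.hκ, Finset.sum_mul]
    refine Finset.sum_le_sum fun a _ => ?_
    rw [mul_assoc (Bw F κ a) (κ a), sub_zero]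
    refine mul_le_mul_of_nonneg_left ?_ (Bw_pos hF C.hκ a).le
    split_ifs with h
    · rw [h, hκo]; apply le_of_eq; ring
    · have h2 := (C.TZ a).2 h
      have e1 : sd (e a) (sd (e a) (sd (e o) (sd (e o) φ))) (t, X) = sd (e o) (sd (e o) (sd (e a) (sd (e a) φ))) (t, X) := by
        have c1 : ∀ y ∈ U, sd (e a) (sd (e o) (sd (e o) φ)) y = sd (e o) (sd (e o) (sd (e a) φ)) y := fun y hy => by
          show dd (0, _) (dd (0, _) (dd (0, _) φ)) y = dd (0, _) (dd (0, _) (dd (0, _) φ)) y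
          rw [dd_comm C.S.op (C.sm1 (e o)) hy, dd_comm3 C.S.op C.S.sm hy]
        have c2 := dd_congr C.S.op c1 C.m (0, e a)
        refine c2.trans ?_
        show dd (0, _) (dd (0, _) (dd (0, _) (dd (0, _) φ))) (t, X) = dd (0, _) (dd (0, _) (dd (0, _) (dd (0, _) φ))) (t, X)
        rw [dd_comm C.S.op (C.sm2 (e a) (e o)) C.m, dd_comm3 C.S.op (C.sm1 (e a)) C.m]
      have e2 : sd (e a) (sd (e a) (sd (e o) φ)) (t, X) = sd (e o) (sd (e a) (sd (e a) φ)) (t, X) := by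
        show dd (0, _) (dd (0, _) (dd (0, _) φ)) (t, X) = dd (0, _) (dd (0, _) (dd (0, _) φ)) (t, X)
        rw [dd_comm3 C.S.op C.S.sm C.m, dd_comm C.S.op (C.sm1 (e a)) C.m]
      rw [e1, e2, hPu, ← div_eq_mul_inv] at h2
      have h3 := mul_le_mul_of_nonneg_left h2 (show 0 ≤ u / 2 by positivity)
      have e3 : u * (κ a / u) = κ a := by field_simp
      have e4 : (u * (M - u ^ 2 * M ^ 2) / 2 + M / 2 * u) * (κ a / u) = (M - u ^ 2 * M ^ 2) / 2 * κ a + M / 2 * κ a := by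
        field_simp
      rw [e4]
      have e5 : u / 2 * (-2 * M * ⟪e o, X⟫ * sd (e o) (sd (e a) (sd (e a) φ)) (t, X) - κ a / u * M) =
        - (u * M * ⟪e o, X⟫ * sd (e o) (sd (e a) (sd (e a) φ)) (t, X)) - M / 2 * κ a := by field_simp
      rw [e5] at h3
      linarith
  have hc2 := add_le_add_left hsum (q0⁻¹ * ((dd (e o) (dd (e o) f) X) / 2 + (- u * (dd (1, 0) φ (t, X) * M + sd (e o) (sd (e o) (dd (1, 0) φ)) (t, X) + 2 * M * ⟪e o, X⟫ * sd (e o) (dd (1, 0) φ) (t, X)) / 2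
      - SS φ (t, X) * (M + u ^ 2 * M ^ 2) / 2) - 0))
  have hc3 := hc.trans hc2
  have hc4 := mul_nonneg (show 0 ≤ 2 * q0 by positivity) hc3
  have e6 : ∀ A B : ℝ, 2 * q0 * (A + q0⁻¹ * B) = 2 * q0 * A + 2 * B := fun A B => by field_simp
  rw [e6] at hc4
  linarith
end Crit


/-- normalized curvature quotient -/
def Wf {n : ℕ} (φ : ℝ × E (n + 1) → ℝ) (t : ℝ) (X η : E (n + 1)) : ℝ :=
  φ (t, X) ^ 3 * HB φ (t, X) η η / ‖φ (t, X) • η - ⟪pV φ (t, X), η⟫ • X‖ ^ 2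

/-- unit tangent bundle of the sphere -/
def KK (n : ℕ) : Set (E (n + 1) × E (n + 1)) := {q | ‖q.1‖ = 1 ∧ ‖q.2‖ = 1 ∧ ⟪q.1, q.2⟫ = 0}

lemma KK_compact (n : ℕ) : IsCompact (KK n) := by
  refine ((isCompact_sphere (0 : E (n + 1)) 1).prod (isCompact_sphere (0 : E (n + 1)) 1)).of_isClosed_subset ?_ ?_
  · unfold KK
    refine ((isClosed_eq (by fun_prop) (by fun_prop)).inter ((isClosed_eq (by fun_prop) (by fun_prop)).inter
      (isClosed_eq (by fun_prop) (by fun_prop))))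
  · rintro q ⟨h1, h2, -⟩
    exact ⟨by simpa using h1, by simpa using h2⟩

namespace Sol
variable {n : ℕ} {Γ : Set (Fin n → ℝ)} {F : (Fin n → ℝ) → ℝ} {f : E (n + 1) → ℝ} {T k r₁ r₂ R₁ R₂ : ℝ}
    {U : Set (ℝ × E (n + 1))} {φ : ℝ × E (n + 1) → ℝ}

lemma Wf_inv (S : Sol Γ F f T U φ) {t : ℝ} {X : E (n + 1)} (hy : (t, X) ∈ U) {c a b : ℝ} (hc : 0 < c)
    (ha : a ≠ 0) (η : E (n + 1)) : Wf φ t (c • X) (a • η + b • X) = Wf φ t X η := by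
  unfold Wf
  rw [S.hom c hc t X hy, S.p_hom hy hc, S.H_hom hy hc]
  have e1 : HB φ (t, X) (a • η + b • X) (a • η + b • X) = a ^ 2 * HB φ (t, X) η η := by
    simp only [map_add, map_smul, add_apply, smul_apply, smul_eq_mul, S.HX hy]
    rw [S.H_symm hy X η, S.HX hy]; ring
  have e2 : (c * φ (t, X)) • (a • η + b • X) - ⟪pV φ (t, X), a • η + b • X⟫ • c • X =
      (c * a) • (φ (t, X) • η - ⟪pV φ (t, X), η⟫ • X) := by
    rw [inner_add_right, inner_smul_right, inner_smul_right, S.inner_pX hy]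
    module
  rw [e1, e2, norm_smul, mul_pow ‖c * a‖, Real.norm_eq_abs, sq_abs]
  have hca : (c * a) ^ 2 ≠ 0 := by positivity
  rw [show (c * φ (t, X)) ^ 3 * (c⁻¹ * (a ^ 2 * HB φ (t, X) η η)) = (c * a) ^ 2 * (φ (t, X) ^ 3 * HB φ (t, X) η η) by
    field_simp]
  rw [mul_div_mul_left _ _ hca]

lemma toK (S : Sol Γ F f T U φ) {t : ℝ} {X : E (n + 1)} (hX : X ≠ 0) {η : E (n + 1)}
    (hy : (t, X) ∈ U) (hη : φ (t, X) • η - ⟪pV φ (t, X), η⟫ • X ≠ 0) :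
    ∃ q ∈ KK n, ∀ s ∈ Icc 0 T, Wf φ s q.1 q.2 = Wf φ s X η := by
  have hX' : 0 < ‖X‖ := norm_pos_iff.2 hX
  have hη' : η - (⟪X, η⟫ / ‖X‖ ^ 2) • X ≠ 0 := by
    intro h
    apply hη
    rw [sub_eq_zero] at h
    rw [h, inner_smul_right, S.inner_pX hy]
    module
  have hn' := norm_pos_iff.2 hη'
  refine ⟨(‖X‖⁻¹ • X, ‖η - (⟪X, η⟫ / ‖X‖ ^ 2) • X‖⁻¹ • (η - (⟪X, η⟫ / ‖X‖ ^ 2) • X)), ⟨?_, ?_, ?_⟩, fun s hs => ?_⟩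
  · simp only [norm_smul, norm_inv, norm_norm]; field_simp
  · simp only [norm_smul, norm_inv, norm_norm]; field_simp
  · simp only [inner_smul_left, inner_smul_right, inner_sub_right, real_inner_self_eq_norm_sq]
    simp only [conj_trivial]; field_simp; simp
  · have h := S.Wf_inv (S.mem s hs X hX) (inv_pos.2 hX') (inv_pos.2 hn').ne' (a := ‖η - (⟪X, η⟫ / ‖X‖ ^ 2) • X‖⁻¹)
      (b := - (‖η - (⟪X, η⟫ / ‖X‖ ^ 2) • X‖⁻¹ * (⟪X, η⟫ / ‖X‖ ^ 2))) η
    rw [← h]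
    simp only
    congr 1
    module

lemma KK_den (S : Sol Γ F f T U φ) {t : ℝ} (ht : t ∈ Icc 0 T) {q : E (n + 1) × E (n + 1)} (hq : q ∈ KK n) :
    φ (t, q.1) • q.2 - ⟪pV φ (t, q.1), q.2⟫ • q.1 ≠ 0 := by
  intro h
  have h1 : q.1 ≠ 0 := fun h => by have := hq.1; rw [h] at this; simp at this
  have h2 := congrArg (fun v => ⟪q.2, v⟫) h
  simp only [inner_sub_right, inner_smul_right, real_inner_self_eq_norm_sq, hq.2.1, inner_zero_right] at h2
  rw [real_inner_comm q.1 q.2, hq.2.2] at h2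
  have := S.pos _ (S.mem t ht _ h1)
  simp at h2; linarith

lemma exists_crit (S : Sol Γ F f T U φ) {t : ℝ} (ht : t ∈ Icc 0 T) {q : E (n + 1) × E (n + 1)} (hq : q ∈ KK n)
    (hM : 0 < Wf φ t q.1 q.2) (hmax : ∀ y ∈ KK n, Wf φ t y.1 y.2 ≤ Wf φ t q.1 q.2) :
    ∃ X κ e o, Crit Γ F f T U φ t X κ e (Wf φ t q.1 q.2) o := by
  have h1 : q.1 ≠ 0 := fun h => by have := hq.1; rw [h] at this; simp at this
  have hy := S.mem t ht _ h1
  have hφ := S.pos _ hy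
  have hmx : ∀ Y : E (n + 1), Y ≠ 0 → ∀ η, φ (t, Y) ^ 3 * HB φ (t, Y) η η ≤
      Wf φ t q.1 q.2 * ‖φ (t, Y) • η - ⟪pV φ (t, Y), η⟫ • Y‖ ^ 2 := by
    intro Y hY η
    have hyY := S.mem t ht _ hY
    have hφY := S.pos _ hyY
    by_cases hη : φ (t, Y) • η - ⟪pV φ (t, Y), η⟫ • Y = 0
    · have e : η = (⟪pV φ (t, Y), η⟫ / φ (t, Y)) • Y := by
        rw [sub_eq_zero] at hη
        rw [div_eq_inv_mul, mul_smul, ← hη, smul_smul, inv_mul_cancel₀ hφY.ne', one_smul]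
      have : HB φ (t, Y) η η = 0 := by
        conv_lhs => rw [e]
        simp only [map_smul, smul_apply, S.HX hyY, smul_zero]
      rw [hη, this]; simp
    · obtain ⟨q', hq', h⟩ := S.toK hY hyY hη
      have h3 := hmax q' hq'
      rw [h t ht] at h3
      have hn := norm_pos_iff.2 hη
      unfold Wf at h3
      rwa [div_le_iff₀ (by positivity)] at h3
  set M := Wf φ t q.1 q.2 with hMd
  set X := (φ (t, q.1))⁻¹ • q.1 with hXd
  have hX : X ≠ 0 := smul_ne_zero (inv_pos.2 hφ).ne' h1
  have hyX := S.mem t ht _ hX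
  have hX1 : φ (t, X) = 1 := by rw [hXd, S.hom _ (inv_pos.2 hφ) t _ hy, inv_mul_cancel₀ hφ.ne']
  obtain ⟨κ, hκ, e, hd, hqq⟩ := S.pde t ht X hX
  have hp := S.p_pos hyX
  have hW : Wf φ t X q.2 = M := by
    have := S.Wf_inv hy (inv_pos.2 hφ) one_ne_zero (b := 0) q.2
    simpa using this
  set V := q.2 - ⟪pV φ (t, X), q.2⟫ • X with hVd
  have hV0 : V ≠ 0 := by
    intro h
    rw [← hW] at hM
    unfold Wf at hM
    rw [hX1, one_smul, ← hVd, h] at hM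
    simp at hM
  have hVp : ⟪pV φ (t, X), V⟫ = 0 := by
    rw [hVd, inner_sub_right, inner_smul_right, S.inner_pX hyX, hX1]; ring
  have hHV : HB φ (t, X) V V = M * ‖V‖ ^ 2 := by
    have e1 : HB φ (t, X) V V = HB φ (t, X) q.2 q.2 := by
      rw [hVd]
      simp only [map_sub, map_smul, sub_apply, smul_apply, smul_eq_mul, S.HX hyX]
      rw [S.H_symm hyX X q.2, S.HX hyX]; ring
    have hn := norm_pos_iff.2 hV0
    rw [e1, ← hW]
    unfold Wf
    rw [hX1, one_smul, ← hVd]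
    field_simp
  have hdiag := hd.diag (S.p_ne hyX) hVp
  have hnorm := hd.1.norm_sq (S.p_ne hyX) V
  rw [hVp] at hnorm
  simp only [smul_apply, smul_eq_mul, hX1, hHV] at hdiag
  have hself : ∀ j, HB φ (t, X) (e j) (e j) = κ j * ‖pV φ (t, X)‖ := fun j => by
    have := hd.self j
    simp only [smul_apply, smul_eq_mul, hX1] at this
    rw [← this]; field_simp
  have hle : ∀ j, κ j * ‖pV φ (t, X)‖ ≤ M := fun j => by
    have := hmx X hX (e j)
    rw [hd.1.2 j, hX1, hself, zero_smul, one_smul, sub_zero, hd.1.1.1 j] at this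
    linarith
  have hex : ∃ o, κ o * ‖pV φ (t, X)‖ = M := by
    by_contra! hcon
    have hlt : ∀ j, κ j * ‖pV φ (t, X)‖ < M := fun j => lt_of_le_of_ne (hle j) (hcon j)
    have hs : ∑ j, ⟪e j, V⟫ ^ 2 * (M - κ j * ‖pV φ (t, X)‖) = 0 := by
      simp only [mul_sub, Finset.sum_sub_distrib, ← mul_assoc, ← Finset.sum_mul]
      rw [← hdiag]
      have : ‖V‖ ^ 2 = ∑ j, ⟪e j, V⟫ ^ 2 := by rw [hnorm]; simp
      rw [← this]; field_simp; ring
    have h0 := (Finset.sum_eq_zero_iff_of_nonneg (fun j _ => mul_nonneg (sq_nonneg _) (by linarith [hlt j]))).1 hs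
    have h00 : ∀ j, ⟪e j, V⟫ ^ 2 = 0 := fun j => by
      rcases mul_eq_zero.1 (h0 j (Finset.mem_univ _)) with h | h
      · exact h
      · linarith [hlt j]
    simp only [h00] at hnorm
    have hn := norm_pos_iff.2 hV0
    simp at hnorm
    exact hV0 hnorm
  obtain ⟨o, ho⟩ := hex
  exact ⟨X, κ, e, o, ⟨S, ht, hX, hX1, hκ, hd, hqq, hM, hmx, by rw [hself, ho]⟩⟩

set_option synthInstance.maxHeartbeats 200000 in
set_option maxSynthPendingDepth 3 in
lemma Wf_cont (S : Sol Γ F f T U φ) :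
    ContinuousOn (fun q : ℝ × (E (n + 1) × E (n + 1)) => Wf φ q.1 q.2.1 q.2.2) (Icc 0 T ×ˢ KK n) := by
  have hm : MapsTo (fun q : ℝ × (E (n + 1) × E (n + 1)) => ((q.1, q.2.1) : ℝ × E (n + 1))) (Icc 0 T ×ˢ KK n) U := by
    rintro q ⟨h1, h2⟩
    exact S.mem _ h1 _ (fun h => by have := h2.1; rw [h] at this; simp at this)
  have c0 : ContinuousOn (fun q : ℝ × (E (n + 1) × E (n + 1)) => ((q.1, q.2.1) : ℝ × E (n + 1))) (Icc 0 T ×ˢ KK n) := by fun_prop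
  have c1 : ContinuousOn (fun q : ℝ × (E (n + 1) × E (n + 1)) => φ (q.1, q.2.1)) (Icc 0 T ×ˢ KK n) := S.sm.continuousOn.comp c0 hm
  have c2 : ContinuousOn (fun q : ℝ × (E (n + 1) × E (n + 1)) => fderiv ℝ φ (q.1, q.2.1)) (Icc 0 T ×ˢ KK n) :=
    (sm_fderiv S.op S.sm).continuousOn.comp c0 hm
  have h1 : ContDiffOn ℝ (⊤ : ℕ∞) (fderiv ℝ (fderiv ℝ φ)) U := (sm_fderiv S.op S.sm).fderiv_of_isOpen S.op (by simp)
  have c3 : ContinuousOn (fun q : ℝ × (E (n + 1) × E (n + 1)) => fderiv ℝ (fderiv ℝ φ) (q.1, q.2.1)) (Icc 0 T ×ˢ KK n) :=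
    h1.continuousOn.comp c0 hm
  have c4 : ContinuousOn (fun q : ℝ × (E (n + 1) × E (n + 1)) => (((0 : ℝ), q.2.2) : ℝ × E (n + 1))) (Icc 0 T ×ˢ KK n) := by fun_prop
  have c5 : ContinuousOn (fun q : ℝ × (E (n + 1) × E (n + 1)) => HB φ (q.1, q.2.1) q.2.2 q.2.2) (Icc 0 T ×ˢ KK n) := by
    have := (c3.clm_apply c4).clm_apply c4
    refine this.congr fun q hq => ?_
    simp [HB]
  have c6 : ContinuousOn (fun q : ℝ × (E (n + 1) × E (n + 1)) => ⟪pV φ (q.1, q.2.1), q.2.2⟫) (Icc 0 T ×ˢ KK n) := by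
    refine (c2.clm_apply c4).congr fun q hq => ?_
    simp only [pV_inner]; rfl
  unfold Wf
  refine ContinuousOn.div ((c1.pow 3).mul c5) (ContinuousOn.pow (ContinuousOn.norm ?_) 2) ?_
  · exact (c1.smul (by fun_prop)).sub (c6.smul (by fun_prop))
  · rintro q ⟨h1, h2⟩
    have := norm_pos_iff.2 (S.KK_den h1 h2)
    positivity

lemma tder (S : Sol Γ F f T U φ) {G : ℝ × E (n + 1) → ℝ} (hG : ContDiffOn ℝ (⊤ : ℕ∞) G U) {t : ℝ} {X : E (n + 1)}
    (hy : (t, X) ∈ U) : HasDerivAt (fun s => G (s, X)) (dd (1, 0) G (t, X)) t := by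
  have h := line_deriv S.op hG (y := ((0 : ℝ), X)) (v := (1, 0)) (s := t) (by simpa using hy)
  simpa using h

lemma Wf_ev (S : Sol Γ F f T U φ) {t : ℝ} {X : E (n + 1)} (hy : (t, X) ∈ U) (η : E (n + 1)) :
    (fun s => Wf φ s X η) =ᶠ[nhds t] fun s => φ (s, X) ^ 3 * dd (0, η) (dd (0, η) φ) (s, X) /
      (φ (s, X) ^ 2 * ‖η‖ ^ 2 - 2 * (φ (s, X) * dd (0, η) φ (s, X) * ⟪η, X⟫) + dd (0, η) φ (s, X) ^ 2 * ‖X‖ ^ 2) := by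
  have hc : ContinuousAt (fun s : ℝ => ((s, X) : ℝ × E (n + 1))) t := by fun_prop
  filter_upwards [hc.eventually (S.op.mem_nhds hy)] with s hs
  unfold Wf
  rw [HB_apply S.op S.sm hs, norm_sub_sq_real, norm_smul, norm_smul, inner_smul_left, inner_smul_right, mul_pow, mul_pow,
    Real.norm_eq_abs, Real.norm_eq_abs, sq_abs, sq_abs, pV_inner]
  simp only [conj_trivial]
  congr 3
  ring

lemma Wf_diff (S : Sol Γ F f T U φ) {t : ℝ} {X : E (n + 1)} (hy : (t, X) ∈ U) (η : E (n + 1))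
    (h0 : φ (t, X) • η - ⟪pV φ (t, X), η⟫ • X ≠ 0) : DifferentiableAt ℝ (fun s => Wf φ s X η) t := by
  refine DifferentiableAt.congr_of_eventuallyEq ?_ (S.Wf_ev hy η)
  have d0 := (S.tder S.sm hy).differentiableAt
  have d1 := (S.tder (sm_dd S.op S.sm (0, η)) hy).differentiableAt
  have d2 := (S.tder (sm_dd S.op (sm_dd S.op S.sm (0, η)) (0, η)) hy).differentiableAt
  refine DifferentiableAt.div ((d0.pow 3).mul d2) ((((d0.pow 2).mul_const _).sub (((d0.mul d1).mul_const _).const_mul 2)).add ((d1.pow 2).mul_const _)) ?_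
  have h := norm_pos_iff.2 h0
  have h2 : 0 < ‖φ (t, X) • η - ⟪pV φ (t, X), η⟫ • X‖ ^ 2 := by positivity
  rw [norm_sub_sq_real, norm_smul, norm_smul, inner_smul_left, inner_smul_right, mul_pow, mul_pow,
    Real.norm_eq_abs, Real.norm_eq_abs, sq_abs, sq_abs, pV_inner] at h2
  simp only [conj_trivial] at h2
  intro h3
  rw [← mul_assoc] at h2
  linarith
end Sol

lemma Crit.Wder {n : ℕ} {Γ : Set (Fin n → ℝ)} {F : (Fin n → ℝ) → ℝ} {f : E (n + 1) → ℝ} {T : ℝ}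
    {U : Set (ℝ × E (n + 1))} {φ : ℝ × E (n + 1) → ℝ} {t : ℝ} {X : E (n + 1)} {κ : Fin n → ℝ}
    {e : Fin n → E (n + 1)} {M : ℝ} {o : Fin n} (C : Crit Γ F f T U φ t X κ e M o) :
    HasDerivAt (fun s => Wf φ s X (e o)) (dd (1, 0) φ (t, X) * M + sd (e o) (sd (e o) (dd (1, 0) φ)) (t, X)
      + 2 * M * ⟪e o, X⟫ * sd (e o) (dd (1, 0) φ) (t, X)) t := by
  refine HasDerivAt.congr_of_eventuallyEq ?_ (C.S.Wf_ev C.m (e o))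
  have d0 := C.S.tder C.S.sm C.m
  have d1 := C.S.tder (C.sm1 (e o)) C.m
  have d2 := C.S.tder (C.sm2 (e o) (e o)) C.m
  have e0 := C.pe o
  have e2 := C.Hab o o
  rw [if_pos rfl, C.HM] at e2
  have c1 : dd (1, 0) (sd (e o) φ) (t, X) = sd (e o) (dd (1, 0) φ) (t, X) := dd_comm C.S.op C.S.sm C.m _ _
  have c2 : dd (1, 0) (sd (e o) (sd (e o) φ)) (t, X) = sd (e o) (sd (e o) (dd (1, 0) φ)) (t, X) :=
    (dd_comm C.S.op (C.sm1 (e o)) C.m _ _).trans (dd_comm3 C.S.op C.S.sm C.m _ _ _)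
  rw [c1] at d1
  rw [c2] at d2
  have hD := ((d0.pow 2).mul_const (‖e o‖ ^ 2)).sub (((d0.mul d1).mul_const ⟪e o, X⟫).const_mul 2) |>.add ((d1.pow 2).mul_const (‖X‖ ^ 2))
  have := ((d0.pow 3).mul d2).div hD (by
    simp [e0, C.h1, C.data.1.1.1 o])
  refine this.congr_deriv ?_
  simp [e0, e2, C.h1, C.data.1.1.1 o]
  ring

namespace Sol
variable {n : ℕ} {Γ : Set (Fin n → ℝ)} {F : (Fin n → ℝ) → ℝ} {f : E (n + 1) → ℝ} {T k r₁ r₂ R₁ R₂ : ℝ}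
    {U : Set (ℝ × E (n + 1))} {φ : ℝ × E (n + 1) → ℝ}

lemma E3 (S : Sol Γ F f T U φ) (hk : 0 < k) (hΓ : GoodCone Γ) (hF : GoodF Γ F k) (hf : GoodPrescribed f k r₁ r₂)
    (hT : 0 < T) {M₀ : ℝ} (hM₀ : 0 ≤ M₀) (h0 : ∀ q ∈ KK n, Wf φ 0 q.1 q.2 ≤ M₀)
    (hbig : ∀ t ∈ Icc 0 T, ∀ X : E (n + 1), X ≠ 0 → φ (t, X) = 1 → ∀ v : E (n + 1), ‖v‖ = 1 → ∀ M, M₀ < M →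
      (k * QQ f φ (t, X) - SS φ (t, X)) * M + dd v (dd v f) X
        - (k * QQ f φ (t, X) + SS φ (t, X)) * ((‖pV φ (t, X)‖⁻¹) ^ 2 * M ^ 2) ≤ 0) :
    ∀ t ∈ Icc 0 T, ∀ q ∈ KK n, Wf φ t q.1 q.2 ≤ M₀ := by
  refine MP (KK_compact n) hT (w := fun t q => Wf φ t q.1 q.2) (w' := fun t q => deriv (fun s => Wf φ s q.1 q.2) t)
    S.Wf_cont ?_ h0 ?_
  · intro t ht q hq
    have h1 : q.1 ≠ 0 := fun h => by have := hq.1; rw [h] at this; simp at this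
    have ht' : t ∈ Icc 0 T := ⟨ht.1.le, ht.2.le⟩
    exact (S.Wf_diff (S.mem t ht' _ h1) q.2 (S.KK_den ht' hq)).hasDerivAt
  · intro t ht q hq hlt hmx
    have ht' : t ∈ Icc 0 T := ⟨ht.1.le, ht.2.le⟩
    obtain ⟨X, κ, e, o, C⟩ := S.exists_crit ht' hq (hM₀.trans_lt hlt) hmx
    have hne : φ (t, X) • e o - ⟪pV φ (t, X), e o⟫ • X ≠ 0 := by
      rw [C.h1, C.data.1.2 o, zero_smul, sub_zero, one_smul]
      exact C.data.1.1.ne_zero o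
    obtain ⟨q', hq', h⟩ := S.toK C.hX C.m hne
    refine ⟨q', hq', ?_, ?_⟩
    · have : Wf φ t X (e o) = Wf φ t q.1 q.2 := by
        rw [show Wf φ t X (e o) = φ (t, X) ^ 3 * HB φ (t, X) (e o) (e o) / ‖φ (t, X) • e o - ⟪pV φ (t, X), e o⟫ • X‖ ^ 2 from rfl]
        rw [C.h1, C.data.1.2 o, C.ho]
        simp [C.data.1.1.1 o]
      exact (h t ht').trans this
    · have he : (fun s => Wf φ s q'.1 q'.2) =ᶠ[nhds t] fun s => Wf φ s X (e o) := by
        filter_upwards [Icc_mem_nhds ht.1 ht.2] with s hs using h s hs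
      have hd := (C.Wder.congr_of_eventuallyEq he).deriv
      simp only [hd]
      have hm := C.main hk hΓ hF hf rfl
      have hb := hbig t ht' X C.hX C.h1 (e o) (C.data.1.1.1 o) _ hlt
      have hp := C.S.p_pos C.m
      have hu : 0 < ‖pV φ (t, X)‖⁻¹ := by positivity
      by_contra! hc
      have := mul_pos hu hc
      linarith

lemma curv_bound (S : Sol Γ F f T U φ) (hn : 2 ≤ n) (hΓ : GoodCone Γ) {M₀ : ℝ} (hM₀ : 0 ≤ M₀) {t : ℝ} (ht : t ∈ Icc 0 T)
    (h : ∀ q ∈ KK n, Wf φ t q.1 q.2 ≤ M₀) (hR2 : 0 < R₂) {x : E (n + 1)} (hx : x ∈ Sph n) (hlo : R₂⁻¹ ≤ φ (t, x))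
    {κ : Fin n → ℝ} {e : Fin n → E (n + 1)}
    (hd : IsData (pV φ (t, x)) ((φ (t, x) / ‖pV φ (t, x)‖) • HB φ (t, x)) κ e) (i : Fin n) : |κ i| ≤ n * (M₀ * R₂) := by
  have hy := S.mem t ht x (sph_ne x hx)
  have hφ := S.pos _ hy
  have hp := S.p_pos hy
  have hx1 : ‖x‖ = 1 := by simpa using hx
  have hpl : R₂⁻¹ ≤ ‖pV φ (t, x)‖ := by
    refine hlo.trans ?_
    rw [← S.inner_pX hy]
    refine (real_inner_le_norm _ _).trans ?_
    rw [hx1, mul_one]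
  have hup : ∀ {κ : Fin n → ℝ} {e : Fin n → E (n + 1)},
      IsData (pV φ (t, x)) ((φ (t, x) / ‖pV φ (t, x)‖) • HB φ (t, x)) κ e → ∀ j, κ j ≤ M₀ * R₂ := by
    intro κ e hd j
    have hne : φ (t, x) • e j - ⟪pV φ (t, x), e j⟫ • x ≠ 0 := by
      rw [hd.1.2 j, zero_smul, sub_zero]
      exact smul_ne_zero hφ.ne' (hd.1.1.ne_zero j)
    obtain ⟨q, hq, h2⟩ := S.toK (sph_ne x hx) hy hne
    have h3 := h q hq
    rw [h2 t ht] at h3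
    unfold Wf at h3
    rw [hd.1.2 j, zero_smul, sub_zero, norm_smul, hd.1.1.1 j, mul_one, Real.norm_eq_abs, sq_abs] at h3
    have h4 : φ (t, x) * HB φ (t, x) (e j) (e j) ≤ M₀ := by
      refine le_trans (le_of_eq ?_) h3
      field_simp
    have h5 := hd.self j
    simp only [smul_apply, smul_eq_mul] at h5
    rw [← h5, div_mul_eq_mul_div, div_le_iff₀ hp]
    refine h4.trans ?_
    rw [mul_assoc]
    refine le_mul_of_one_le_right hM₀ ?_
    have := mul_le_mul_of_nonneg_left hpl hR2.le
    rwa [mul_inv_cancel₀ hR2.ne'] at this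
  have hB : 0 ≤ M₀ * R₂ := by positivity
  have hn1 : (2 : ℝ) ≤ n := by exact_mod_cast hn
  obtain ⟨κ', hκ', e', hd', -⟩ := S.pde t ht x (sph_ne x hx)
  have hlow : ∀ j, -(n * (M₀ * R₂)) ≤ κ' j := by
    intro j
    have hs := cone_sum_pos hn hΓ hκ'
    rw [← Finset.add_sum_erase _ _ (Finset.mem_univ j)] at hs
    have h2 : ∑ l ∈ Finset.univ.erase j, κ' l ≤ ∑ l ∈ Finset.univ.erase j, M₀ * R₂ := Finset.sum_le_sum fun l _ => hup hd' l
    rw [Finset.sum_const, Finset.card_erase_of_mem (Finset.mem_univ j), nsmul_eq_mul] at h2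
    have h3 : ((Finset.univ.card (α := Fin n) - 1 : ℕ) : ℝ) ≤ n := by
      rw [Finset.card_univ, Fintype.card_fin]; exact_mod_cast Nat.sub_le n 1
    nlinarith
  rw [abs_le]
  constructor
  · have h1 := hd'.diag (S.p_ne hy) (hd.1.2 i)
    rw [hd.self i] at h1
    have h2 := hd'.1.norm_sq (S.p_ne hy) (e i)
    rw [hd.1.2 i, hd.1.1.1 i] at h2
    have h3 : ∑ j, ⟪e' j, e i⟫ ^ 2 * (-(n * (M₀ * R₂))) ≤ ∑ j, ⟪e' j, e i⟫ ^ 2 * κ' j :=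
      Finset.sum_le_sum fun j _ => mul_le_mul_of_nonneg_left (hlow j) (sq_nonneg _)
    rw [← Finset.sum_mul] at h3
    have h4 : ∑ j, ⟪e' j, e i⟫ ^ 2 = 1 := by linarith [h2, show (0 : ℝ) ^ 2 / ‖pV φ (t, x)‖ ^ 2 = 0 by simp]
    rw [h4, one_mul] at h3
    linarith
  · refine (hup hd i).trans ?_
    nlinarith
end Sol


lemma grad_inner {m : ℕ} (r : E m → ℝ) (y v : E m) : ⟪gradient r y, v⟫ = dd v r y := by
  simp [gradient, dd]

lemma hess_eq {m : ℕ} {r : E m → ℝ} {O : Set (E m)} (hO : IsOpen O) (hr : ContDiffOn ℝ (⊤ : ℕ∞) r O) {y : E m} (hy : y ∈ O)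
    (u w : E m) : hess r y u w = dd u (dd w r) y := by
  unfold hess
  have hd : DifferentiableAt ℝ (fderiv ℝ r) y := ((sm_fderiv hO hr).contDiffAt (hO.mem_nhds hy)).differentiableAt (by simp)
  have h1 : HasFDerivAt (gradient r) ((InnerProductSpace.toDual ℝ (E m)).symm.toContinuousLinearEquiv.toContinuousLinearMap.comp
      (fderiv ℝ (fderiv ℝ r) y)) y :=
    (InnerProductSpace.toDual ℝ (E m)).symm.toContinuousLinearEquiv.toContinuousLinearMap.hasFDerivAt.comp y hd.hasFDerivAt
  rw [h1.fderiv, dd_dd hO hr hy]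
  simp

/-- gauge function -/
def gau {n : ℕ} (ρ : ℝ → E (n + 1) → ℝ) (y : ℝ × E (n + 1)) : ℝ := ‖y.2‖ / ρ y.1 (‖y.2‖⁻¹ • y.2)

/-- its domain -/
def gU {n : ℕ} (ρ : ℝ → E (n + 1) → ℝ) : Set (ℝ × E (n + 1)) := {y | y.2 ≠ 0 ∧ 0 < ρ y.1 (‖y.2‖⁻¹ • y.2)}

section
variable {n : ℕ} {Γ : Set (Fin n → ℝ)} {F : (Fin n → ℝ) → ℝ} {f : E (n + 1) → ℝ} {T k r₁ r₂ R₁ R₂ : ℝ}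
    {ρ : ℝ → E (n + 1) → ℝ} {ρ₀ : E (n + 1) → ℝ}

lemma gau_sm1 (h : ContDiffOn ℝ (⊤ : ℕ∞) (fun p : ℝ × E (n + 1) => ρ p.1 p.2) (univ ×ˢ {y | y ≠ 0})) :
    ContDiffOn ℝ (⊤ : ℕ∞) (fun y : ℝ × E (n + 1) => ρ y.1 (‖y.2‖⁻¹ • y.2)) (univ ×ˢ {y | y ≠ 0}) := by
  have h2 : ContDiffOn ℝ (⊤ : ℕ∞) (fun y : ℝ × E (n + 1) => ((y.1, ‖y.2‖⁻¹ • y.2) : ℝ × E (n + 1))) (univ ×ˢ {y | y ≠ 0}) := by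
    have a : ContDiffOn ℝ (⊤ : ℕ∞) (fun y : ℝ × E (n + 1) => ‖y.2‖) (univ ×ˢ {y | y ≠ 0}) :=
      ContDiffOn.norm ℝ contDiffOn_snd (fun y hy => hy.2)
    have b : ContDiffOn ℝ (⊤ : ℕ∞) (fun y : ℝ × E (n + 1) => ‖y.2‖⁻¹) (univ ×ˢ {y | y ≠ 0}) :=
      a.inv fun y hy => norm_ne_zero_iff.2 hy.2
    have c : ContDiffOn ℝ (⊤ : ℕ∞) (fun y : ℝ × E (n + 1) => ‖y.2‖⁻¹ • y.2) (univ ×ˢ {y | y ≠ 0}) :=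
      b.smul contDiffOn_snd
    exact contDiffOn_fst.prodMk c
  exact ContDiffOn.comp (g := fun p : ℝ × E (n + 1) => ρ p.1 p.2) h h2 (fun y hy => ⟨trivial, smul_ne_zero (inv_ne_zero (norm_ne_zero_iff.2 hy.2)) hy.2⟩)

lemma gau_sol0 (h : IsFlowSol Γ F f T ρ ρ₀) : Sol Γ F f (-1) (gU ρ) (gau ρ) where
  op := by
    have h1 := (gau_sm1 h.1).continuousOn
    have h2 := h1.isOpen_inter_preimage (isOpen_univ.prod ne_open) (isOpen_Ioi (a := (0 : ℝ)))
    have e : gU ρ = (univ ×ˢ {y | y ≠ 0}) ∩ (fun y : ℝ × E (n + 1) => ρ y.1 (‖y.2‖⁻¹ • y.2)) ⁻¹' Ioi 0 :=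
      Set.ext fun y => by simp [gU]
    rw [e]; exact h2
  sm := by
    refine ContDiffOn.div ?_ ((gau_sm1 h.1).mono fun y hy => ⟨trivial, hy.1⟩) (fun y hy => hy.2.ne')
    exact ContDiffOn.norm ℝ contDiffOn_snd (fun y hy => hy.1)
  mem := fun t ht => by have := ht.1.trans ht.2; norm_num at this
  ne := fun y hy => hy.1
  pos := fun y hy => div_pos (norm_pos_iff.2 hy.1) hy.2
  cone := fun c hc t X hX => by
    refine ⟨smul_ne_zero hc.ne' hX.1, ?_⟩
    have := hX.2
    simp only at this ⊢
    have hX0 := norm_ne_zero_iff.2 hX.1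
    rw [norm_smul, Real.norm_eq_abs, abs_of_pos hc, smul_smul, mul_inv, mul_comm c⁻¹, mul_assoc, inv_mul_cancel₀ hc.ne', mul_one]
    exact this
  hom := fun c hc t X hX => by
    unfold gau
    simp only
    have hX0 := norm_ne_zero_iff.2 hX.1
    rw [norm_smul, Real.norm_eq_abs, abs_of_pos hc, smul_smul, mul_inv, mul_comm c⁻¹, mul_assoc ‖X‖⁻¹, inv_mul_cancel₀ hc.ne', mul_one, mul_div_assoc]
  pde := fun t ht => by have := ht.1.trans ht.2; norm_num at this
end


section
variable {n : ℕ} {Γ : Set (Fin n → ℝ)} {F : (Fin n → ℝ) → ℝ} {f : E (n + 1) → ℝ} {T k t : ℝ}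
    {U : Set (ℝ × E (n + 1))} {φ : ℝ × E (n + 1) → ℝ} {r : E (n + 1) → ℝ} {x : E (n + 1)}

lemma Sol.rad1 (S : Sol Γ F f T U φ) (hr : ContDiffOn ℝ (⊤ : ℕ∞) r {y | y ≠ 0})
    (h : ∀ Y : E (n + 1), Y ≠ 0 → φ (t, Y) * r Y = ‖Y‖) (hx : ‖x‖ = 1) (hy : (t, x) ∈ U) (v : E (n + 1)) :
    φ (t, x) * dd v r x + ⟪pV φ (t, x), v⟫ * r x = ⟪x, v⟫ ∧
    φ (t, x) * dd v (dd v r) x + 2 * ⟪pV φ (t, x), v⟫ * dd v r x + HB φ (t, x) v v * r x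
      = ‖v‖ ^ 2 - ⟪x, v⟫ ^ 2 := by
  have x0 : x ≠ 0 := by rintro rfl; simp at hx
  have h1 := (S.T2s hy v).mul (T2.line ne_open hr x0 v)
  have h2 := h1.mul h1
  have h3 : T2 (fun s : ℝ => 1 + 2 * ⟪x, v⟫ * s + ‖v‖ ^ 2 * s ^ 2) 1 (2 * ⟪x, v⟫) (‖v‖ ^ 2) := by
    simp [T2]
  have h4 := h2.congr (g' := fun s : ℝ => 1 + 2 * ⟪x, v⟫ * s + ‖v‖ ^ 2 * s ^ 2) (by
    filter_upwards [line_mem ne_open x0 v] with s hs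
    rw [h _ hs, ← sq, norm_add_sq_real, hx, norm_smul, inner_smul_right, mul_pow, Real.norm_eq_abs, sq_abs]; ring)
  obtain ⟨-, e2, e3⟩ := h4.unique h3
  have e1 := h x x0
  rw [hx] at e1
  rw [e1] at e2 e3
  have e4 : φ (t, x) * dd v r x + ⟪pV φ (t, x), v⟫ * r x = ⟪x, v⟫ := by linarith
  refine ⟨e4, ?_⟩
  rw [e4] at e3
  linarith

lemma Sol.rad_data (S : Sol Γ F f T U φ) (hr : ContDiffOn ℝ (⊤ : ℕ∞) r {y | y ≠ 0})
    (h : ∀ Y : E (n + 1), Y ≠ 0 → φ (t, Y) * r Y = ‖Y‖) (hx : ‖x‖ = 1) (hy : (t, x) ∈ U) :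
    Real.sqrt ((r x) ^ 2 + ‖gradient r x‖ ^ 2) = r x ^ 2 * ‖pV φ (t, x)‖ ∧ ∀ κ, HasPrincCurv r x κ →
    ∃ e, IsData (pV φ (t, x)) ((φ (t, x) / ‖pV φ (t, x)‖) • HB φ (t, x)) κ e := by
  have x0 : x ≠ 0 := by rintro rfl; simp at hx
  have hP := S.p_pos hy
  have hφ := S.pos _ hy
  have hxx : ⟪x, x⟫ = 1 := by rw [real_inner_self_eq_norm_sq, hx]; norm_num
  have e1 := h x x0
  rw [hx] at e1
  have R := S.rad1 hr h hx hy
  have hpx := S.inner_pX hy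
  set p := pV φ (t, x) with hp
  have r0 : 0 < r x := by
    by_contra h0
    nlinarith
  have hφ' : φ (t, x) = (r x)⁻¹ := eq_inv_of_mul_eq_one_left e1
  have hg : ∀ v, ⟪gradient r x, v⟫ = r x * ⟪x, v⟫ - r x ^ 2 * ⟪p, v⟫ := fun v => by
    have := (R v).1
    rw [grad_inner]
    rw [hφ'] at this
    field_simp at this
    linarith
  have hG : gradient r x = r x • x - r x ^ 2 • p := by
    refine ext_inner_right ℝ fun v => ?_
    rw [hg, inner_sub_left, inner_smul_left, inner_smul_left]; simp
  have hsq : Real.sqrt ((r x) ^ 2 + ‖gradient r x‖ ^ 2) = r x ^ 2 * ‖p‖ := by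
    rw [Real.sqrt_eq_iff_mul_self_eq (by positivity) (by positivity)]
    have : ‖gradient r x‖ ^ 2 = r x ^ 4 * ‖p‖ ^ 2 - r x ^ 2 := by
      rw [hG, norm_sub_sq_real, norm_smul, norm_smul, inner_smul_left, inner_smul_right, real_inner_comm, hpx, hx, hφ']
      simp only [Real.norm_eq_abs, mul_pow, sq_abs]
      simp
      field_simp
      ring
    rw [this]; ring
  refine ⟨hsq, ?_⟩
  have hH : ∀ v, ⟪x, v⟫ = 0 → r x ^ 3 * HB φ (t, x) v v =
      r x ^ 2 * ⟪v, v⟫ + 2 * ⟪gradient r x, v⟫ * ⟪gradient r x, v⟫ - r x * hess r x v v := fun v hv => by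
    have h1 := (R v).2
    rw [hess_eq ne_open hr x0, hg, hv, real_inner_self_eq_norm_sq]
    have h2 := hg v
    rw [grad_inner] at h2
    rw [h2, hv, hφ'] at h1
    field_simp at h1
    linear_combination r x * h1
  have hsym : ∀ u w, hess r x u w = hess r x w u := fun u w => by
    rw [hess_eq ne_open hr x0, hess_eq ne_open hr x0, dd_comm ne_open hr x0]
  have hadd : ∀ u w z, hess r x (u + w) z = hess r x u z + hess r x w z := fun u w z => by
    simp [hess, inner_add_left]
  have hB : ∀ u w, ⟪x, u⟫ = 0 → ⟪x, w⟫ = 0 → r x ^ 3 * HB φ (t, x) u w =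
      r x ^ 2 * ⟪u, w⟫ + 2 * ⟪gradient r x, u⟫ * ⟪gradient r x, w⟫ - r x * hess r x u w := fun u w hu hw => by
    have h1 := hH u hu
    have h2 := hH w hw
    have h3 := hH (u + w) (by rw [inner_add_right, hu, hw, add_zero])
    rw [hadd, hsym u (u + w), hsym w (u + w), hadd, hadd, hsym w u] at h3
    simp only [map_add, add_apply, inner_add_right, inner_add_left] at h3
    rw [S.H_symm hy w u, real_inner_comm u w] at h3
    linear_combination (h3 - h1 - h2) / 2
  rintro κ ⟨w, hw, hwx, hk⟩
  refine exists_data (w := fun i => w i - (r x * ⟪p, w i⟫) • x) ?_ ?_ ?_ ?_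
  · intro V W
    simp [S.H_symm hy V W]
  · let L : E (n + 1) →ₗ[ℝ] E (n + 1) :=
      LinearMap.id - (innerSL ℝ x).toLinearMap.smulRight x
    refine LinearIndependent.of_comp L ?_
    convert hw using 1
    ext1 i
    simp [L, inner_sub_right, inner_smul_right, hwx, hx]
  · intro i
    rw [inner_sub_right, inner_smul_right, hpx, hφ']
    field_simp; ring
  · intro i V hV
    have hHx : ∀ z, HB φ (t, x) x z = 0 := fun z => by rw [S.H_symm hy, S.HX hy]
    have hu : ⟪x, V - ⟪x, V⟫ • x⟫ = 0 := by rw [inner_sub_right, inner_smul_right, hxx]; ring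
    have h1 := hk i _ hu
    unfold hForm gForm at h1
    rw [← hB _ _ hu (hwx i), hsq, hg, hg, hu, hwx i] at h1
    simp only [map_sub, map_smul, sub_apply, smul_apply, inner_sub_left, inner_sub_right, inner_smul_left, inner_smul_right, hHx, hwx i, hV, hpx, S.HX hy, smul_eq_mul] at h1 ⊢
    rw [hφ'] at h1 ⊢
    simp only [real_inner_comm, conj_trivial] at h1 ⊢
    have hc : ⟪V, x⟫ = ⟪x, V⟫ := real_inner_comm _ _
    field_simp at h1 ⊢
    linear_combination h1
end


section
variable {n : ℕ} {Γ : Set (Fin n → ℝ)} {F : (Fin n → ℝ) → ℝ} {f : E (n + 1) → ℝ} {T k t : ℝ}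
    {ρ : ℝ → E (n + 1) → ℝ} {ρ₀ : E (n + 1) → ℝ} {x : E (n + 1)}

lemma gau_unit (hx : ‖x‖ = 1) (s : ℝ) : gau ρ (s, x) = (ρ s x)⁻¹ := by
  simp [gau, hx]

lemma gau_pos (h : IsFlowSol Γ F f T ρ ρ₀) (ht : t ∈ Icc 0 T) {Y : E (n + 1)} (hY : Y ≠ 0) : 0 < ρ t Y := by
  have hY0 := norm_pos_iff.2 hY
  rw [← h.2.1 t ht ‖Y‖⁻¹ (by positivity)]
  exact h.2.2.1 t ht _ (by rw [norm_smul]; simp; field_simp)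

lemma gau_mem (h : IsFlowSol Γ F f T ρ ρ₀) (ht : t ∈ Icc 0 T) {Y : E (n + 1)} (hY : Y ≠ 0) : (t, Y) ∈ gU ρ := by
  have hY0 := norm_pos_iff.2 hY
  refine ⟨hY, ?_⟩
  simp only
  rw [h.2.1 t ht ‖Y‖⁻¹ (by positivity)]
  exact gau_pos h ht hY

lemma gau_mul (h : IsFlowSol Γ F f T ρ ρ₀) (ht : t ∈ Icc 0 T) (Y : E (n + 1)) (hY : Y ≠ 0) :
    gau ρ (t, Y) * ρ t Y = ‖Y‖ := by
  have hY0 := norm_pos_iff.2 hY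
  have := gau_pos h ht hY
  unfold gau
  simp only
  rw [h.2.1 t ht ‖Y‖⁻¹ (by positivity)]
  field_simp

lemma gau_slice (h : IsFlowSol Γ F f T ρ ρ₀) (t : ℝ) : ContDiffOn ℝ (⊤ : ℕ∞) (ρ t) {y | y ≠ 0} := by
  have h2 : ContDiffOn ℝ (⊤ : ℕ∞) (fun y : E (n + 1) => ((t, y) : ℝ × E (n + 1))) {y | y ≠ 0} :=
    contDiffOn_const.prodMk contDiffOn_id
  exact ContDiffOn.comp (g := fun p : ℝ × E (n + 1) => ρ p.1 p.2) h.1 h2 (fun y hy => ⟨trivial, hy⟩)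

lemma gau_rho (h : IsFlowSol Γ F f T ρ ρ₀) (ht : t ∈ Icc 0 T) (hx : ‖x‖ = 1) {κ : Fin n → ℝ} (hκ : HasPrincCurv (ρ t) x κ) :
    VV (gau ρ) (t, x) = calF F f (ρ t) x κ / ρ t x ∧ (F κ)⁻¹ = QQ f (gau ρ) (t, x) := by
  have S := gau_sol0 h
  have x0 : x ≠ 0 := by rintro rfl; simp at hx
  have hy := gau_mem h ht x0
  have r0 := gau_pos h ht x0
  have h1 := S.tder S.sm hy
  simp only [gau_unit hx] at h1
  have hd : DifferentiableAt ℝ (fun s => ρ s x) t := by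
    have h3 := line_deriv (isOpen_univ.prod ne_open) h.1 (y := ((0 : ℝ), x)) (v := (1, 0)) (s := t) (by simpa using x0)
    simp at h3
    exact h3.differentiableAt
  have h2 := hd.hasDerivAt.fun_inv r0.ne'
  have h3 := h1.unique h2
  have h4 := h.2.2.2.2.1 t ht x hx κ hκ
  have hs := (S.rad_data (gau_slice h t) (gau_mul h ht) hx hy).1
  have hV : VV (gau ρ) (t, x) = calF F f (ρ t) x κ / ρ t x := by
    unfold VV
    rw [h3, h4, gau_unit hx]
    field_simp
  refine ⟨hV, ?_⟩
  rw [S.VV_eq hy] at hV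
  unfold calF at hV
  rw [hs] at hV
  unfold QQ
  rw [gau_unit hx]
  have := S.p_pos hy
  field_simp at hV
  simp only [inv_inv]
  rw [hV]; ring

lemma gau_sol (h : IsFlowSol Γ F f T ρ ρ₀) : Sol Γ F f T (gU ρ) (gau ρ) :=
  { gau_sol0 h with
    mem := fun t ht X hX => gau_mem h ht hX
    pde := fun t ht X hX => by
      have S := gau_sol0 h
      have c0 := norm_pos_iff.2 hX
      obtain ⟨x, hx, hxX⟩ : ∃ x : E (n + 1), ‖x‖ = 1 ∧ X = ‖X‖ • x :=
        ⟨‖X‖⁻¹ • X, by rw [norm_smul]; simp; field_simp, by rw [smul_smul, mul_inv_cancel₀ c0.ne', one_smul]⟩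
      have x0 : x ≠ 0 := by rintro rfl; simp at hx
      have hy := gau_mem h ht x0
      generalize ‖X‖ = c at *
      subst hxX
      obtain ⟨κ, hκ, hp⟩ := h.2.2.2.1 t ht x hx
      obtain ⟨e, he⟩ := (S.rad_data (gau_slice h t) (gau_mul h ht) hx hy).2 κ hp
      have hH : HB (gau ρ) (t, c • x) = c⁻¹ • HB (gau ρ) (t, x) := by
        ext v w; rw [S.H_hom hy c0]; simp
      have h1 := S.pos _ hy
      have h2 := S.p_pos hy
      refine ⟨κ, hκ, e, ?_, ?_⟩
      · rw [S.p_hom hy c0, S.hom c c0 t x hy, hH, smul_smul]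
        convert he using 2
        field_simp
      · rw [(gau_rho h ht hx hp).2]
        unfold QQ SS
        rw [S.p_hom hy c0, S.hom c c0 t x hy, S.dt_hom hy c0]
        simp only [smul_smul]
        congr 1
        · congr 2; field_simp
        · field_simp }
end


lemma curv_congr {n : ℕ} {r r' : E (n + 1) → ℝ} {x : E (n + 1)} (h : r =ᶠ[nhds x] r') {κ : Fin n → ℝ}
    (hκ : HasPrincCurv r x κ) (F : (Fin n → ℝ) → ℝ) (f : E (n + 1) → ℝ) :
    HasPrincCurv r' x κ ∧ calF F f r' x κ = calF F f r x κ := by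
  have hg : gradient r =ᶠ[nhds x] gradient r' := by
    filter_upwards [h.eventuallyEq_nhds] with y hy
    unfold gradient; rw [hy.fderiv_eq]
  have e1 : gradient r' x = gradient r x := hg.eq_of_nhds.symm
  have e2 : r' x = r x := h.eq_of_nhds.symm
  have e3 : fderiv ℝ (gradient r') x = fderiv ℝ (gradient r) x := hg.fderiv_eq.symm
  constructor
  · obtain ⟨w, h1, h2, h3⟩ := hκ
    refine ⟨w, h1, h2, fun i u hu => ?_⟩
    have := h3 i u hu
    unfold hForm gForm hess at *
    rw [e1, e2, e3]; exact this
  · unfold calF; rw [e1, e2]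

section
variable {n : ℕ} {Γ : Set (Fin n → ℝ)} {F : (Fin n → ℝ) → ℝ} {f : E (n + 1) → ℝ} {T T' k r₁ r₂ R₁ R₂ : ℝ}
    {U U' : Set (ℝ × E (n + 1))} {φ φ' : ℝ × E (n + 1) → ℝ}

lemma Sol.Wf0 (S : Sol Γ F f T U φ) (hT : 0 < T) (S' : Sol Γ F f T' U' φ') (hT' : 0 < T')
    (h : ∀ Y : E (n + 1), Y ≠ 0 → φ (0, Y) = φ' (0, Y)) {X : E (n + 1)} (hX : X ≠ 0) (η : E (n + 1)) :
    Wf φ 0 X η = Wf φ' 0 X η := by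
  have key : ∀ v, ⟪pV φ (0, X), v⟫ = ⟪pV φ' (0, X), v⟫ ∧ HB φ (0, X) v v = HB φ' (0, X) v v := fun v => by
    have h1 := S.T2s (S.mem 0 ⟨le_rfl, hT.le⟩ X hX) v
    have h2 := (S'.T2s (S'.mem 0 ⟨le_rfl, hT'.le⟩ X hX) v).congr (g' := fun s : ℝ => φ (0, X + s • v)) (by
      filter_upwards [line_mem ne_open hX v] with s hs using h _ hs)
    have h3 := h1.unique h2
    exact ⟨h3.2.1, by linarith [h3.2.2]⟩
  have hp : pV φ (0, X) = pV φ' (0, X) := ext_inner_right ℝ fun v => (key v).1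
  unfold Wf
  rw [hp, h X hX, (key η).2]

lemma Sol.VV_zero (S : Sol Γ F f T U φ) (hT : 0 < T) {R : ℝ} (h : ∀ t ∈ Icc 0 T, ∀ x ∈ Sph n, φ (t, x) = R⁻¹)
    {t : ℝ} (ht : t ∈ Icc 0 T) {x : E (n + 1)} (hx : x ∈ Sph n) : VV φ (t, x) = 0 := by
  have h1 := (S.logderiv (S.mem t ht x (sph_ne x hx))).hasDerivWithinAt (s := Icc 0 T)
  have h2 : HasDerivWithinAt (fun s => - Real.log (φ (s, x))) 0 (Icc 0 T) t :=
    (hasDerivWithinAt_const t _ (- Real.log R⁻¹)).congr (fun s hs => by rw [h s hs x hx]) (by rw [h t ht x hx])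
  exact (uniqueDiffOn_Icc hT t ht).eq_deriv _ h1 h2

set_option synthInstance.maxHeartbeats 200000 in
set_option maxSynthPendingDepth 3 in
lemma f_hess_bdd (hf : GoodPrescribed f k r₁ r₂) (h : 0 < R₁) : ∃ B, 0 ≤ B ∧ ∀ X ∈ An n R₁ R₂, ∀ v : E (n + 1), ‖v‖ = 1 →
    dd v (dd v f) X ≤ B := by
  have hc : ContinuousOn (fun X => fderiv ℝ (fderiv ℝ f) X) (An n R₁ R₂) :=
    ((sm_fderiv ne_open hf.1).continuousOn_fderiv_of_isOpen ne_open (by simp)).mono fun X hX => An_ne h hX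
  obtain ⟨B, hB⟩ := (An_compact (n := n) R₁ R₂).exists_bound_of_continuousOn
    (E := E (n + 1) →L[ℝ] E (n + 1) →L[ℝ] ℝ) hc
  refine ⟨max B 0, le_max_right _ _, fun X hX v hv => ?_⟩
  rw [dd_dd ne_open hf.1 (An_ne h hX)]
  have h1 := (fderiv ℝ (fderiv ℝ f) X).le_opNorm₂ v v
  rw [hv, mul_one, mul_one] at h1
  exact (le_abs_self _).trans (h1.trans ((hB X hX).trans (le_max_left _ _)))

/-- lower bound for the good coefficient -/
lemma Sol.good (S : Sol Γ F f T U φ) (hk : 0 < k) (hΓ : GoodCone Γ) (hF : GoodF Γ F k) (hf : GoodPrescribed f k r₁ r₂)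
    (hT : 0 < T) (hR1 : 0 < R₁) (hR : R₁ ≤ R₂)
    (hlo : ∀ t ∈ Icc 0 T, ∀ x ∈ Sph n, R₂⁻¹ ≤ φ (t, x)) (hhi : ∀ t ∈ Icc 0 T, ∀ x ∈ Sph n, φ (t, x) ≤ R₁⁻¹)
    {m c₀ : ℝ} (hm : 0 < m) (hmf : ∀ X ∈ An n R₁ R₂, m ≤ f X)
    (hV1 : k ≤ 1 → ∀ x ∈ Sph n, 0 ≤ VV φ (0, x))
    (hV2 : 1 < k → ∀ x ∈ Sph n, VV φ (0, x) ≤ 0 ∧ - VV φ (0, x) ≤ k * m / ((k + 1) * R₂))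
    (hc1 : c₀ ≤ k * m) (hc2 : R₁ < R₂ → c₀ ≤ k * m * (1 - R₁ / R₂)) :
    (∀ t ∈ Icc 0 T, ∀ x ∈ Sph n, (k - 1) * SS φ (t, x) ≤ 0) ∧
    ∀ t ∈ Icc 0 T, ∀ x ∈ Sph n, c₀ ≤ k * f ((φ (t, x))⁻¹ • x) + (k + 1) * SS φ (t, x) := by
  have hR2 : 0 < R₂ := hR1.trans_le hR
  have hSV : ∀ t ∈ Icc 0 T, ∀ x ∈ Sph n, SS φ (t, x) = VV φ (t, x) / ‖pV φ (t, x)‖ := fun t ht x hx => by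
    have m := S.mem t ht x (sph_ne x hx)
    have := S.p_pos m
    rw [S.VV_eq m]; field_simp
  have hXA : ∀ t ∈ Icc 0 T, ∀ x ∈ Sph n, ‖(φ (t, x))⁻¹ • x‖ = (φ (t, x))⁻¹ ∧ R₁ ≤ (φ (t, x))⁻¹ ∧ (φ (t, x))⁻¹ ≤ R₂ :=
    fun t ht x hx => by
    have hp := S.pos _ (S.mem t ht x (sph_ne x hx))
    have hx1 : ‖x‖ = 1 := by simpa using hx
    refine ⟨by rw [norm_smul, hx1, mul_one, Real.norm_eq_abs, abs_of_pos (inv_pos.2 hp)], ?_, ?_⟩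
    · exact (le_inv_comm₀ hp hR1).1 (hhi t ht x hx)
    · exact (inv_le_comm₀ hR2 hp).1 (hlo t ht x hx)
  rcases le_or_gt k 1 with hk1 | hk1
  · have hV := S.E1a hΓ hF hf hT hk1 (hV1 hk1)
    have hS : ∀ t ∈ Icc 0 T, ∀ x ∈ Sph n, 0 ≤ SS φ (t, x) := fun t ht x hx => by
      rw [hSV t ht x hx]; exact div_nonneg (hV t ht x hx) (norm_nonneg _)
    refine ⟨fun t ht x hx => mul_nonpos_of_nonpos_of_nonneg (by linarith) (hS t ht x hx), fun t ht x hx => ?_⟩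
    obtain ⟨a1, a2, a3⟩ := hXA t ht x hx
    have h1 := hmf _ (show (φ (t, x))⁻¹ • x ∈ An n R₁ R₂ from ⟨by rw [a1]; exact a2, by rw [a1]; exact a3⟩)
    have h2 := hS t ht x hx
    nlinarith
  · have hV := S.E1c hΓ hF hf hT hk1.le (fun x hx => (hV2 hk1 x hx).1)
    have hW := S.E1d hΓ hF hf hT hk1.le (fun x hx => (hV2 hk1 x hx).1) (m := k * m / ((k + 1) * R₂)) (by positivity)
      (fun x hx => (hV2 hk1 x hx).2)
    have hS : ∀ t ∈ Icc 0 T, ∀ x ∈ Sph n, SS φ (t, x) ≤ 0 := fun t ht x hx => by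
      rw [hSV t ht x hx]; exact div_nonpos_of_nonpos_of_nonneg (hV t ht x hx) (norm_nonneg _)
    refine ⟨fun t ht x hx => mul_nonpos_of_nonneg_of_nonpos (by linarith) (hS t ht x hx), fun t ht x hx => ?_⟩
    obtain ⟨a1, a2, a3⟩ := hXA t ht x hx
    rcases hR.lt_or_eq with hlt | heq
    · refine (hc2 hlt).trans ?_
      have mm := S.mem t ht x (sph_ne x hx)
      have hp := S.pos _ mm
      have hP := S.p_pos mm
      have hx1 : ‖x‖ = 1 := by simpa using hx
      have hPφ : φ (t, x) ≤ ‖pV φ (t, x)‖ := by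
        have := real_inner_le_norm (pV φ (t, x)) x
        rw [S.inner_pX mm, hx1, mul_one] at this
        exact this
      set c := (φ (t, x))⁻¹ with hc
      have hc0 : 0 < c := inv_pos.2 hp
      have hS1 : - SS φ (t, x) ≤ k * m / ((k + 1) * R₂) * c := by
        rw [hSV t ht x hx, ← neg_div, div_eq_mul_inv]
        refine mul_le_mul (hW t ht x hx) ?_ (by positivity) (by positivity)
        rw [hc]; exact inv_anti₀ hp hPφ
      have hf1 : c / R₁ * m ≤ f (c • x) := by
        have hZ : R₁ • x ∈ An n R₁ R₂ := by
          have : ‖R₁ • x‖ = R₁ := by rw [norm_smul, hx1, mul_one, Real.norm_eq_abs, abs_of_pos hR1]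
          exact ⟨this.ge, by rw [this]; exact hR⟩
        have h1 : 1 ≤ c / R₁ := (one_le_div hR1).2 a2
        have h2 := f_scale hf h1 (An_ne hR1 hZ)
        rw [smul_smul, div_mul_cancel₀ _ hR1.ne'] at h2
        refine le_trans ?_ h2
        refine mul_le_mul ?_ (hmf _ hZ) hm.le (by positivity)
        calc c / R₁ = (c / R₁) ^ (1 : ℝ) := (Real.rpow_one _).symm
          _ ≤ _ := Real.rpow_le_rpow_of_exponent_le h1 hk1.le
      have e1 : (k + 1) * (k * m / ((k + 1) * R₂) * c) = k * m * c / R₂ := by field_simp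
      have h3 : (k + 1) * - SS φ (t, x) ≤ k * m * c / R₂ := by
        rw [← e1]; exact mul_le_mul_of_nonneg_left hS1 (by linarith)
      have h4 : k * (c / R₁ * m) ≤ k * f (c • x) := mul_le_mul_of_nonneg_left hf1 hk.le
      have h5 : k * m * (1 - R₁ / R₂) ≤ k * (c / R₁ * m) - k * m * c / R₂ := by
        have : k * (c / R₁ * m) - k * m * c / R₂ - k * m * (1 - R₁ / R₂) = k * m * ((c - R₁) * (R₂ - R₁) / (R₁ * R₂)) := by
          field_simp
        have h6 : 0 ≤ k * m * ((c - R₁) * (R₂ - R₁) / (R₁ * R₂)) := by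
          have : 0 ≤ (c - R₁) * (R₂ - R₁) := mul_nonneg (by linarith) (by linarith)
          positivity
        linarith
      linarith
    · have h0 := S.VV_zero hT (R := R₁) (fun t ht x hx => le_antisymm (hhi t ht x hx) (by rw [heq]; exact hlo t ht x hx)) ht hx
      have h1 := hmf _ (show (φ (t, x))⁻¹ • x ∈ An n R₁ R₂ from ⟨by rw [a1]; exact a2, by rw [a1]; exact a3⟩)
      rw [hSV t ht x hx, h0, zero_div, mul_zero, add_zero]
      nlinarith

lemma Sol.main (S : Sol Γ F f T U φ) (hn : 2 ≤ n) (hk : 0 < k) (hΓ : GoodCone Γ) (hF : GoodF Γ F k)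
    (hf : GoodPrescribed f k r₁ r₂)
    (hT : 0 < T) (hR1 : 0 < R₁) (hR : R₁ ≤ R₂) (hRr : R₁ ≤ r₁) (hRr2 : r₂ ≤ R₂)
    (hlo0 : ∀ x ∈ Sph n, R₂⁻¹ ≤ φ (0, x)) (hhi0 : ∀ x ∈ Sph n, φ (0, x) ≤ R₁⁻¹)
    {m c₀ Mf B : ℝ} (hm : 0 < m) (hmf : ∀ X ∈ An n R₁ R₂, m ≤ f X)
    (hV1 : k ≤ 1 → ∀ x ∈ Sph n, 0 ≤ VV φ (0, x))
    (hV2 : 1 < k → ∀ x ∈ Sph n, VV φ (0, x) ≤ 0 ∧ - VV φ (0, x) ≤ k * m / ((k + 1) * R₂))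
    (hc0 : 0 < c₀) (hc1 : c₀ ≤ k * m) (hc2 : R₁ < R₂ → c₀ ≤ k * m * (1 - R₁ / R₂))
    {d L Λ : ℝ} (hd : 0 < d) (hd2 : ∀ Z ∈ An n R₁ R₂, ∀ c, 1 ≤ c → c * ‖Z‖ ≤ R₂ → c ^ (k + d) * f Z ≤ f (c • Z))
    (hL : 0 ≤ L) (hL2 : ∀ Z ∈ An n R₁ R₂, ∀ Z' ∈ An n R₁ R₂, f Z ≤ Real.exp (L * ‖Z - Z'‖) * f Z')
    (hΛ0 : 0 ≤ Λ) (hΛ : L * R₂ ≤ Λ * d)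
    (hini : ∀ x ∈ Sph n, ∀ y ∈ Sph n, - Real.log (φ (0, y)) - - Real.log (φ (0, x)) ≤ Λ * ‖y - x‖)
    (hMf : ∀ X ∈ An n R₁ R₂, f X ≤ Mf) (hB0 : 0 ≤ B)
    (hB : ∀ X ∈ An n R₁ R₂, ∀ v : E (n + 1), ‖v‖ = 1 → dd v (dd v f) X ≤ B)
    {M₀ : ℝ} (hM1 : 1 ≤ M₀) (hM2 : k * Mf + B ≤ c₀ * (R₁ / (1 + 4 * Λ)) ^ 2 * M₀)
    (hM3 : ∀ q ∈ KK n, Wf φ 0 q.1 q.2 ≤ M₀)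
    {t : ℝ} (ht : t ∈ Icc 0 T) {x : E (n + 1)} (hx : x ∈ Sph n) {κ : Fin n → ℝ} {e : Fin n → E (n + 1)}
    (hdd : IsData (pV φ (t, x)) ((φ (t, x) / ‖pV φ (t, x)‖) • HB φ (t, x)) κ e) (i : Fin n) : |κ i| ≤ n * (M₀ * R₂) := by
  have hR2 : 0 < R₂ := hR1.trans_le hR
  have hlo := S.E0max hΓ hF hf hT hRr2 hlo0
  have hhi := S.E0min hΓ hF hf hT hR1 hRr hhi0
  obtain ⟨hS, hg⟩ := S.good hk hΓ hF hf hT hR1 hR hlo hhi hm hmf hV1 hV2 hc1 hc2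
  have hrot := S.E2rot hΓ hF hf hT hR1 hlo hR2 hhi hS hd hd2 hL hL2 hΛ0 hΛ hini
  have hgr : ∀ t ∈ Icc 0 T, ∀ x ∈ Sph n, ‖pV φ (t, x)‖ ≤ (1 + 4 * Λ) * φ (t, x) := fun t ht x hx =>
    S.E2 ht hΛ0 (fun R δ h1 h2 x hx => hrot R h1 h2 t ht x hx) hx
  refine S.curv_bound hn hΓ (by linarith) ht ?_ hR2 hx (hlo t ht x hx) hdd i
  refine S.E3 hk hΓ hF hf hT (by linarith) hM3 ?_ t ht
  clear! t x κ
  intro t ht X hX hφ v hv M hM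
  have c0 := norm_pos_iff.2 hX
  obtain ⟨x, hx, hxX⟩ : ∃ x : E (n + 1), ‖x‖ = 1 ∧ X = ‖X‖ • x :=
    ⟨‖X‖⁻¹ • X, by rw [norm_smul]; simp; field_simp, by rw [smul_smul, mul_inv_cancel₀ c0.ne', one_smul]⟩
  have hx' : x ∈ Sph n := by simpa using hx
  have mx := S.mem t ht x (sph_ne x hx')
  have mX := S.mem t ht X hX
  have ep : pV φ (t, X) = pV φ (t, x) := by
    conv_lhs => rw [hxX]
    exact S.p_hom mx c0
  have eV : VV φ (t, X) = VV φ (t, x) := by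
    conv_lhs => rw [hxX]
    exact S.VV_hom mx c0
  have hP := S.p_pos mx
  have eS : SS φ (t, X) = SS φ (t, x) := by
    rw [S.VV_eq mX, S.VV_eq mx, ep] at eV
    exact mul_left_cancel₀ hP.ne' eV
  have eφ : φ (t, x) = ‖X‖⁻¹ := by
    have h1 := S.hom _ c0 t x mx
    rw [← hxX, hφ] at h1
    exact eq_inv_of_mul_eq_one_right h1.symm
  have hXn : (φ (t, x))⁻¹ • x = X := by rw [eφ, inv_inv]; exact hxX.symm
  have hA : X ∈ An n R₁ R₂ := by
    have h1 := hlo t ht x hx'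
    have h2 := hhi t ht x hx'
    rw [eφ] at h1 h2
    exact ⟨(inv_le_inv₀ c0 hR1).1 h2, (inv_le_inv₀ hR2 c0).1 h1⟩
  have g1 := hg t ht x hx'
  rw [hXn] at g1
  have g2 := hS t ht x hx'
  have g3 : R₁ / (1 + 4 * Λ) ≤ ‖pV φ (t, x)‖⁻¹ := by
    have h1 := hgr t ht x hx'
    have h2 := hhi t ht x hx'
    rw [← inv_div]
    refine inv_anti₀ hP (h1.trans ?_)
    rw [div_eq_mul_inv]
    exact mul_le_mul_of_nonneg_left h2 (by positivity)
  have hq : QQ f φ (t, X) = f X + SS φ (t, x) := by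
    unfold QQ; rw [hφ, eS]; simp
  rw [hq, eS, ep]
  have g4 := hMf X hA
  have g5 := hB X hA v hv
  have M0 : 0 < M := by linarith
  have w0 : 0 < R₁ / (1 + 4 * Λ) := by positivity
  have g6 : (R₁ / (1 + 4 * Λ)) ^ 2 * M ^ 2 ≤ ‖pV φ (t, x)‖⁻¹ ^ 2 * M ^ 2 := by gcongr
  have g7 : c₀ * ((R₁ / (1 + 4 * Λ)) ^ 2 * M ^ 2) ≤ (k * (f X + SS φ (t, x)) + SS φ (t, x)) * (‖pV φ (t, x)‖⁻¹ ^ 2 * M ^ 2) :=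
    mul_le_mul (by linarith) g6 (by positivity) (by linarith)
  have g8 : (k * (f X + SS φ (t, x)) - SS φ (t, x)) * M ≤ k * Mf * M := by
    refine mul_le_mul_of_nonneg_right ?_ M0.le
    have := mul_le_mul_of_nonneg_left g4 hk.le
    linarith
  have w1 : 0 < c₀ * (R₁ / (1 + 4 * Λ)) ^ 2 := by positivity
  have g9 : k * Mf + B ≤ c₀ * (R₁ / (1 + 4 * Λ)) ^ 2 * M := hM2.trans (mul_le_mul_of_nonneg_left hM.le w1.le)
  have g10 := mul_le_mul_of_nonneg_right g9 M0.le
  have g11 : B ≤ B * M := le_mul_of_one_le_right hB0 (by linarith)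
  nlinarith
end

/-- Proposition 4.1, curvature estimate: under condition (4.1) on the
initial datum, there is `C > 0` depending only on the data bounding all the principal
curvatures of any admissible solution of the flow. -/
theorem stmt15 (n : ℕ) (hn : 2 ≤ n) (Γ : Set (Fin n → ℝ)) (hΓ : GoodCone Γ)
    (F : (Fin n → ℝ) → ℝ) (k : ℝ) (hk : 0 < k) (hF : GoodF Γ F k)
    (hFb : FVanishesOnBoundary Γ F)
    (f : E (n + 1) → ℝ) (r₁ r₂ : ℝ) (hf : GoodPrescribed f k r₁ r₂)
    (ρ₀ : E (n + 1) → ℝ) (hρ₀ : GoodInit ρ₀) (hadm : Admissible Γ ρ₀)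
    (hc₁ : k ≤ 1 → ∀ x : E (n + 1), ‖x‖ = 1 → ∀ κ : Fin n → ℝ,
      HasPrincCurv ρ₀ x κ → 0 ≤ calF F f ρ₀ x κ)
    (hc₂ : 1 < k → ∀ x : E (n + 1), ‖x‖ = 1 → ∀ κ : Fin n → ℝ,
      HasPrincCurv ρ₀ x κ →
        calF F f ρ₀ x κ ≤ 0 ∧
        -calF F f ρ₀ x κ ≤
          k * min r₁ (sphMin ρ₀) / ((k + 1) * max r₂ (sphMax ρ₀)) *
            sInf (f '' {Y : E (n + 1) |
              min r₁ (sphMin ρ₀) ≤ ‖Y‖ ∧ ‖Y‖ ≤ max r₂ (sphMax ρ₀)})) :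
    ∃ C : ℝ, 0 < C ∧
      ∀ T : ℝ, 0 < T → ∀ ρ : ℝ → E (n + 1) → ℝ, IsFlowSol Γ F f T ρ ρ₀ →
        ∀ t ∈ Icc (0 : ℝ) T, ∀ x : E (n + 1), ‖x‖ = 1 → ∀ κ : Fin n → ℝ,
          HasPrincCurv (ρ t) x κ → ∀ i, |κ i| ≤ C := by
  by_cases hex : ∃ T : ℝ, 0 < T ∧ ∃ ρ : ℝ → E (n + 1) → ℝ, IsFlowSol Γ F f T ρ ρ₀
  swap
  · exact ⟨1, one_pos, fun T hT ρ h => (hex ⟨T, hT, ρ, h⟩).elim⟩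
  obtain ⟨T', hT', ρ', h'⟩ := hex
  have S' := gau_sol h'
  -- the initial datum
  have hpos : ∀ y : E (n + 1), y ≠ 0 → 0 < ρ₀ y := fun y hy => by
    have hY0 := norm_pos_iff.2 hy
    rw [← hρ₀.2.1 ‖y‖⁻¹ (by positivity)]
    exact hρ₀.2.2 _ (by rw [norm_smul]; simp; field_simp)
  have hSph : {x : E (n + 1) | ‖x‖ = 1} = Sph n := by ext x; simp
  have hcpt : IsCompact (Sph n) := isCompact_sphere _ _
  have hcont : ContinuousOn ρ₀ (Sph n) := hρ₀.1.continuousOn.mono fun x hx => sph_ne x hx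
  have himg : IsCompact (ρ₀ '' Sph n) := hcpt.image_of_continuousOn hcont
  have hne : (Sph n).Nonempty := ⟨EuclideanSpace.single 0 1, by simp⟩
  have hmin : ∀ x ∈ Sph n, sphMin ρ₀ ≤ ρ₀ x := fun x hx => by
    unfold sphMin; rw [hSph]; exact csInf_le himg.bddBelow ⟨x, hx, rfl⟩
  have hmax : ∀ x ∈ Sph n, ρ₀ x ≤ sphMax ρ₀ := fun x hx => by
    unfold sphMax; rw [hSph]; exact le_csSup himg.bddAbove ⟨x, hx, rfl⟩
  have hmin0 : 0 < sphMin ρ₀ := by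
    obtain ⟨x, hx, he⟩ := himg.sInf_mem (hne.image _)
    unfold sphMin; rw [hSph, ← he]; exact hpos x (sph_ne x hx)
  set R₁ := min r₁ (sphMin ρ₀) with hR₁
  set R₂ := max r₂ (sphMax ρ₀) with hR₂
  have hR1 : 0 < R₁ := lt_min hf.2.2.2.1 hmin0
  have hR : R₁ ≤ R₂ := (min_le_left _ _).trans (hf.2.2.2.2.1.trans (le_max_left _ _))
  have hR2 : 0 < R₂ := hR1.trans_le hR
  have hρ1 : ∀ x ∈ Sph n, R₁ ≤ ρ₀ x := fun x hx => (min_le_right _ _).trans (hmin x hx)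
  have hρ2 : ∀ x ∈ Sph n, ρ₀ x ≤ R₂ := fun x hx => (hmax x hx).trans (le_max_right _ _)
  -- constants from `f`
  have hfc : ContinuousOn f (An n R₁ R₂) := hf.1.continuousOn.mono fun X hX => An_ne hR1 hX
  have hfi : IsCompact (f '' An n R₁ R₂) := (An_compact R₁ R₂).image_of_continuousOn hfc
  obtain ⟨x₁, hx₁⟩ := hne
  have hAne : (An n R₁ R₂).Nonempty := by
    have : ‖R₁ • x₁‖ = R₁ := by
      rw [norm_smul, show ‖x₁‖ = 1 by simpa using hx₁, mul_one, Real.norm_eq_abs, abs_of_pos hR1]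
    exact ⟨R₁ • x₁, this.ge, by rw [this]; exact hR⟩
  have hAn : {Y : E (n + 1) | R₁ ≤ ‖Y‖ ∧ ‖Y‖ ≤ R₂} = An n R₁ R₂ := rfl
  rw [hAn] at hc₂
  set m := sInf (f '' An n R₁ R₂) with hm
  have hm0 : 0 < m := by
    obtain ⟨X, hX, he⟩ := hfi.sInf_mem (hAne.image _)
    rw [hm, ← he]; exact hf.2.1 X (An_ne hR1 hX)
  have hmf : ∀ X ∈ An n R₁ R₂, m ≤ f X := fun X hX => csInf_le hfi.bddBelow ⟨X, hX, rfl⟩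
  obtain ⟨Mf, hMf⟩ := hfi.bddAbove
  obtain ⟨B, hB0, hB⟩ := f_hess_bdd (R₂ := R₂) hf hR1
  obtain ⟨d, hd, hd2⟩ := f_strict (R₂ := R₂) hf hR1
  obtain ⟨L, hL, hL2⟩ := f_lip (R₂ := R₂) hf hR1
  obtain ⟨c₀, hc0, hc1, hc2⟩ : ∃ c₀ : ℝ, 0 < c₀ ∧ c₀ ≤ k * m ∧ (R₁ < R₂ → c₀ ≤ k * m * (1 - R₁ / R₂)) := by
    rcases hR.lt_or_eq with h1 | h1
    · have h2 : 0 < 1 - R₁ / R₂ := by rw [sub_pos, div_lt_one hR2]; exact h1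
      have h3 : 0 < R₁ / R₂ := by positivity
      refine ⟨k * m * (1 - R₁ / R₂), by positivity, ?_, fun _ => le_rfl⟩
      exact mul_le_of_le_one_right (by positivity) (by linarith)
    · exact ⟨k * m, by positivity, le_rfl, fun h2 => (h2.ne h1).elim⟩
  obtain ⟨Λ₁, hΛ₁, hlip⟩ := lip_compact ne_open (hρ₀.1.log fun y hy => (hpos y hy).ne') hcpt
    (fun x hx => sph_ne x hx)
  set Λ := max Λ₁ (L * R₂ / d) with hΛd
  have hΛ0 : 0 ≤ Λ := hΛ₁.trans (le_max_left _ _)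
  have hΛ : L * R₂ ≤ Λ * d := (div_le_iff₀ hd).1 (le_max_right _ _)
  obtain ⟨W, hW⟩ := (KK_compact n).bddAbove_image (f := fun q => Wf (gau ρ') 0 q.1 q.2)
    (S'.Wf_cont.comp (f := fun q : E (n + 1) × E (n + 1) => ((0 : ℝ), q)) (by fun_prop)
      (fun q hq => ⟨⟨le_rfl, hT'.le⟩, hq⟩))
  set w := c₀ * (R₁ / (1 + 4 * Λ)) ^ 2 with hw
  have hw0 : 0 < w := by positivity
  set M₀ := max (max 1 W) ((k * Mf + B) / w) with hM₀
  have hM1 : 1 ≤ M₀ := (le_max_left _ _).trans (le_max_left _ _)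
  refine ⟨n * (M₀ * R₂) + 1, by positivity, fun T hT ρ h t ht x hx κ hκ i => ?_⟩
  have S := gau_sol h
  have z : (0 : ℝ) ∈ Icc 0 T := ⟨le_rfl, hT.le⟩
  have h00 : ∀ (T : ℝ), 0 < T → ∀ ρ : ℝ → E (n + 1) → ℝ, IsFlowSol Γ F f T ρ ρ₀ → ∀ y : E (n + 1), y ≠ 0 → ρ 0 y = ρ₀ y :=
    fun T hT ρ h y hy => by
    have hY0 := norm_pos_iff.2 hy
    rw [← hρ₀.2.1 ‖y‖⁻¹ (by positivity), ← h.2.1 0 ⟨le_rfl, hT.le⟩ ‖y‖⁻¹ (by positivity)]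
    exact h.2.2.2.2.2 _ (by rw [norm_smul]; simp; field_simp)
  have hφ0 : ∀ x ∈ Sph n, gau ρ (0, x) = (ρ₀ x)⁻¹ := fun x hx => by
    rw [gau_unit (by simpa using hx), h00 T hT ρ h x (sph_ne x hx)]
  have hVV : ∀ x ∈ Sph n, ∃ κ, HasPrincCurv ρ₀ x κ ∧ VV (gau ρ) (0, x) = calF F f ρ₀ x κ / ρ₀ x := fun x hx => by
    have hx1 : ‖x‖ = 1 := by simpa using hx
    obtain ⟨κ, -, hκ⟩ := h.2.2.2.1 0 z x hx1
    have hev : ρ 0 =ᶠ[nhds x] ρ₀ := Filter.eventually_of_mem (ne_open.mem_nhds (sph_ne x hx)) (h00 T hT ρ h)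
    obtain ⟨a, b⟩ := curv_congr hev hκ F f
    refine ⟨κ, a, ?_⟩
    rw [(gau_rho h z hx1 hκ).1, b, h00 T hT ρ h x (sph_ne x hx)]
  obtain ⟨e, he⟩ := (S.rad_data (gau_slice h t) (gau_mul h ht) hx (gau_mem h ht (by rintro rfl; simp at hx))).2 κ hκ
  refine le_trans (S.main (r₁ := r₁) (r₂ := r₂) (R₁ := R₁) (Mf := Mf) (B := B) hn hk hΓ hF hf hT hR1 hR (min_le_left _ _) (le_max_left _ _) ?_ ?_ hm0 hmf ?_ ?_ hc0 hc1 hc2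
    hd hd2 hL hL2 hΛ0 hΛ ?_ (fun X hX => hMf ⟨X, hX, rfl⟩) hB0 hB hM1 ?_ ?_ ht (by simpa using hx) he i) (by linarith)
  · intro x hx
    rw [hφ0 x hx]; exact inv_anti₀ (hpos x (sph_ne x hx)) (hρ2 x hx)
  · intro x hx
    rw [hφ0 x hx]; exact inv_anti₀ hR1 (hρ1 x hx)
  · intro hk1 x hx
    obtain ⟨κ, h1, h2⟩ := hVV x hx
    rw [h2]
    exact div_nonneg (hc₁ hk1 x (by simpa using hx) κ h1) (hpos x (sph_ne x hx)).le
  · intro hk1 x hx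
    obtain ⟨κ, h1, h2⟩ := hVV x hx
    obtain ⟨h3, h4⟩ := hc₂ hk1 x (by simpa using hx) κ h1
    have hp := hpos x (sph_ne x hx)
    rw [h2]
    refine ⟨div_nonpos_of_nonpos_of_nonneg h3 hp.le, ?_⟩
    rw [← neg_div, div_le_iff₀ hp]
    refine h4.trans ?_
    have : k * R₁ / ((k + 1) * R₂) * m = k * m / ((k + 1) * R₂) * R₁ := by ring
    rw [this]
    exact mul_le_mul_of_nonneg_left (hρ1 x hx) (by positivity)
  · intro x hx y hy
    rw [hφ0 x hx, hφ0 y hy, Real.log_inv, Real.log_inv, neg_neg, neg_neg]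
    exact (le_abs_self _).trans ((hlip y hy x hx).trans (mul_le_mul_of_nonneg_right (le_max_left _ _) (norm_nonneg _)))
  · rw [← hw, mul_comm w]
    exact (div_le_iff₀ hw0).1 (le_max_right _ _)
  · intro q hq
    have hq0 : q.1 ≠ 0 := fun h => by have := hq.1; rw [h] at this; simp at this
    rw [S.Wf0 hT S' hT' (fun Y hY => ?_) hq0]
    · exact (hW ⟨q, hq, rfl⟩).trans ((le_max_right _ _).trans (le_max_left _ _))
    · have h1 := gau_mul h z Y hY
      have h2 := gau_mul h' ⟨le_rfl, hT'.le⟩ Y hY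
      rw [h00 T hT ρ h Y hY] at h1
      rw [h00 T' hT' ρ' h' Y hY, ← h1] at h2
      exact (mul_right_cancel₀ (hpos Y hY).ne' h2).symm
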